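/- arXiv:2208.03850 — 5 statements merged into one kernel-verified Lean document; each statement's English description precedes it below -/
import Mathlib

section
/- Let r₀ > 0 and let f = f(r,z) be a C¹ function on (r₀,∞) × [-π,π] satisfying ∫_{-π}^{π} ∫_{r₀}^{∞} |∂_r f(r,z)|² r dr dz < ∞. Then lim_{r→∞} (1/log r) ∫_{-π}^{π} |f(r,z)|² dz = 0. -/
open MeasureTheory Real Set Filter Topology

noncomputable section

/-- Partial derivative in the first (radial) variable. -/
def dr (f : ℝ → ℝ → ℝ) (r z : ℝ) : ℝ := deriv (fun s => f s z) r

/-- Fundamental theorem of calculus and Cauchy–Schwarz with the weight `s`. -/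
theorem sq_sub_le_log_mul_integral {g g' : ℝ → ℝ} {a b : ℝ} (ha : 0 < a) (hab : a < b)
    (hderiv : ∀ s ∈ Icc a b, HasDerivAt g (g' s) s) (hcont : ContinuousOn g' (Icc a b)) :
    (g b - g a) ^ 2 ≤ (log b - log a) * ∫ s in a..b, g' s ^ 2 * s := by
  have hI : uIcc a b = Icc a b := uIcc_of_le hab.le
  have hne : ∀ s ∈ Icc a b, s ≠ 0 := fun s hs => (ha.trans_le hs.1).ne'
  have hinv : ContinuousOn (fun s : ℝ => s⁻¹) (Icc a b) := continuousOn_inv₀.mono hne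
  have hinv_int : IntervalIntegrable (fun s : ℝ => s⁻¹) volume a b :=
    (hI ▸ hinv).intervalIntegrable
  have hg'_int : IntervalIntegrable g' volume a b := (hI ▸ hcont).intervalIntegrable
  have hsq_int : IntervalIntegrable (fun s => g' s ^ 2 * s) volume a b :=
    (hI ▸ (hcont.pow 2).mul continuousOn_id).intervalIntegrable
  have hg' : ∫ s in a..b, g' s = g b - g a :=
    intervalIntegral.integral_eq_sub_of_hasDerivAt (fun s hs => hderiv s (hI ▸ hs)) hg'_int
  have hlog : ∫ s in a..b, s⁻¹ = log b - log a := by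
    rw [integral_inv_of_pos ha (ha.trans hab), log_div (ha.trans hab).ne' ha.ne']
  have hL : 0 < log b - log a := sub_pos.2 (log_lt_log ha hab)
  set L := log b - log a
  set D := g b - g a
  set B := ∫ s in a..b, g' s ^ 2 * s
  have hexpand : ∫ s in a..b, (g' s - D / L * s⁻¹) ^ 2 * s
      = B - 2 * (D / L) * D + (D / L) ^ 2 * L := by
    rw [← hg', ← hlog, ← intervalIntegral.integral_const_mul, ← intervalIntegral.integral_const_mul,
      ← intervalIntegral.integral_sub hsq_int (hg'_int.const_mul _),
      ← intervalIntegral.integral_add (hsq_int.sub (hg'_int.const_mul _)) (hinv_int.const_mul _)]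
    refine intervalIntegral.integral_congr fun s hs => ?_
    have := hne s (hI ▸ hs)
    field_simp
    ring
  have hnonneg : 0 ≤ ∫ s in a..b, (g' s - D / L * s⁻¹) ^ 2 * s :=
    intervalIntegral.integral_nonneg hab.le fun s hs =>
      mul_nonneg (sq_nonneg _) (ha.le.trans hs.1)
  have hmul : L * (B - 2 * (D / L) * D + (D / L) ^ 2 * L) = L * B - D ^ 2 := by
    field_simp
    ring
  have := mul_nonneg hL.le (hexpand ▸ hnonneg)
  linarith

theorem hasDerivAt_slice {r₀ : ℝ} {K : Set ℝ} {f : ℝ → ℝ → ℝ}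
    (hf : DifferentiableOn ℝ (fun w : ℝ × ℝ => f w.1 w.2) (Ioi r₀ ×ˢ K))
    {r z : ℝ} (hr : r₀ < r) (hz : z ∈ K) :
    HasDerivAt (fun s => f s z)
      (fderivWithin ℝ (fun w : ℝ × ℝ => f w.1 w.2) (Ioi r₀ ×ˢ K) (r, z) (1, 0)) r := by
  have hF := (hf (r, z) ⟨hr, hz⟩).hasFDerivWithinAt
  have hline : HasDerivWithinAt (fun s : ℝ => (s, z)) ((1 : ℝ), (0 : ℝ)) (Ioi r₀) r :=
    ((hasDerivAt_id r).prodMk (hasDerivAt_const r z)).hasDerivWithinAt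
  have hmaps : MapsTo (fun s : ℝ => (s, z)) (Ioi r₀) (Ioi r₀ ×ˢ K) := fun s hs => ⟨hs, hz⟩
  exact (hF.comp_hasDerivWithinAt r hline hmaps).hasDerivAt (Ioi_mem_nhds hr)

theorem continuousOn_dr {r₀ : ℝ} {K : Set ℝ} (hK : UniqueDiffOn ℝ K) {f : ℝ → ℝ → ℝ}
    (hf : ContDiffOn ℝ 1 (fun w : ℝ × ℝ => f w.1 w.2) (Ioi r₀ ×ˢ K)) :
    ContinuousOn (fun w : ℝ × ℝ => dr f w.1 w.2) (Ioi r₀ ×ˢ K) := by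
  have h := hf.continuousOn_fderivWithin ((uniqueDiffOn_Ioi r₀).prod hK) le_rfl
  refine (h.clm_apply (continuousOn_const (c := ((1 : ℝ), (0 : ℝ))))).congr fun w hw => ?_
  exact (hasDerivAt_slice (hf.differentiableOn one_ne_zero) hw.1 hw.2).deriv

theorem tendsto_setIntegral_Ioi_prod {r₀ : ℝ} {K : Set ℝ} (hK : MeasurableSet K) {G : ℝ × ℝ → ℝ}
    (hG : IntegrableOn G (Ioi r₀ ×ˢ K)) :
    Tendsto (fun a : ℝ => ∫ w in Ioi a ×ˢ K, G w) atTop (𝓝 0) := by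
  have h := tendsto_setIntegral_of_antitone (μ := volume) (f := G) (s := fun a : ℝ => Ioi a ×ˢ K)
    (fun a => measurableSet_Ioi.prod hK)
    (fun a b hab => prod_mono_left (Ioi_subset_Ioi hab)) ⟨r₀, hG⟩
  have hempty : ⋂ a : ℝ, Ioi a ×ˢ K = ∅ :=
    eq_empty_of_forall_notMem fun w hw => lt_irrefl w.1 (mem_iInter.1 hw w.1).1
  simpa [hempty] using h

/-- Growth of the `L²` norm of the slices from radius `a` to radius `r`. -/
theorem integral_sq_le_add_log_mul {r₀ a r : ℝ} {K : Set ℝ} (hK : IsCompact K)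
    (hKd : UniqueDiffOn ℝ K) {f : ℝ → ℝ → ℝ}
    (hf : ContDiffOn ℝ 1 (fun w : ℝ × ℝ => f w.1 w.2) (Ioi r₀ ×ˢ K))
    (hG : IntegrableOn (fun w : ℝ × ℝ => dr f w.1 w.2 ^ 2 * w.1) (Ioi r₀ ×ˢ K))
    (hra : r₀ < a) (ha : 0 < a) (har : a < r) :
    ∫ z in K, f r z ^ 2 ≤ 2 * (∫ z in K, f a z ^ 2) + 2 * ((log r - log a) *
      ∫ w : ℝ × ℝ in Ioi a ×ˢ K, dr f w.1 w.2 ^ 2 * w.1) := by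
  have hKm := hK.measurableSet
  have hslice : ∀ s, r₀ < s → IntegrableOn (fun z => f s z ^ 2) K := fun s hs =>
    ((hf.continuousOn.comp (f := fun z : ℝ => (s, z)) (by fun_prop)
      fun z hz => ⟨hs, hz⟩).pow 2).integrableOn_compact hK
  have hsub : Ioi a ×ˢ K ⊆ Ioi r₀ ×ˢ K := prod_mono_left (Ioi_subset_Ioi hra.le)
  have hGa := hG.mono_set hsub
  have hGr : IntegrableOn (fun w : ℝ × ℝ => dr f w.1 w.2 ^ 2 * w.1) (Ioc a r ×ˢ K) :=
    hGa.mono_set (prod_mono_left Ioc_subset_Ioi_self)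
  have hGprod : Integrable (fun w : ℝ × ℝ => dr f w.1 w.2 ^ 2 * w.1)
      ((volume.restrict (Ioc a r)).prod (volume.restrict K)) := by
    rwa [Measure.prod_restrict, ← Measure.volume_eq_prod]
  have hfubini : ∫ z in K, ∫ s in Ioc a r, dr f s z ^ 2 * s
      = ∫ w : ℝ × ℝ in Ioc a r ×ˢ K, dr f w.1 w.2 ^ 2 * w.1 := by
    rw [Measure.volume_eq_prod, ← Measure.prod_restrict, integral_prod_symm _ hGprod]
  have hle : ∫ w : ℝ × ℝ in Ioc a r ×ˢ K, dr f w.1 w.2 ^ 2 * w.1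
      ≤ ∫ w : ℝ × ℝ in Ioi a ×ˢ K, dr f w.1 w.2 ^ 2 * w.1 := by
    refine setIntegral_mono_set hGa ?_ (prod_mono_left Ioc_subset_Ioi_self).eventuallyLE
    filter_upwards [ae_restrict_mem (measurableSet_Ioi.prod hKm)] with w hw
    exact mul_nonneg (sq_nonneg _) (ha.trans hw.1).le
  have hpoint : ∀ z ∈ K, f r z ^ 2
      ≤ 2 * f a z ^ 2 + 2 * ((log r - log a) * ∫ s in Ioc a r, dr f s z ^ 2 * s) := by
    intro z hz
    have h := sq_sub_le_log_mul_integral (g := fun s => f s z) (g' := fun s => dr f s z) ha har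
      (fun s hs => (hasDerivAt_slice (hf.differentiableOn one_ne_zero)
        (hra.trans_le hs.1) hz).differentiableAt.hasDerivAt)
      ((continuousOn_dr hKd hf).comp (f := fun s : ℝ => (s, z)) (by fun_prop)
        fun s hs => ⟨hra.trans_le hs.1, hz⟩)
    rw [intervalIntegral.integral_of_le har.le] at h
    nlinarith [sq_nonneg (f r z - 2 * f a z)]
  have hint₁ := (hslice a hra).const_mul 2
  have hint₂ : IntegrableOn
      (fun z => 2 * ((log r - log a) * ∫ s in Ioc a r, dr f s z ^ 2 * s)) K :=
    (hGprod.integral_prod_right.const_mul _).const_mul _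
  calc ∫ z in K, f r z ^ 2
      ≤ ∫ z in K, (2 * f a z ^ 2 + 2 * ((log r - log a) * ∫ s in Ioc a r, dr f s z ^ 2 * s)) :=
        setIntegral_mono_on (hslice r (hra.trans har)) (hint₁.fun_add hint₂) hKm hpoint
    _ = 2 * (∫ z in K, f a z ^ 2) + 2 * ((log r - log a) *
          ∫ w : ℝ × ℝ in Ioc a r ×ˢ K, dr f w.1 w.2 ^ 2 * w.1) := by
        rw [integral_add hint₁ hint₂, integral_const_mul, integral_const_mul, integral_const_mul,
          hfubini]
    _ ≤ _ := by
        have := log_lt_log ha har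
        gcongr

/-- the Gilbarg–Weinberger type estimate, Lemma 2.2 of the paper. -/
theorem log_average_decay (r₀ : ℝ) (hr₀ : 0 < r₀) (f : ℝ → ℝ → ℝ)
    (hf : ContDiffOn ℝ 1 (fun w : ℝ × ℝ => f w.1 w.2) (Ioi r₀ ×ˢ Icc (-π) π))
    (hint : ∫⁻ w : ℝ × ℝ in Ioi r₀ ×ˢ Icc (-π) π,
      ENNReal.ofReal ((dr f w.1 w.2) ^ 2 * w.1) < ⊤) :
    Tendsto (fun r : ℝ => (1 / Real.log r) * ∫ z in Icc (-π) π, (f r z) ^ 2)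
      atTop (𝓝 0) := by
  have hKd : UniqueDiffOn ℝ (Icc (-π) π) := uniqueDiffOn_Icc (by linarith [pi_pos])
  have hS : MeasurableSet (Ioi r₀ ×ˢ Icc (-π) π) := measurableSet_Ioi.prod measurableSet_Icc
  have hG : IntegrableOn (fun w : ℝ × ℝ => dr f w.1 w.2 ^ 2 * w.1) (Ioi r₀ ×ˢ Icc (-π) π) := by
    refine ⟨(((continuousOn_dr hKd hf).pow 2).mul continuousOn_fst).aestronglyMeasurable hS, ?_⟩
    rw [hasFiniteIntegral_iff_ofReal]
    · exact hint
    · filter_upwards [ae_restrict_mem hS] with w hw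
      exact mul_nonneg (sq_nonneg _) (hr₀.trans hw.1).le
  rw [Metric.tendsto_nhds]
  intro ε hε
  obtain ⟨a, hE, hra, ha⟩ :=
    (((tendsto_setIntegral_Ioi_prod measurableSet_Icc hG).eventually_lt_const
      (show (0 : ℝ) < ε / 4 by linarith)).and
      ((eventually_gt_atTop r₀).and (eventually_ge_atTop 1))).exists
  set C := ∫ z in Icc (-π) π, f a z ^ 2
  filter_upwards [eventually_gt_atTop a, tendsto_log_atTop.eventually_gt_atTop (4 * C / ε),
    tendsto_log_atTop.eventually_gt_atTop 0] with r har hrC hlog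
  have hbound := integral_sq_le_add_log_mul isCompact_Icc hKd hf hG hra (by linarith) har
  have hnonneg : 0 ≤ ∫ z in Icc (-π) π, f r z ^ 2 := integral_nonneg fun z => sq_nonneg _
  have hloga : 0 ≤ log a := log_nonneg ha
  have hlogle : 0 < log r - log a := sub_pos.2 (log_lt_log (by linarith) har)
  rw [div_lt_iff₀ hε] at hrC
  rw [dist_zero_right, norm_of_nonneg (by positivity), one_div, inv_mul_lt_iff₀ hlog]
  have h := mul_lt_mul_of_pos_left hE hlogle
  nlinarith [mul_nonneg hloga hε.le]
end
end

section
/- Let (r₁,z₁), (r₂,z₂) ∈ [R/4, 4R] × [-π,π] with R > 4r₀, and let q ∈ (2,∞). If f is a C¹ function on [r₀,∞) × [-π,π] with ∫_{-π}^{π} ∫_{r₀}^{∞} |∇_{r,z} f(r,z)|^q r dr dz < ∞, then |f(r₁,z₁) − f(r₂,z₂)| ≤ C R^{1−2/q} ( ∫_{-π}^{π} ∫_{r₀}^{∞} |∇_{r,z} f(r,z)|^q r dr dz )^{1/q}, where the constant C depends only on q and r₀ and is independent of R. -/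
open MeasureTheory Real Set Filter Topology

noncomputable section

/-- Partial derivative in the second (vertical) variable. -/
def dzz (f : ℝ → ℝ → ℝ) (r z : ℝ) : ℝ := deriv (fun t => f r t) z

open scoped ENNReal

section Morrey

variable {E : Type*} [NormedAddCommGroup E] [NormedSpace ℝ E]

/-- Integrating the derivative along a segment bounds the increment of a `C¹` function. -/
lemma enorm_sub_le_lintegral_fderiv_segment {U : Set E} (hU : IsOpen U) (hconv : Convex ℝ U)
    {f : E → ℝ} (hf : ContDiffOn ℝ 1 f U) {a y : E} (ha : a ∈ U) (hy : y ∈ U) :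
    ‖f y - f a‖ₑ ≤ ∫⁻ t in Ioo (0 : ℝ) 1, ‖fderiv ℝ f (a + t • (y - a))‖ₑ * ‖y - a‖ₑ := by
  have hmem : ∀ t ∈ Icc (0 : ℝ) 1, a + t • (y - a) ∈ U := fun t ht =>
    hconv.add_smul_sub_mem ha hy ht
  have hpath : Continuous fun t : ℝ => a + t • (y - a) := by fun_prop
  have hderiv : ∀ t ∈ uIcc (0 : ℝ) 1, HasDerivAt (fun t : ℝ => f (a + t • (y - a)))
      (fderiv ℝ f (a + t • (y - a)) (y - a)) t := by
    intro t ht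
    rw [uIcc_of_le zero_le_one] at ht
    have hd : HasFDerivAt f (fderiv ℝ f (a + t • (y - a))) (a + t • (y - a)) :=
      ((hf.contDiffAt (hU.mem_nhds (hmem t ht))).differentiableAt one_ne_zero).hasFDerivAt
    have hl : HasDerivAt (fun t : ℝ => a + t • (y - a)) (y - a) t := by
      simpa using ((hasDerivAt_id t).smul_const (y - a)).const_add a
    exact hd.comp_hasDerivAt t hl
  have hcont : ContinuousOn (fun t : ℝ => fderiv ℝ f (a + t • (y - a)) (y - a))
      (uIcc (0 : ℝ) 1) := by
    rw [uIcc_of_le zero_le_one]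
    exact ((hf.continuousOn_fderiv_of_isOpen hU le_rfl).comp hpath.continuousOn hmem).clm_apply
      continuousOn_const
  have hftc := intervalIntegral.integral_eq_sub_of_hasDerivAt hderiv hcont.intervalIntegrable
  simp only [one_smul, zero_smul, add_zero, add_sub_cancel] at hftc
  rw [← hftc, intervalIntegral.integral_of_le zero_le_one, integral_Ioc_eq_integral_Ioo]
  exact (enorm_integral_le_lintegral_enorm _).trans
    (lintegral_mono fun t => ContinuousLinearMap.le_opENorm _ _)

variable [MeasurableSpace E] [BorelSpace E] [FiniteDimensional ℝ E]
  (μ : Measure E) [μ.IsAddHaarMeasure]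

lemma lintegral_comp_add_smul_sub {g : E → ℝ≥0∞} (hg : Measurable g) (a : E) {t : ℝ}
    (ht : 0 < t) :
    ∫⁻ y, g (a + t • (y - a)) ∂μ = ENNReal.ofReal ((t ^ Module.finrank ℝ E)⁻¹) * ∫⁻ y, g y ∂μ := by
  have h1 : ∫⁻ y, g (a + t • (y - a)) ∂μ = ∫⁻ y, g (a + t • y) ∂μ :=
    lintegral_sub_right_eq_self (fun y => g (a + t • y)) a
  have h2 : ∫⁻ y, g (a + t • y) ∂μ = ∫⁻ y, g (a + y) ∂(Measure.map (fun x => t • x) μ) := by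
    rw [lintegral_map (f := fun y => g (a + y)) (hg.comp (measurable_const_add a))
      (measurable_const_smul t)]
  rw [h1, h2, Measure.map_addHaar_smul μ ht.ne', lintegral_smul_measure,
    lintegral_add_left_eq_self g a, abs_of_nonneg (by positivity), smul_eq_mul]

/-- Hölder's inequality and scaling for the average of `g` over a homothetic copy of `U`. -/
lemma setLIntegral_comp_add_smul_sub_le {g : E → ℝ≥0∞} (hg : Measurable g) (U : Set E) (a : E)
    {q : ℝ} (hq : 1 < q) {t : ℝ} (ht : 0 < t) :
    ∫⁻ y in U, g (a + t • (y - a)) ∂μ ≤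
      ENNReal.ofReal (t ^ (-(Module.finrank ℝ E / q : ℝ))) *
        ((∫⁻ y, g y ^ q ∂μ) ^ (1 / q) * μ U ^ (1 - 1 / q)) := by
  have hq0 : 0 < q := by linarith
  have hpath : Measurable fun y : E => a + t • (y - a) := by fun_prop
  have hH := ENNReal.lintegral_mul_le_Lp_mul_Lq (μ.restrict U)
    (Real.HolderConjugate.conjExponent hq) (hg.comp hpath).aemeasurable
    (aemeasurable_const (b := (1 : ℝ≥0∞)))
  simp only [Pi.mul_apply, Function.comp_apply, mul_one, ENNReal.one_rpow, lintegral_one,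
    Measure.restrict_apply_univ] at hH
  have hexp : 1 / Real.conjExponent q = 1 - 1 / q := by
    rw [Real.conjExponent]; field_simp
  rw [hexp] at hH
  refine hH.trans ?_
  rw [← mul_assoc]
  gcongr
  calc (∫⁻ y in U, g (a + t • (y - a)) ^ q ∂μ) ^ (1 / q)
      ≤ (∫⁻ y, g (a + t • (y - a)) ^ q ∂μ) ^ (1 / q) := by
        gcongr
        exact Measure.restrict_le_self
    _ = (ENNReal.ofReal ((t ^ Module.finrank ℝ E)⁻¹) * ∫⁻ y, g y ^ q ∂μ) ^ (1 / q) := by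
        rw [lintegral_comp_add_smul_sub μ (hg.pow_const q) a ht]
    _ = ENNReal.ofReal (t ^ (-(Module.finrank ℝ E / q : ℝ))) *
        (∫⁻ y, g y ^ q ∂μ) ^ (1 / q) := by
        rw [ENNReal.mul_rpow_of_nonneg _ _ (by positivity),
          ENNReal.ofReal_rpow_of_nonneg (by positivity) (by positivity), ← Real.rpow_natCast,
          ← Real.rpow_neg ht.le, ← Real.rpow_mul ht.le]
        congr 3
        ring

lemma lintegral_rpow_neg_Ioo {s : ℝ} (hs : s < 1) :
    ∫⁻ t in Ioo (0 : ℝ) 1, ENNReal.ofReal (t ^ (-s)) = ENNReal.ofReal (1 - s)⁻¹ := by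
  have hInt : IntegrableOn (fun t : ℝ => t ^ (-s)) (Ioo 0 1) :=
    ((intervalIntegrable_iff_integrableOn_Ioo_of_le zero_le_one).1
      (intervalIntegral.intervalIntegrable_rpow' (by linarith)))
  rw [← ofReal_integral_eq_lintegral_ofReal hInt
    ((ae_restrict_mem measurableSet_Ioo).mono fun t ht => Real.rpow_nonneg ht.1.le _),
    ← integral_Ioc_eq_integral_Ioo, ← intervalIntegral.integral_of_le zero_le_one,
    integral_rpow (Or.inl (by linarith)), Real.one_rpow,
    Real.zero_rpow (by linarith : -s + 1 ≠ 0)]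
  congr 1
  rw [sub_zero, one_div, neg_add_eq_sub]

lemma setLIntegral_enorm_sub_le {U : Set E} (hU : IsOpen U) (hconv : Convex ℝ U)
    {f : E → ℝ} (hf : ContDiffOn ℝ 1 f U) {q : ℝ} (hq : 1 < q) (hqn : Module.finrank ℝ E < q)
    {D : ℝ≥0∞} {a : E} (ha : a ∈ U) (hD : ∀ y ∈ U, ‖y - a‖ₑ ≤ D) :
    ∫⁻ y in U, ‖f y - f a‖ₑ ∂μ ≤ ENNReal.ofReal (1 - Module.finrank ℝ E / q)⁻¹ *
      ((∫⁻ y in U, ‖fderiv ℝ f y‖ₑ ^ q ∂μ) ^ (1 / q) * μ U ^ (1 - 1 / q)) * D := by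
  have hq0 : 0 < q := by linarith
  set g : E → ℝ≥0∞ := U.indicator fun x => ‖fderiv ℝ f x‖ₑ with hgdef
  have hg : Measurable g := by
    classical
    rw [hgdef, ← piecewise_eq_indicator]
    exact ContinuousOn.measurable_piecewise
      (hf.continuousOn_fderiv_of_isOpen hU le_rfl).enorm continuousOn_const hU.measurableSet
  have hgq : ∫⁻ y, g y ^ q ∂μ = ∫⁻ y in U, ‖fderiv ℝ f y‖ₑ ^ q ∂μ := by
    rw [← lintegral_indicator hU.measurableSet]
    refine lintegral_congr fun y => ?_
    by_cases hy : y ∈ U <;> simp [hgdef, hy, hq0]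
  have hmeas : Measurable (Function.uncurry fun (y : E) (t : ℝ) => g (a + t • (y - a))) :=
    hg.comp (by fun_prop)
  calc ∫⁻ y in U, ‖f y - f a‖ₑ ∂μ
      ≤ ∫⁻ y in U, (∫⁻ t in Ioo (0 : ℝ) 1, g (a + t • (y - a))) * D ∂μ := by
        refine setLIntegral_mono' hU.measurableSet fun y hy => ?_
        refine (enorm_sub_le_lintegral_fderiv_segment hU hconv hf ha hy).trans ?_
        rw [← lintegral_mul_const _ (hmeas.of_uncurry_left (x := y))]
        refine setLIntegral_mono' measurableSet_Ioo fun t ht => ?_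
        have hmem : a + t • (y - a) ∈ U := hconv.add_smul_sub_mem ha hy ⟨ht.1.le, ht.2.le⟩
        simp only [hgdef, indicator_of_mem hmem]
        gcongr
        exact hD y hy
    _ = (∫⁻ t in Ioo (0 : ℝ) 1, ∫⁻ y in U, g (a + t • (y - a)) ∂μ) * D := by
        rw [lintegral_mul_const _ hmeas.lintegral_prod_right,
          lintegral_lintegral_swap hmeas.aemeasurable]
    _ ≤ (∫⁻ t in Ioo (0 : ℝ) 1, ENNReal.ofReal (t ^ (-(Module.finrank ℝ E / q : ℝ))) *
          ((∫⁻ y, g y ^ q ∂μ) ^ (1 / q) * μ U ^ (1 - 1 / q))) * D := by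
        gcongr ?_ * D
        exact setLIntegral_mono' measurableSet_Ioo fun t ht =>
          setLIntegral_comp_add_smul_sub_le μ hg U a hq ht.1
    _ = _ := by
        rw [lintegral_mul_const _ (by fun_prop), hgq,
          lintegral_rpow_neg_Ioo ((div_lt_one hq0).2 hqn)]

/-- **Morrey's inequality** on a convex open set of finite measure. -/
theorem morrey_of_convex {U : Set E} (hU : IsOpen U) (hconv : Convex ℝ U)
    {f : E → ℝ} (hf : ContDiffOn ℝ 1 f U) {q : ℝ} (hq : 1 < q) (hqn : Module.finrank ℝ E < q)
    {D V N : ℝ} (hV : 0 < V) (hVU : μ U = ENNReal.ofReal V) (hN : 0 ≤ N)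
    (hD : ∀ x ∈ U, ∀ y ∈ U, ‖x - y‖ ≤ D)
    (hfN : ∫⁻ y in U, ‖fderiv ℝ f y‖ₑ ^ q ∂μ ≤ ENNReal.ofReal N)
    {a b : E} (ha : a ∈ U) (hb : b ∈ U) :
    |f a - f b| ≤
      2 * (1 - Module.finrank ℝ E / q)⁻¹ * D * V ^ (-(1 / q)) * N ^ (1 / q) := by
  have hq0 : 0 < q := by linarith
  have hK : 0 < (1 - Module.finrank ℝ E / q : ℝ)⁻¹ :=
    inv_pos.2 (sub_pos.2 ((div_lt_one hq0).2 hqn))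
  have hD0 : 0 ≤ D := (norm_nonneg _).trans (hD a ha a ha)
  set K : ℝ := (1 - Module.finrank ℝ E / q : ℝ)⁻¹
  have hexp : 0 ≤ 1 - 1 / q := sub_nonneg.2 ((div_le_one hq0).2 hq.le)
  have key : ∀ c ∈ U, ∫⁻ y in U, ‖f y - f c‖ₑ ∂μ ≤
      ENNReal.ofReal (K * (N ^ (1 / q) * V ^ (1 - 1 / q)) * D) := by
    intro c hc
    refine (setLIntegral_enorm_sub_le μ hU hconv hf hq hqn (D := ENNReal.ofReal D) hc
      fun y hy => ?_).trans ?_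
    · rw [← ofReal_norm]
      exact ENNReal.ofReal_le_ofReal (hD y hy c hc)
    · rw [ENNReal.ofReal_mul (by positivity), ENNReal.ofReal_mul hK.le,
        ENNReal.ofReal_mul (by positivity), hVU,
        ENNReal.ofReal_rpow_of_nonneg hV.le hexp,
        ← ENNReal.ofReal_rpow_of_nonneg hN (by positivity)]
      gcongr
  have hmeas : AEMeasurable (fun y => ‖f y - f a‖ₑ) (μ.restrict U) :=
    ((hf.continuousOn.sub continuousOn_const).enorm).aemeasurable hU.measurableSet
  have hsum : ENNReal.ofReal (|f a - f b| * V) ≤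
      ENNReal.ofReal (K * (N ^ (1 / q) * V ^ (1 - 1 / q)) * D +
        K * (N ^ (1 / q) * V ^ (1 - 1 / q)) * D) := by
    calc ENNReal.ofReal (|f a - f b| * V) = ∫⁻ _ in U, ‖f a - f b‖ₑ ∂μ := by
          rw [setLIntegral_const, hVU, ENNReal.ofReal_mul (abs_nonneg _), ← ofReal_norm,
            Real.norm_eq_abs]
      _ ≤ ∫⁻ y in U, (‖f y - f a‖ₑ + ‖f y - f b‖ₑ) ∂μ := by
          refine lintegral_mono fun y => ?_
          rw [← enorm_neg (f y - f a)]
          refine le_trans (le_of_eq ?_) (enorm_add_le _ _)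
          congr 1
          ring
      _ ≤ _ := by
          rw [lintegral_add_left' hmeas, ENNReal.ofReal_add (by positivity) (by positivity)]
          exact add_le_add (key a ha) (key b hb)
  rw [ENNReal.ofReal_le_ofReal_iff (by positivity)] at hsum
  have hVpow : V ^ (1 - 1 / q) = V ^ (-(1 / q)) * V := by
    rw [← Real.rpow_add_one hV.ne']
    congr 1
    ring
  rw [hVpow] at hsum
  refine le_of_mul_le_mul_right (hsum.trans (le_of_eq ?_)) hV
  ring

end Morrey

/-- The operator norm of the derivative is controlled by the partial derivatives. -/
lemma norm_fderiv_le_of_differentiableAt {f : ℝ → ℝ → ℝ} {w : ℝ × ℝ}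
    (hf : DifferentiableAt ℝ (fun w : ℝ × ℝ => f w.1 w.2) w) :
    ‖fderiv ℝ (fun w : ℝ × ℝ => f w.1 w.2) w‖ ≤
      2 * (dr f w.1 w.2 ^ 2 + dzz f w.1 w.2 ^ 2) ^ (1 / 2 : ℝ) := by
  set L := fderiv ℝ (fun w : ℝ × ℝ => f w.1 w.2) w with hL
  have hdr : dr f w.1 w.2 = L (1, 0) :=
    (HasFDerivAt.comp_hasDerivAt (l := fun w : ℝ × ℝ => f w.1 w.2) w.1 hf.hasFDerivAt
      ((hasDerivAt_id w.1).prodMk (hasDerivAt_const w.1 w.2))).deriv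
  have hdz : dzz f w.1 w.2 = L (0, 1) :=
    (HasFDerivAt.comp_hasDerivAt (l := fun w : ℝ × ℝ => f w.1 w.2) w.2 hf.hasFDerivAt
      ((hasDerivAt_const w.2 w.1).prodMk (hasDerivAt_id w.2))).deriv
  rw [hdr, hdz, ← Real.sqrt_eq_rpow]
  refine ContinuousLinearMap.opNorm_le_bound _ (by positivity) fun v => ?_
  have hv : L v = v.1 * L (1, 0) + v.2 * L (0, 1) := by
    have : v = v.1 • ((1, 0) : ℝ × ℝ) + v.2 • ((0, 1) : ℝ × ℝ) := by ext <;> simp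
    conv_lhs => rw [this]
    rw [map_add, map_smul, map_smul, smul_eq_mul, smul_eq_mul]
  have h1 : |L (1, 0)| ≤ √(L (1, 0) ^ 2 + L (0, 1) ^ 2) :=
    Real.abs_le_sqrt (le_add_of_nonneg_right (sq_nonneg _))
  have h2 : |L (0, 1)| ≤ √(L (1, 0) ^ 2 + L (0, 1) ^ 2) :=
    Real.abs_le_sqrt (le_add_of_nonneg_left (sq_nonneg _))
  have hv1 : |v.1| ≤ ‖v‖ := norm_fst_le v
  have hv2 : |v.2| ≤ ‖v‖ := norm_snd_le v
  calc ‖L v‖ ≤ |v.1| * |L (1, 0)| + |v.2| * |L (0, 1)| := by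
        rw [hv, Real.norm_eq_abs, ← abs_mul, ← abs_mul]
        exact abs_add_le _ _
    _ ≤ ‖v‖ * √(L (1, 0) ^ 2 + L (0, 1) ^ 2) + ‖v‖ * √(L (1, 0) ^ 2 + L (0, 1) ^ 2) := by
        gcongr
    _ = _ := by ring

/-- Morrey-type oscillation estimate on dyadic annuli in the slab,
with a constant depending only on `q` and `r₀`, independent of `R`. -/
theorem oscillation_estimate (r₀ q : ℝ) (hr₀ : 0 < r₀) (hq : 2 < q) :
    ∃ C : ℝ, 0 < C ∧ ∀ f : ℝ → ℝ → ℝ,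
      ContDiffOn ℝ 1 (fun w : ℝ × ℝ => f w.1 w.2) (Ici r₀ ×ˢ Icc (-π) π) →
      IntegrableOn
        (fun w : ℝ × ℝ => ((dr f w.1 w.2) ^ 2 + (dzz f w.1 w.2) ^ 2) ^ (q / 2) * w.1)
        (Ici r₀ ×ˢ Icc (-π) π) →
      ∀ R : ℝ, 4 * r₀ < R →
      ∀ r₁ ∈ Icc (R / 4) (4 * R), ∀ r₂ ∈ Icc (R / 4) (4 * R),
      ∀ z₁ ∈ Icc (-π) π, ∀ z₂ ∈ Icc (-π) π,
        |f r₁ z₁ - f r₂ z₂| ≤ C * R ^ (1 - 2 / q) *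
          (∫ w : ℝ × ℝ in Ici r₀ ×ˢ Icc (-π) π,
            ((dr f w.1 w.2) ^ 2 + (dzz f w.1 w.2) ^ 2) ^ (q / 2) * w.1) ^ (1 / q) := by
  have hq0 : 0 < q := by linarith
  have hK : 0 < (1 - 2 / q)⁻¹ := inv_pos.2 (sub_pos.2 ((div_lt_one hq0).2 hq))
  refine ⟨4 * (1 - 2 / q)⁻¹ * (4 + 2 * π / (4 * r₀)) * 4 ^ (1 / q), by positivity, ?_⟩
  intro f hf hInt R hR r₁ hr₁ r₂ hr₂ z₁ hz₁ z₂ hz₂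
  have hR0 : 0 < R := by linarith
  set S : Set (ℝ × ℝ) := Ici r₀ ×ˢ Icc (-π) π
  set h : ℝ × ℝ → ℝ := fun w =>
    ((dr f w.1 w.2) ^ 2 + (dzz f w.1 w.2) ^ 2) ^ (q / 2) * w.1
  set I : ℝ := ∫ w in S, h w with hI
  set U : Set (ℝ × ℝ) := Ioo (R / 4) (4 * R) ×ˢ Ioo (-π) π with hUdef
  have hU : IsOpen U := isOpen_Ioo.prod isOpen_Ioo
  have hclosure : closure U = Icc (R / 4) (4 * R) ×ˢ Icc (-π) π := by
    rw [hUdef, closure_prod_eq, closure_Ioo (by linarith), closure_Ioo (by linarith [pi_pos])]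
  have hclosureS : closure U ⊆ S := by
    rw [hclosure]
    exact prod_mono (fun r hr => le_trans (by linarith) hr.1) Subset.rfl
  have hUS : U ⊆ S := subset_closure.trans hclosureS
  have hS : MeasurableSet S := measurableSet_Ici.prod measurableSet_Icc
  have hh : ∀ w ∈ S, 0 ≤ h w := fun w hw =>
    mul_nonneg (by positivity) (hr₀.le.trans hw.1)
  have hI0 : 0 ≤ I := setIntegral_nonneg hS hh
  have hvol : volume U = ENNReal.ofReal ((4 * R - R / 4) * (π - -π)) := by
    rw [hUdef, Measure.volume_eq_prod, Measure.prod_prod, Real.volume_Ioo, Real.volume_Ioo,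
      ← ENNReal.ofReal_mul (by linarith)]
  have hRV : R ≤ (4 * R - R / 4) * (π - -π) := by nlinarith [pi_gt_three]
  have hdiam : ∀ x ∈ U, ∀ y ∈ U, ‖x - y‖ ≤ (4 + 2 * π / (4 * r₀)) * R := by
    intro x hx y hy
    have hπR : 2 * π ≤ 2 * π / (4 * r₀) * R := by
      rw [div_mul_eq_mul_div, le_div_iff₀ (by positivity)]
      gcongr
    have hpos : 0 ≤ 2 * π / (4 * r₀) * R := by positivity
    rw [Prod.norm_def, add_mul]
    obtain ⟨⟨hx1, hx2⟩, hx3, hx4⟩ := hx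
    obtain ⟨⟨hy1, hy2⟩, hy3, hy4⟩ := hy
    refine max_le ?_ ?_ <;> rw [Real.norm_eq_abs, abs_le] <;>
      constructor <;> simp only [Prod.fst_sub, Prod.snd_sub] <;> linarith
  have hgrad : ∫⁻ w in U, ‖fderiv ℝ (fun w : ℝ × ℝ => f w.1 w.2) w‖ₑ ^ q ≤
      ENNReal.ofReal (2 ^ q * (4 / R) * I) := by
    calc ∫⁻ w in U, ‖fderiv ℝ (fun w : ℝ × ℝ => f w.1 w.2) w‖ₑ ^ q
        ≤ ∫⁻ w in U, ENNReal.ofReal (2 ^ q * (4 / R) * h w) := by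
          refine setLIntegral_mono' hU.measurableSet fun w hw => ?_
          have hd : DifferentiableAt ℝ (fun w : ℝ × ℝ => f w.1 w.2) w :=
            ((hf.mono hUS).contDiffAt (hU.mem_nhds hw)).differentiableAt one_ne_zero
          rw [← ofReal_norm, ENNReal.ofReal_rpow_of_nonneg (norm_nonneg _) hq0.le]
          refine ENNReal.ofReal_le_ofReal ?_
          calc ‖fderiv ℝ (fun w : ℝ × ℝ => f w.1 w.2) w‖ ^ q
              ≤ (2 * (dr f w.1 w.2 ^ 2 + dzz f w.1 w.2 ^ 2) ^ (1 / 2 : ℝ)) ^ q := by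
                gcongr
                exact norm_fderiv_le_of_differentiableAt hd
            _ = 2 ^ q * 1 * (dr f w.1 w.2 ^ 2 + dzz f w.1 w.2 ^ 2) ^ (q / 2) := by
                rw [Real.mul_rpow (by positivity) (by positivity),
                  ← Real.rpow_mul (by positivity), mul_one]
                congr 2
                ring
            _ ≤ 2 ^ q * (4 / R * w.1) * (dr f w.1 w.2 ^ 2 + dzz f w.1 w.2 ^ 2) ^ (q / 2) := by
                gcongr
                rw [div_mul_eq_mul_div, le_div_iff₀ hR0]
                linarith [hw.1.1]
            _ = 2 ^ q * (4 / R) * h w := by ring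
      _ ≤ ∫⁻ w in S, ENNReal.ofReal (2 ^ q * (4 / R) * h w) := lintegral_mono_set hUS
      _ = ENNReal.ofReal (2 ^ q * (4 / R) * I) := by
          rw [hI, ← integral_const_mul, ofReal_integral_eq_lintegral_ofReal (hInt.const_mul _)]
          exact (ae_restrict_mem hS).mono fun w hw => mul_nonneg (by positivity) (hh w hw)
  have hopen : ∀ a ∈ U, ∀ b ∈ U, |f a.1 a.2 - f b.1 b.2| ≤
      4 * (1 - 2 / q)⁻¹ * (4 + 2 * π / (4 * r₀)) * 4 ^ (1 / q) * R ^ (1 - 2 / q) *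
        I ^ (1 / q) := by
    intro a ha b hb
    have hfin : (Module.finrank ℝ (ℝ × ℝ) : ℝ) = 2 := by
      rw [Module.finrank_prod, Module.finrank_self]
      norm_num
    have hmorrey := morrey_of_convex volume hU ((convex_Ioo _ _).prod (convex_Ioo _ _))
      (hf.mono hUS) (q := q) (by linarith) (by rw [hfin]; exact hq) (hR0.trans_le hRV) hvol
      (by positivity) hdiam hgrad ha hb
    rw [hfin] at hmorrey
    refine hmorrey.trans ?_
    have hVpow : ((4 * R - R / 4) * (π - -π)) ^ (-(1 / q)) ≤ R ^ (-(1 / q)) :=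
      Real.rpow_le_rpow_of_nonpos hR0 hRV (by rw [neg_nonpos]; positivity)
    have hNpow : (2 ^ q * (4 / R) * I) ^ (1 / q) =
        2 * 4 ^ (1 / q) * R ^ (-(1 / q)) * I ^ (1 / q) := by
      rw [Real.mul_rpow (by positivity) hI0, Real.mul_rpow (by positivity) (by positivity),
        Real.div_rpow (by positivity) hR0.le, ← Real.rpow_mul zero_le_two,
        mul_one_div_cancel hq0.ne', Real.rpow_one, Real.rpow_neg hR0.le]
      ring
    have hRpow : R ^ (1 - 2 / q) = R * R ^ (-(1 / q)) * R ^ (-(1 / q)) := by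
      rw [← Real.rpow_one_add' hR0.le, ← Real.rpow_add hR0]
      · congr 1
        ring
      · have : 1 / q < 1 := (div_lt_one hq0).2 (by linarith)
        linarith
    rw [hNpow, hRpow]
    calc _ ≤ 2 * (1 - 2 / q)⁻¹ * ((4 + 2 * π / (4 * r₀)) * R) * R ^ (-(1 / q)) *
          (2 * 4 ^ (1 / q) * R ^ (-(1 / q)) * I ^ (1 / q)) := by gcongr
      _ = _ := by ring
  have hcont : ContinuousOn (fun w : ℝ × ℝ => f w.1 w.2) (closure U) :=
    hf.continuousOn.mono hclosureS
  have hp₁ : (r₁, z₁) ∈ closure U := hclosure ▸ ⟨hr₁, hz₁⟩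
  have hp₂ : (r₂, z₂) ∈ closure U := hclosure ▸ ⟨hr₂, hz₂⟩
  have hcontU : ∀ p ∈ closure U, ContinuousWithinAt (fun w : ℝ × ℝ => f w.1 w.2) U p :=
    fun p hp => (hcont p hp).mono subset_closure
  exact ContinuousWithinAt.closure_le (f := fun w : ℝ × ℝ => |f w.1 w.2 - f r₂ z₂|) hp₁
    ((hcontU _ hp₁).sub continuousWithinAt_const).abs continuousWithinAt_const fun a ha =>
    ContinuousWithinAt.closure_le (f := fun w : ℝ × ℝ => |f a.1 a.2 - f w.1 w.2|) hp₂
      (continuousWithinAt_const.sub (hcontU _ hp₂)).abs continuousWithinAt_const (hopen a ha)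
end
end

section
/- Let r₁ > 0, q ∈ [2,∞), α ∈ ℝ, and let f = f(r,z) be a C¹ function on (r₁,∞) × ℝ that is 2π-periodic in z and satisfies ∫_{-π}^{π} ∫_{r₁}^{∞} r^α |f(r,z)|^{q-2} |∇_{r,z} f(r,z)|² dr dz + ∫_{-π}^{π} ∫_{r₁}^{∞} r^{q+1} |f(r,z)|^q dr dz < ∞. Assume moreover that f satisfies the maximum principle in (r₁,∞) × S¹: for every ρ₁, ρ₂ ∈ (r₁,∞) with ρ₁ < ρ₂, the restriction of |f| to [ρ₁,ρ₂] × [-π,π] attains its maximum on the set where r = ρ₁ or r = ρ₂. Then lim_{r→∞} r^{β/q} sup_{-π ≤ z ≤ π} |f(r,z)| = 0, where β = min{ q + 2, (α + q + 3)/2 }. -/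
open MeasureTheory Real Set Filter Topology

noncomputable section

theorem tendsto_setLIntegral_Ioi_atTop {g : ℝ → ENNReal} {a : ℝ}
    (h : ∫⁻ x in Ioi a, g x ≠ ⊤) :
    Tendsto (fun b : ℝ => ∫⁻ x in Ioi b, g x) atTop (𝓝 0) := by
  have key := tendsto_measure_iInter_atTop (μ := volume.withDensity g) (s := fun b : ℝ => Ioi b)
    (fun _ => measurableSet_Ioi.nullMeasurableSet) (fun _ _ hxy => Ioi_subset_Ioi hxy)
    ⟨a, by rwa [withDensity_apply _ measurableSet_Ioi]⟩
  have hempty : ⋂ b : ℝ, Ioi b = ∅ :=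
    eq_empty_of_forall_notMem fun x hx => lt_irrefl x (mem_iInter.1 hx x)
  rw [hempty, measure_empty] at key
  exact key.congr fun b => withDensity_apply _ measurableSet_Ioi

theorem exists_mem_Ioo_le_of_setLIntegral_lt {g : ℝ → ENNReal} {a b T : ℝ} (hab : a < b)
    (h : ∫⁻ x in Ioo a b, g x < ENNReal.ofReal T) :
    ∃ x ∈ Ioo a b, g x ≤ ENNReal.ofReal (T / (b - a)) := by
  by_contra! hcon
  refine h.not_ge ?_
  have hba : 0 < b - a := sub_pos.2 hab
  calc ENNReal.ofReal T = ENNReal.ofReal (T / (b - a)) * ENNReal.ofReal (b - a) := by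
        rw [← ENNReal.ofReal_mul' hba.le, div_mul_cancel₀ _ hba.ne']
    _ = ∫⁻ _ in Ioo a b, ENNReal.ofReal (T / (b - a)) := by
        rw [setLIntegral_const, Real.volume_Ioo]
    _ ≤ ∫⁻ x in Ioo a b, g x :=
        setLIntegral_mono' measurableSet_Ioo fun x hx => (hcon x hx).le

theorem abs_rpow_sub_two_mul_sq {q : ℝ} (hq : 2 ≤ q) (x : ℝ) :
    |x| ^ (q - 2) * |x| ^ 2 = |x| ^ q := by
  rw [← Real.rpow_natCast |x| 2, ← Real.rpow_add_of_nonneg (abs_nonneg x) (by linarith) (by simp)]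
  norm_num

/-- Weighted Young inequality for the derivative of `|h| ^ q`. -/
theorem mul_abs_rpow_deriv_le {q A B c : ℝ} (hq : 2 ≤ q) (hA : 0 ≤ A) (hB : 0 ≤ B)
    (hcAB : c ^ 2 ≤ A * B) (x y d : ℝ) (hd : y ^ 2 ≤ d) :
    |c * (q * |x| ^ (q - 2) * x * y)| ≤ q / 2 * (A * |x| ^ (q - 2) * d + B * |x| ^ q) := by
  have hP : 0 ≤ |x| ^ (q - 2) := by positivity
  have h1 : 2 * (|c| * (|x| * |y|)) ≤ A * d + B * |x| ^ 2 := by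
    have hd0 : 0 ≤ d := (sq_nonneg y).trans hd
    refine abs_le_of_sq_le_sq' ?_ (by positivity) |>.2
    calc (2 * (|c| * (|x| * |y|))) ^ 2 = 4 * c ^ 2 * (x ^ 2 * y ^ 2) := by
          simp only [mul_pow, sq_abs]; ring
      _ ≤ 4 * (A * B) * (x ^ 2 * d) := by gcongr
      _ ≤ (A * d + B * |x| ^ 2) ^ 2 := by
          rw [sq_abs]; nlinarith [sq_nonneg (A * d - B * x ^ 2)]
  have h2 : |c * (q * |x| ^ (q - 2) * x * y)|
      = q / 2 * |x| ^ (q - 2) * (2 * (|c| * (|x| * |y|))) := by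
    rw [abs_mul, abs_mul, abs_mul, abs_mul, abs_of_nonneg hP, abs_of_nonneg (by linarith : 0 ≤ q)]
    ring
  rw [h2, ← abs_rpow_sub_two_mul_sq hq x]
  calc _ ≤ q / 2 * |x| ^ (q - 2) * (A * d + B * |x| ^ 2) := by gcongr
    _ = _ := by ring

/-- A one-dimensional weighted Sobolev inequality. -/
theorem mul_abs_rpow_le_integral {a b q A B c : ℝ} (hab : a < b) (hq : 2 ≤ q) (hA : 0 ≤ A)
    (hB : 0 ≤ B) (hcB : c ≤ B) (hcAB : c ^ 2 ≤ A * B) {h h' d : ℝ → ℝ}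
    (hh : ∀ z, HasDerivAt h (h' z) z) (hh' : Continuous h') (hd : Continuous d)
    (hle : ∀ z, h' z ^ 2 ≤ d z) {z : ℝ} (hz : z ∈ Icc a b) :
    c * |h z| ^ q ≤ ((b - a)⁻¹ + q / 2) *
      ∫ t in a..b, (A * |h t| ^ (q - 2) * d t + B * |h t| ^ q) := by
  have hcont : Continuous h := continuous_iff_continuousAt.2 fun z => (hh z).continuousAt
  have hcq : Continuous fun t => |h t| ^ q :=
    hcont.abs.rpow_const fun _ => Or.inr (by linarith)
  have hcq2 : Continuous fun t => |h t| ^ (q - 2) :=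
    hcont.abs.rpow_const fun _ => Or.inr (by linarith)
  set F : ℝ → ℝ := fun t => A * |h t| ^ (q - 2) * d t + B * |h t| ^ q with hF
  have hFc : Continuous F := by fun_prop
  have hd0 : ∀ t, 0 ≤ d t := fun t => (sq_nonneg _).trans (hle t)
  have hF0 : ∀ t, 0 ≤ F t := fun t => by have := hd0 t; simp only [hF]; positivity
  have hba : 0 < b - a := sub_pos.2 hab
  set G : ℝ → ℝ := fun t => c * (q * |h t| ^ (q - 2) * h t * h' t)
  have hG : Continuous G := by fun_prop
  have hder : ∀ t, HasDerivAt (fun t => c * |h t| ^ q) (G t) t := fun t =>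
    ((hasDerivAt_abs_rpow (h t) (by linarith : 1 < q)).comp t (hh t)).const_mul c
  have hosc : ∀ w ∈ Icc a b, c * |h z| ^ q ≤ c * |h w| ^ q + q / 2 * ∫ t in a..b, F t := by
    intro w hw
    have hftc : ∫ t in w..z, G t = c * |h z| ^ q - c * |h w| ^ q :=
      intervalIntegral.integral_eq_sub_of_hasDerivAt (fun t _ => hder t)
        (hG.intervalIntegrable _ _)
    have hbound : |∫ t in w..z, G t| ≤ |∫ t in w..z, q / 2 * F t| := by
      rw [← Real.norm_eq_abs]
      exact intervalIntegral.norm_integral_le_abs_of_norm_le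
        (Eventually.of_forall fun t =>
          mul_abs_rpow_deriv_le hq hA hB hcAB (h t) (h' t) (d t) (hle t))
        ((hFc.const_mul _).intervalIntegrable _ _)
    have hmono : |∫ t in w..z, q / 2 * F t| ≤ |∫ t in a..b, q / 2 * F t| := by
      refine intervalIntegral.abs_integral_mono_interval ?_ ?_ ?_
      · rw [uIoc_of_le hab.le]
        exact Ioc_subset_Ioc (le_min hw.1 hz.1) (max_le hw.2 hz.2)
      · exact Eventually.of_forall fun t => by have := hF0 t; simp only [Pi.zero_apply]; positivity
      · exact (hFc.const_mul _).intervalIntegrable _ _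
    rw [intervalIntegral.integral_const_mul (a := a), abs_of_nonneg (a := q / 2 * _)
      (mul_nonneg (by linarith) (intervalIntegral.integral_nonneg hab.le fun t _ => hF0 t))] at hmono
    linarith [le_abs_self (∫ t in w..z, G t)]
  have hmean : (b - a) * (c * |h z| ^ q) ≤
      (∫ t in a..b, F t) + (b - a) * (q / 2 * ∫ t in a..b, F t) := by
    calc (b - a) * (c * |h z| ^ q) = ∫ _ in a..b, c * |h z| ^ q := by
          rw [intervalIntegral.integral_const, smul_eq_mul]
      _ ≤ ∫ w in a..b, (F w + q / 2 * ∫ t in a..b, F t) := by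
          refine intervalIntegral.integral_mono_on hab.le (by simp)
            ((hFc.add continuous_const).intervalIntegrable _ _) fun w hw => (hosc w hw).trans ?_
          have hdw := hd0 w
          have h1 : c * |h w| ^ q ≤ B * |h w| ^ q := by gcongr
          have h2 : 0 ≤ A * |h w| ^ (q - 2) * d w := by positivity
          simp only [hF]
          linarith
      _ = _ := by
          rw [intervalIntegral.integral_add (hFc.intervalIntegrable _ _) (by simp),
            intervalIntegral.integral_const, smul_eq_mul]
  calc c * |h z| ^ q = (b - a)⁻¹ * ((b - a) * (c * |h z| ^ q)) := by field_simp
    _ ≤ (b - a)⁻¹ * ((∫ t in a..b, F t) + (b - a) * (q / 2 * ∫ t in a..b, F t)) := by gcongr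
    _ = _ := by field_simp

/-- Proposition 2.3 of the paper, pointwise decay via the maximum
principle from weighted integral bounds. -/
theorem pointwise_decay_via_maximum_principle (r₁ q α : ℝ) (hr₁ : 0 < r₁)
    (hq : 2 ≤ q) (f : ℝ → ℝ → ℝ)
    (hf : ContDiffOn ℝ 1 (fun w : ℝ × ℝ => f w.1 w.2) (Ioi r₁ ×ˢ univ))
    (hper : ∀ r z : ℝ, f r (z + 2 * π) = f r z)
    (hint : ∫⁻ w : ℝ × ℝ in Ioi r₁ ×ˢ Icc (-π) π,
      ENNReal.ofReal
        (w.1 ^ α * |f w.1 w.2| ^ (q - 2) * ((dr f w.1 w.2) ^ 2 + (dzz f w.1 w.2) ^ 2)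
          + w.1 ^ (q + 1) * |f w.1 w.2| ^ q) < ⊤)
    (hmax : ∀ ρ₁ ρ₂ : ℝ, r₁ < ρ₁ → ρ₁ < ρ₂ →
      ∃ w ∈ Icc ρ₁ ρ₂ ×ˢ Icc (-π) π, (w.1 = ρ₁ ∨ w.1 = ρ₂) ∧
        ∀ u ∈ Icc ρ₁ ρ₂ ×ˢ Icc (-π) π, |f u.1 u.2| ≤ |f w.1 w.2|) :
    Tendsto
      (fun r : ℝ => r ^ (min (q + 2) ((α + q + 3) / 2) / q) *
        ⨆ z : (Icc (-π) π : Set ℝ), |f r (z : ℝ)|)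
      atTop (𝓝 0) := by
  have hU : IsOpen (Ioi r₁ ×ˢ (univ : Set ℝ)) := isOpen_Ioi.prod isOpen_univ
  set Φ : ℝ × ℝ → ℝ := fun w =>
    w.1 ^ α * |f w.1 w.2| ^ (q - 2) * ((dr f w.1 w.2) ^ 2 + (dzz f w.1 w.2) ^ 2)
      + w.1 ^ (q + 1) * |f w.1 w.2| ^ q with hΦ
  set β : ℝ := min (q + 2) ((α + q + 3) / 2) with hβ
  have hfd : ∀ r z : ℝ, r₁ < r → HasFDerivAt (fun w : ℝ × ℝ => f w.1 w.2)
      (fderiv ℝ (fun w : ℝ × ℝ => f w.1 w.2) (r, z)) (r, z) := fun r z hr =>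
    ((hf.differentiableOn one_ne_zero).differentiableAt
      (hU.mem_nhds (mk_mem_prod hr (mem_univ z)))).hasFDerivAt
  have hdr : ∀ r z : ℝ, r₁ < r →
      dr f r z = fderiv ℝ (fun w : ℝ × ℝ => f w.1 w.2) (r, z) (1, 0) := fun r z hr =>
    ((hfd r z hr).comp_hasDerivAt (f := fun s => (s, z)) r
      ((hasDerivAt_id r).prodMk (hasDerivAt_const r z))).deriv
  have hdz' : ∀ r z : ℝ, r₁ < r → HasDerivAt (f r)
      (fderiv ℝ (fun w : ℝ × ℝ => f w.1 w.2) (r, z) (0, 1)) z := fun r z hr =>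
    (hfd r z hr).comp_hasDerivAt z ((hasDerivAt_const z r).prodMk (hasDerivAt_id z))
  have hdz : ∀ r z : ℝ, r₁ < r → HasDerivAt (f r) (dzz f r z) z := fun r z hr =>
    (hdz' r z hr).differentiableAt.hasDerivAt
  have hcf := hf.continuousOn_fderiv_of_isOpen hU le_rfl
  have hdrc : ContinuousOn (fun w : ℝ × ℝ => dr f w.1 w.2) (Ioi r₁ ×ˢ univ) :=
    (hcf.clm_apply continuousOn_const).congr fun w hw => hdr w.1 w.2 hw.1
  have hdzc : ContinuousOn (fun w : ℝ × ℝ => dzz f w.1 w.2) (Ioi r₁ ×ˢ univ) :=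
    (hcf.clm_apply continuousOn_const).congr fun w hw => (hdz' w.1 w.2 hw.1).deriv
  have hrc : ∀ p : ℝ, ContinuousOn (fun w : ℝ × ℝ => w.1 ^ p) (Ioi r₁ ×ˢ univ) := fun p =>
    continuousOn_fst.rpow_const fun w hw => Or.inl (hr₁.trans hw.1).ne'
  have hfc : ∀ p : ℝ, 0 ≤ p →
      ContinuousOn (fun w : ℝ × ℝ => |f w.1 w.2| ^ p) (Ioi r₁ ×ˢ univ) := fun p hp =>
    hf.continuousOn.abs.rpow_const fun w _ => Or.inr hp
  have hΦc : ContinuousOn Φ (Ioi r₁ ×ˢ univ) :=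
    (((hrc α).mul (hfc _ (by linarith))).mul ((hdrc.pow 2).add (hdzc.pow 2))).add
      ((hrc _).mul (hfc _ (by linarith)))
  have hslice : ∀ {g : ℝ × ℝ → ℝ} {r : ℝ}, ContinuousOn g (Ioi r₁ ×ˢ univ) → r₁ < r →
      Continuous fun z => g (r, z) := fun hg hr =>
    hg.comp_continuous (by fun_prop) fun z => ⟨hr, mem_univ z⟩
  set H : ℝ → ENNReal := fun r => ∫⁻ z in Icc (-π) π, ENNReal.ofReal (Φ (r, z)) with hH
  have hfin : ∫⁻ r in Ioi r₁, H r ≠ ⊤ := by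
    rw [hH, ← lintegral_prod (fun w => ENNReal.ofReal (Φ w)), Measure.prod_restrict,
      ← Measure.volume_eq_prod]
    · exact hint.ne
    · rw [Measure.prod_restrict]
      exact ENNReal.measurable_ofReal.comp_aemeasurable
        ((hΦc.mono (prod_mono_right (subset_univ _))).aemeasurable
          (measurableSet_Ioi.prod measurableSet_Icc))
  set C : ℝ := (π - -π)⁻¹ + q / 2 with hC
  have hC0 : 0 < C := by
    have : 0 < (π - -π)⁻¹ := inv_pos.2 (by linarith [Real.pi_pos])
    linarith
  have hbound : ∀ {ρ X : ℝ}, r₁ < ρ → 1 ≤ ρ → 0 ≤ X → H ρ ≤ ENNReal.ofReal X →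
      ∀ z ∈ Icc (-π) π, ρ ^ (β - 1) * |f ρ z| ^ q ≤ C * X := by
    intro ρ X hρ hρ1 hX hHX z hz
    have hρ0 : 0 < ρ := hr₁.trans hρ
    have hΦρ : Continuous fun z => Φ (ρ, z) := hslice hΦc hρ
    have hint_le : ∫ t in (-π)..π, Φ (ρ, t) ≤ X := by
      rw [← ENNReal.ofReal_le_ofReal_iff hX,
        intervalIntegral.integral_of_le (by linarith [Real.pi_pos]),
        ← integral_Icc_eq_integral_Ioc, ofReal_integral_eq_lintegral_ofReal]
      · exact hHX
      · exact hΦρ.integrableOn_Icc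
      · exact Eventually.of_forall fun t => by simp only [hΦ, Pi.zero_apply]; positivity
    refine (mul_abs_rpow_le_integral (h := f ρ) (h' := dzz f ρ)
      (d := fun t => dr f ρ t ^ 2 + dzz f ρ t ^ 2) (a := -π) (b := π) (A := ρ ^ α)
      (B := ρ ^ (q + 1)) (by linarith [Real.pi_pos]) hq (by positivity) (by positivity) ?_ ?_
      (fun t => hdz ρ t hρ) (hslice hdzc hρ) (((hslice hdrc hρ).pow 2).add ((hslice hdzc hρ).pow 2))
      (fun t => le_add_of_nonneg_left (sq_nonneg _)) hz).trans ?_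
    · exact Real.rpow_le_rpow_of_exponent_le hρ1 (by linarith [min_le_left (q + 2) ((α + q + 3) / 2)])
    · rw [← Real.rpow_mul_natCast hρ0.le, ← Real.rpow_add hρ0]
      refine Real.rpow_le_rpow_of_exponent_le hρ1 ?_
      push_cast
      linarith [min_le_right (q + 2) ((α + q + 3) / 2)]
    · exact mul_le_mul_of_nonneg_left hint_le hC0.le
  -- Comparing nearby radii costs only a constant factor.
  have hcomp : ∀ {R ρ : ℝ}, 0 < R → R / 2 < ρ → ρ < 2 * R →
      R ^ (β - 1) ≤ 2 ^ |β - 1| * ρ ^ (β - 1) := by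
    intro R ρ hR h1 h2
    have hρ : 0 < ρ := by linarith
    rw [← div_le_iff₀ (by positivity), ← Real.div_rpow hR.le hρ.le]
    rcases le_total 0 (β - 1) with hb | hb
    · rw [abs_of_nonneg hb]
      exact Real.rpow_le_rpow (by positivity) (by rw [div_le_iff₀ hρ]; linarith) hb
    · rw [abs_of_nonpos hb, ← neg_neg (β - 1), Real.rpow_neg (by positivity), neg_neg,
        ← Real.inv_rpow (by positivity), inv_div]
      exact Real.rpow_le_rpow (by positivity) (by rw [div_le_iff₀ hR]; linarith) (by linarith)
  set K : ℝ := 2 ^ |β - 1| * (C * 2) with hK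
  have hK0 : 0 < K := by positivity
  have hq0 : 0 < q := by linarith
  have htail := tendsto_setLIntegral_Ioi_atTop hfin
  rw [Metric.tendsto_atTop']
  intro ε hε
  set δ : ℝ := (ε / 2) ^ q / K with hδ
  have hδ0 : 0 < δ := by positivity
  obtain ⟨N, hN⟩ := eventually_atTop.1
    (htail.eventually (gt_mem_nhds (ENNReal.ofReal_pos.2 hδ0)))
  refine ⟨max (2 * N) (max (2 * r₁) 2), fun R hR => ?_⟩
  simp only [gt_iff_lt, max_lt_iff] at hR
  obtain ⟨hRN, hRr, hR2⟩ := hR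
  have hR0 : 0 < R := by linarith
  have hrad : ∀ {a b : ℝ}, R / 2 ≤ a → R / 2 ≤ b - a → ∃ ρ ∈ Ioo a b,
      H ρ ≤ ENNReal.ofReal (δ / (R / 2)) := by
    intro a b ha hab
    have hlt : ∫⁻ x in Ioo a b, H x < ENNReal.ofReal δ :=
      (lintegral_mono_set Ioo_subset_Ioi_self).trans_lt (hN a (by linarith))
    obtain ⟨ρ, hρ, hle⟩ := exists_mem_Ioo_le_of_setLIntegral_lt (by linarith) hlt
    exact ⟨ρ, hρ, hle.trans (ENNReal.ofReal_le_ofReal (by gcongr))⟩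
  have hgood : ∀ {ρ : ℝ}, R / 2 < ρ → ρ < 2 * R → H ρ ≤ ENNReal.ofReal (δ / (R / 2)) →
      ∀ z ∈ Icc (-π) π, |f ρ z| ≤ ε / 2 / R ^ (β / q) := by
    intro ρ h1 h2 hHρ z hz
    have hb := hbound (by linarith) (by linarith) (by positivity) hHρ z hz
    have hKδ : R ^ β * |f ρ z| ^ q ≤ (ε / 2) ^ q := by
      calc R ^ β * |f ρ z| ^ q = R * (R ^ (β - 1) * |f ρ z| ^ q) := by
            rw [Real.rpow_sub_one hR0.ne']; field_simp
        _ ≤ R * (2 ^ |β - 1| * ρ ^ (β - 1) * |f ρ z| ^ q) := by gcongr; exact hcomp hR0 h1 h2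
        _ = R * 2 ^ |β - 1| * (ρ ^ (β - 1) * |f ρ z| ^ q) := by ring
        _ ≤ R * 2 ^ |β - 1| * (C * (δ / (R / 2))) := by gcongr
        _ = K * δ := by rw [hK]; field_simp
        _ = (ε / 2) ^ q := by rw [hδ]; field_simp
    rw [le_div_iff₀ (by positivity), ← Real.rpow_le_rpow_iff (by positivity) (by positivity) hq0,
      Real.mul_rpow (by positivity) (by positivity), ← Real.rpow_mul hR0.le,
      div_mul_cancel₀ _ hq0.ne', mul_comm]
    exact hKδ
  obtain ⟨ρ₁, hρ₁, hH₁⟩ := hrad (a := R / 2) (b := R) le_rfl (by linarith)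
  obtain ⟨ρ₂, hρ₂, hH₂⟩ := hrad (a := R) (b := 2 * R) (by linarith) (by linarith)
  obtain ⟨w, ⟨-, hw⟩, hw12, hwmax⟩ :=
    hmax ρ₁ ρ₂ (by linarith [hρ₁.1]) (hρ₁.2.trans hρ₂.1)
  have hw_le : |f w.1 w.2| ≤ ε / 2 / R ^ (β / q) := by
    rcases hw12 with h | h <;> rw [h]
    · exact hgood hρ₁.1 (by linarith [hρ₁.2]) hH₁ _ hw
    · exact hgood (by linarith [hρ₂.1]) hρ₂.2 hH₂ _ hw
  have hsup : ⨆ z : (Icc (-π) π : Set ℝ), |f R (z : ℝ)| ≤ ε / 2 / R ^ (β / q) := by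
    have : Nonempty (Icc (-π) π : Set ℝ) := ⟨⟨0, by constructor <;> linarith [Real.pi_pos]⟩⟩
    exact ciSup_le fun z => (hwmax (R, z) ⟨⟨hρ₁.2.le, hρ₂.1.le⟩, z.2⟩).trans hw_le
  have hsup0 : 0 ≤ ⨆ z : (Icc (-π) π : Set ℝ), |f R (z : ℝ)| :=
    Real.iSup_nonneg fun _ => abs_nonneg _
  rw [Real.dist_0_eq_abs, abs_of_nonneg (by positivity)]
  rw [le_div_iff₀ (by positivity)] at hsup
  linarith
end
end

section
/- Let r₁ > 0, q ∈ [2,∞), α ∈ ℝ, and let f = f(r,z) be a C¹ function on (r₁,∞) × ℝ that is 2π-periodic in z and satisfies ∫_{-π}^{π} ∫_{r₁}^{∞} r^α |f(r,z)|^{q-2} |∇_{r,z} f(r,z)|² dr dz + ∫_{-π}^{π} ∫_{r₁}^{∞} r^{q+1} |f(r,z)|^q dr dz < ∞. Then, with β = min{ q + 2, (α + q + 3)/2 }, there exists a sequence of radii r_n ∈ [2ⁿ, 2^{n+1}] (for all n with 2ⁿ > r₁) such that lim_{n→∞} r_n^{β} sup_{-π ≤ z ≤ π} |f(r_n,z)|^q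 = 0. -/
open MeasureTheory Real Set Filter Topology

noncomputable section

/-- A `C¹` function on `[-π, π]` is bounded by the integral of itself and of its derivative. -/
theorem le_integral_add_abs_deriv {φ φ' : ℝ → ℝ} (hφ : ∀ z, HasDerivAt φ (φ' z) z)
    (hφ' : Continuous φ') (hφ0 : ∀ z, 0 ≤ φ z) {z : ℝ} (hz : z ∈ Icc (-π) π) :
    φ z ≤ ∫ t in Icc (-π) π, (φ t + |φ' t|) := by
  have hπ := Real.pi_gt_three
  have hcont : Continuous φ := continuous_iff_continuousAt.2 fun z => (hφ z).continuousAt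
  have hint : IntegrableOn φ (Icc (-π) π) := hcont.continuousOn.integrableOn_Icc
  have hint' : IntegrableOn (fun t => |φ' t|) (Icc (-π) π) :=
    hφ'.abs.continuousOn.integrableOn_Icc
  have hvol : volume.real (Icc (-π) π) = 2 * π := by
    rw [Real.volume_real_Icc_of_le (by linarith)]; ring
  obtain ⟨w, hw, hwle⟩ := exists_le_setAverage (μ := volume) (s := Icc (-π) π) (f := φ)
    (by rw [Real.volume_Icc]; simp; linarith) (by rw [Real.volume_Icc]; simp) hint
  rw [setAverage_eq, hvol, smul_eq_mul] at hwle
  have hpos : 0 ≤ ∫ t in Icc (-π) π, φ t := integral_nonneg hφ0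
  have hw' : φ w ≤ ∫ t in Icc (-π) π, φ t := hwle.trans (by
    have : (2 * π)⁻¹ ≤ 1 := inv_le_one_of_one_le₀ (by linarith)
    nlinarith)
  have hftc : ∫ t in w..z, φ' t = φ z - φ w :=
    intervalIntegral.integral_eq_sub_of_hasDerivAt (fun t _ => hφ t)
      (hφ'.intervalIntegrable _ _)
  have hosc : φ z - φ w ≤ ∫ t in Icc (-π) π, |φ' t| := by
    rw [← hftc]
    refine (le_abs_self _).trans ?_
    rw [← Real.norm_eq_abs]
    refine intervalIntegral.norm_integral_le_integral_norm_uIoc.trans ?_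
    simp only [Real.norm_eq_abs]
    refine setIntegral_mono_set hint' (Eventually.of_forall fun t => abs_nonneg _) ?_
    exact (uIoc_subset_uIcc.trans (uIcc_subset_Icc hw hz)).eventuallyLE
  rw [integral_add hint hint']
  linarith

/-- The supremum of `|u| ^ q` is controlled by the integral of `|u| ^ q` and of its derivative. -/
theorem sup_abs_rpow_le {q : ℝ} (hq : 2 ≤ q) {u u' : ℝ → ℝ} (hu : ∀ z, HasDerivAt u (u' z) z)
    (hu' : Continuous u') :
    (⨆ z : (Icc (-π) π : Set ℝ), |u z|) ^ q ≤
      ∫ t in Icc (-π) π, (|u t| ^ q + q * |u t| ^ (q - 1) * |u' t|) := by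
  have hcont : Continuous u := continuous_iff_continuousAt.2 fun z => (hu z).continuousAt
  have hderiv : ∀ z, HasDerivAt (fun t => |u t| ^ q) (q * |u z| ^ (q - 2) * u z * u' z) z :=
    fun z => (hasDerivAt_abs_rpow (u z) (by linarith)).comp z (hu z)
  have habs : ∀ t, |q * |u t| ^ (q - 2) * u t * u' t| = q * |u t| ^ (q - 1) * |u' t| := by
    intro t
    rw [abs_mul, abs_mul, abs_mul, abs_of_nonneg (by linarith : 0 ≤ q),
      abs_of_nonneg (Real.rpow_nonneg (abs_nonneg (u t)) _), mul_assoc q,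
      show q - 1 = (q - 2) + 1 by ring,
      Real.rpow_add_of_nonneg (abs_nonneg _) (by linarith) (by norm_num), Real.rpow_one]
  have hbound : ∀ z ∈ Icc (-π) π, |u z| ^ q ≤
      ∫ t in Icc (-π) π, (|u t| ^ q + q * |u t| ^ (q - 1) * |u' t|) := by
    intro z hz
    have := le_integral_add_abs_deriv hderiv
      (((continuous_const.mul (hcont.abs.rpow_const fun _ => Or.inr (by linarith))).mul
        hcont).mul hu') (fun t => Real.rpow_nonneg (abs_nonneg _) _) hz
    simpa only [habs] using this
  have hπ := Real.pi_pos
  have h0 : (0 : ℝ) ∈ Icc (-π) π := ⟨by linarith, by linarith⟩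
  have hM := (Real.rpow_nonneg (abs_nonneg (u 0)) q).trans (hbound 0 h0)
  have : Nonempty (Icc (-π) π) := ⟨⟨0, h0⟩⟩
  rw [← Real.le_rpow_inv_iff_of_pos (Real.iSup_nonneg fun _ => abs_nonneg _) hM (by linarith)]
  refine ciSup_le fun z => ?_
  rw [Real.le_rpow_inv_iff_of_pos (abs_nonneg _) hM (by linarith)]
  exact hbound z z.2

/-- Pointwise Young inequality between the weighted energy density and the density controlling
the oscillation of `|a| ^ q`. -/
theorem weighted_young {q α r a b c : ℝ} (hq : 2 ≤ q) (hr : 1 ≤ r) :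
    r ^ (min (q + 1) ((α + q + 1) / 2)) * (|a| ^ q + q * |a| ^ (q - 1) * |b|) ≤
      (1 + q / 2) * (r ^ α * |a| ^ (q - 2) * (c ^ 2 + b ^ 2) + r ^ (q + 1) * |a| ^ q) := by
  have hr0 : 0 < r := by linarith
  have h1 : r ^ (min (q + 1) ((α + q + 1) / 2)) ≤ r ^ (q + 1) :=
    Real.rpow_le_rpow_of_exponent_le hr (min_le_left _ _)
  have h2 : r ^ (min (q + 1) ((α + q + 1) / 2)) ≤ r ^ (α / 2) * r ^ ((q + 1) / 2) := by
    rw [← Real.rpow_add hr0]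
    exact Real.rpow_le_rpow_of_exponent_le hr ((min_le_right _ _).trans (by linarith))
  have hα : r ^ α = (r ^ (α / 2)) ^ 2 := by
    rw [← Real.rpow_natCast, ← Real.rpow_mul hr0.le]; norm_num
  have hqr : r ^ (q + 1) = (r ^ ((q + 1) / 2)) ^ 2 := by
    rw [← Real.rpow_natCast, ← Real.rpow_mul hr0.le]; norm_num
  have ha1 : |a| ^ (q - 1) = |a| ^ (q - 2) * |a| := by
    rw [show q - 1 = (q - 2) + 1 by ring,
      Real.rpow_add_of_nonneg (abs_nonneg _) (by linarith) (by norm_num), Real.rpow_one]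
  have ha2 : |a| ^ q = |a| ^ (q - 2) * |a| ^ 2 := by
    conv_lhs => rw [show q = (q - 2) + 2 by ring,
      Real.rpow_add_of_nonneg (abs_nonneg _) (by linarith) (by norm_num), Real.rpow_two]
  have hp : 0 ≤ |a| ^ (q - 2) := Real.rpow_nonneg (abs_nonneg _) _
  have hA := Real.rpow_nonneg hr0.le (α / 2)
  have hB := Real.rpow_nonneg hr0.le ((q + 1) / 2)
  have e1 := mul_le_mul_of_nonneg_right h1 (Real.rpow_nonneg (abs_nonneg a) q)
  have e2 := mul_le_mul_of_nonneg_right h2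
    (by positivity : 0 ≤ q * |a| ^ (q - 1) * |b|)
  rw [mul_add]
  refine (add_le_add e1 e2).trans ?_
  rw [hα, hqr, ha1, ha2, ← sq_abs b]
  generalize r ^ (α / 2) = A at *
  generalize r ^ ((q + 1) / 2) = B at *
  generalize |a| ^ (q - 2) = p at *
  have k1 : 0 ≤ q / 2 * p * (A * |b| - B * |a|) ^ 2 := by positivity
  have k2 : 0 ≤ p * (A ^ 2 * |b| ^ 2) := by positivity
  have k3 : 0 ≤ (1 + q / 2) * (p * (A ^ 2 * c ^ 2)) := by positivity
  nlinarith

/-- existence of a good dyadic sequence of radii along which the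
weighted sup of `f` decays, from the weighted integral bounds. -/
theorem good_dyadic_radii (r₁ q α : ℝ) (hr₁ : 0 < r₁) (hq : 2 ≤ q)
    (f : ℝ → ℝ → ℝ)
    (hf : ContDiffOn ℝ 1 (fun w : ℝ × ℝ => f w.1 w.2) (Ioi r₁ ×ˢ univ))
    (hper : ∀ r z : ℝ, f r (z + 2 * π) = f r z)
    (hint : ∫⁻ w : ℝ × ℝ in Ioi r₁ ×ˢ Icc (-π) π,
      ENNReal.ofReal
        (w.1 ^ α * |f w.1 w.2| ^ (q - 2) * ((dr f w.1 w.2) ^ 2 + (dzz f w.1 w.2) ^ 2)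
          + w.1 ^ (q + 1) * |f w.1 w.2| ^ q) < ⊤) :
    ∃ rs : ℕ → ℝ,
      (∀ n : ℕ, r₁ < 2 ^ n → rs n ∈ Icc ((2 : ℝ) ^ n) (2 ^ (n + 1))) ∧
      Tendsto
        (fun n : ℕ => rs n ^ (min (q + 2) ((α + q + 3) / 2)) *
          (⨆ z : (Icc (-π) π : Set ℝ), |f (rs n) (z : ℝ)|) ^ q)
        atTop (𝓝 0) := by
  set γ := min (q + 1) ((α + q + 1) / 2) with hγ
  have hβ : min (q + 2) ((α + q + 3) / 2) = γ + 1 := by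
    rw [hγ, ← min_add_add_right]; congr 1 <;> ring
  set U : Set (ℝ × ℝ) := Ioi r₁ ×ˢ univ with hU
  have hUo : IsOpen U := isOpen_Ioi.prod isOpen_univ
  have hmem : ∀ {r z : ℝ}, r₁ < r → (r, z) ∈ U := fun h => ⟨h, mem_univ _⟩
  have hpartial : ∀ {r : ℝ}, r₁ < r → ∀ z, HasDerivAt (f r)
      (fderiv ℝ (fun w : ℝ × ℝ => f w.1 w.2) (r, z) (0, 1)) z := by
    intro r hr z
    have hd : DifferentiableAt ℝ (fun w : ℝ × ℝ => f w.1 w.2) (r, z) :=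
      (hf.contDiffAt (hUo.mem_nhds (hmem hr))).differentiableAt (by norm_num)
    exact hd.hasFDerivAt.comp_hasDerivAt z ((hasDerivAt_const z r).prodMk (hasDerivAt_id z))
  have hdzz : ∀ {r : ℝ}, r₁ < r → ∀ z, HasDerivAt (f r) (dzz f r z) z :=
    fun hr z => (hpartial hr z).differentiableAt.hasDerivAt
  have hdzzc : ContinuousOn (fun w : ℝ × ℝ => dzz f w.1 w.2) U := by
    refine ((hf.continuousOn_fderiv_of_isOpen hUo le_rfl).clm_apply
      (continuousOn_const (c := ((0, 1) : ℝ × ℝ)))).congr fun w hw => ?_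
    exact (hpartial hw.1 w.2).deriv
  set K : ℝ × ℝ → ℝ := fun w =>
    w.1 ^ γ * (|f w.1 w.2| ^ q + q * |f w.1 w.2| ^ (q - 1) * |dzz f w.1 w.2|) with hK
  have hfc : ContinuousOn (fun w : ℝ × ℝ => f w.1 w.2) U := hf.continuousOn
  have hKc : ContinuousOn K U := by
    refine (continuousOn_fst.rpow_const fun w hw => Or.inl (hr₁.trans hw.1).ne').mul
      ((hfc.abs.rpow_const fun _ _ => Or.inr (by linarith)).add
        ((continuousOn_const.mul (hfc.abs.rpow_const fun _ _ => Or.inr (by linarith))).mul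
          hdzzc.abs))
  set r₂ := max r₁ 1
  have hsub : Ioi r₂ ×ˢ Icc (-π) π ⊆ Ioi r₁ ×ˢ Icc (-π) π :=
    prod_mono (Ioi_subset_Ioi (le_max_left _ _)) subset_rfl
  have hKint : IntegrableOn K (Ioi r₂ ×ˢ Icc (-π) π) := by
    have hmeas : MeasurableSet (Ioi r₂ ×ˢ Icc (-π) π : Set (ℝ × ℝ)) :=
      measurableSet_Ioi.prod measurableSet_Icc
    refine ⟨(hKc.mono (hsub.trans (prod_mono subset_rfl (subset_univ _)))).aestronglyMeasurable
      hmeas, ?_⟩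
    refine lt_of_le_of_lt ?_ (ENNReal.mul_lt_top
      (ENNReal.ofReal_lt_top (r := 1 + q / 2)) hint)
    rw [← lintegral_const_mul' _ _ ENNReal.ofReal_ne_top]
    refine le_trans (setLIntegral_mono' hmeas fun w hw => ?_) (lintegral_mono_set hsub)
    have hw1 : 1 ≤ w.1 := ((le_max_right _ _).trans_lt hw.1).le
    rw [← ENNReal.ofReal_mul (by linarith), ← ofReal_norm, Real.norm_eq_abs,
      abs_of_nonneg (by positivity)]
    exact ENNReal.ofReal_le_ofReal (weighted_young hq hw1)
  set Φ : ℝ → ℝ := fun r => ∫ z in Icc (-π) π, K (r, z) with hΦ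
  have hΦint : IntegrableOn Φ (Ioi r₂) := by
    rw [IntegrableOn, Measure.volume_eq_prod, ← Measure.prod_restrict] at hKint
    exact hKint.integral_prod_left
  have hpow : Tendsto (fun n : ℕ => (2 : ℝ) ^ n) atTop atTop :=
    tendsto_pow_atTop_atTop_of_one_lt (by norm_num)
  set a : ℕ → ℝ := fun n => ∫ r in Icc ((2 : ℝ) ^ n) (2 ^ (n + 1)), Φ r with ha
  have hle : ∀ n : ℕ, (2 : ℝ) ^ n ≤ 2 ^ (n + 1) := fun n =>
    pow_le_pow_right₀ (by norm_num) n.le_succ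
  have ha0 : Tendsto a atTop (𝓝 0) := by
    have h1 := intervalIntegral_tendsto_integral_Ioi r₂ hΦint hpow
    have h2 := (h1.comp (tendsto_add_atTop_nat 1)).sub h1
    rw [sub_self] at h2
    refine h2.congr' ?_
    filter_upwards [hpow.eventually_gt_atTop r₂] with n hn
    have hi : ∀ {s : ℝ}, r₂ ≤ s → IntervalIntegrable Φ volume r₂ s := fun h =>
      (intervalIntegrable_iff_integrableOn_Ioc_of_le h).2 (hΦint.mono_set Ioc_subset_Ioi_self)
    simp only [Function.comp_apply, ha]
    rw [intervalIntegral.integral_interval_sub_left (hi (hn.le.trans (hle n))) (hi hn.le),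
      intervalIntegral.integral_of_le (hle n), integral_Icc_eq_integral_Ioc]
  have hsup : ∀ {r : ℝ}, r₁ < r →
      r ^ γ * (⨆ z : (Icc (-π) π : Set ℝ), |f r (z : ℝ)|) ^ q ≤ Φ r := by
    intro r hr
    have hc : Continuous (dzz f r) :=
      continuousOn_univ.1 (hdzzc.comp (g := fun w : ℝ × ℝ => dzz f w.1 w.2)
        (f := fun z => (r, z)) (by fun_prop) fun z _ => hmem hr)
    simp only [hΦ, hK]
    rw [integral_const_mul]
    exact mul_le_mul_of_nonneg_left (sup_abs_rpow_le hq (hdzz hr) hc)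
      (Real.rpow_nonneg (hr₁.trans hr).le _)
  have hchoice : ∀ n : ℕ, ∃ r ∈ Icc ((2 : ℝ) ^ n) (2 ^ (n + 1)), r₂ < 2 ^ n →
      r ^ (γ + 1) * (⨆ z : (Icc (-π) π : Set ℝ), |f r (z : ℝ)|) ^ q ≤ 2 * a n := by
    intro n
    by_cases hn : r₂ < 2 ^ n
    swap
    · exact ⟨2 ^ n, left_mem_Icc.2 (hle n), fun h => absurd h hn⟩
    have h2n : (0 : ℝ) < 2 ^ n := by positivity
    have hlen : (2 : ℝ) ^ (n + 1) - 2 ^ n = 2 ^ n := by ring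
    obtain ⟨r, hr, hrle⟩ := exists_le_setAverage (μ := volume)
      (s := Icc ((2 : ℝ) ^ n) (2 ^ (n + 1))) (f := Φ)
      (by rw [Real.volume_Icc, hlen]; simp) (by rw [Real.volume_Icc]; simp)
      (hΦint.mono_set fun x hx => hn.trans_le hx.1)
    refine ⟨r, hr, fun _ => ?_⟩
    rw [setAverage_eq, Real.volume_real_Icc_of_le (hle n), hlen, smul_eq_mul] at hrle
    have hr0 : 0 < r := h2n.trans_le hr.1
    have hs := (hsup ((le_max_left r₁ 1).trans_lt (hn.trans_le hr.1))).trans hrle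
    have hS : 0 ≤ r ^ γ * (⨆ z : (Icc (-π) π : Set ℝ), |f r (z : ℝ)|) ^ q :=
      mul_nonneg (Real.rpow_nonneg hr0.le _)
        (Real.rpow_nonneg (Real.iSup_nonneg fun _ => abs_nonneg _) _)
    calc r ^ (γ + 1) * (⨆ z : (Icc (-π) π : Set ℝ), |f r (z : ℝ)|) ^ q
        = r * (r ^ γ * (⨆ z : (Icc (-π) π : Set ℝ), |f r (z : ℝ)|) ^ q) := by
          rw [Real.rpow_add_one hr0.ne']; ring
      _ ≤ 2 ^ (n + 1) * ((2 ^ n)⁻¹ * a n) :=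
          mul_le_mul hr.2 hs hS (by positivity)
      _ = 2 * a n := by field_simp; ring
  choose rs hrs hrs' using hchoice
  refine ⟨rs, fun n _ => hrs n, ?_⟩
  rw [hβ]
  refine squeeze_zero' (Eventually.of_forall fun n => ?_) ?_ (by simpa using ha0.const_mul 2)
  · have : 0 ≤ rs n := (by positivity : (0 : ℝ) ≤ 2 ^ n).trans (hrs n).1
    exact mul_nonneg (Real.rpow_nonneg this _)
      (Real.rpow_nonneg (Real.iSup_nonneg fun _ => abs_nonneg _) _)
  · filter_upwards [hpow.eventually_gt_atTop r₂] with n hn using hrs' n hn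
end
end

section
/- Let (v,p) be a smooth axisymmetric solution with no swirl of the steady Navier–Stokes equations on the periodic slab domain D × S¹, satisfying the generalized Dirichlet integral condition with exponent q for some q ∈ (2,∞). Then lim_{r→∞} r^{1 + 2/q − 1/q²} sup_{z ∈ [-π,π]} |Ω(r,z)| = 0. -/
open MeasureTheory Real Set Filter Topology

noncomputable section

/-- Three-dimensional Euclidean space. -/
abbrev E3 := EuclideanSpace ℝ (Fin 3)

/-- The distance to the `x₃`-axis, `r = √(x₁² + x₂²)`. -/
def rr (x : E3) : ℝ := Real.sqrt ((x 0) ^ 2 + (x 1) ^ 2)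

/-- Partial derivative of `g : ℝ³ → ℝ` in the `i`-th coordinate direction. -/
def pd (i : Fin 3) (g : E3 → ℝ) (x : E3) : ℝ := fderiv ℝ g x (EuclideanSpace.single i 1)

/-- The azimuthal vorticity `ω^θ = ∂_z v^r − ∂_r v^z` of an axisymmetric vector
field without swirl, as a function of `(r,z)`. -/
def omTheta (vr vz : ℝ → ℝ → ℝ) (r z : ℝ) : ℝ := dzz vr r z - dr vz r z

/-- The rescaled azimuthal vorticity `Ω = ω^θ / r`. -/
def Om (vr vz : ℝ → ℝ → ℝ) (r z : ℝ) : ℝ := omTheta vr vz r z / r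

/-- The squared Frobenius norm `|∇v|² = ∑ᵢⱼ (∂ᵢ vⱼ)²` of the gradient of a
vector field `v : ℝ³ → ℝ³`. -/
def gradSq3 (v : E3 → E3) (x : E3) : ℝ := ∑ i, ∑ j, (pd i (fun y => v y j) x) ^ 2

/-- `v, p, vr, vz` constitute a smooth axisymmetric solution, without swirl, of the
steady Navier–Stokes equations in the periodic (in `x₃`, with period `2π`) slab
domain `D × S¹`, where `D = {(x₁,x₂) : √(x₁²+x₂²) > r₀}`; the functions `vr, vz`
of `(r,z)` are the cylindrical components of `v`. -/
structure AxisymNoSwirlNSSlab (r₀ : ℝ) (v : E3 → E3) (p : E3 → ℝ)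
    (vr vz : ℝ → ℝ → ℝ) : Prop where
  smooth_v : ContDiffOn ℝ (⊤ : ℕ∞) v {x : E3 | r₀ < rr x}
  smooth_p : ContDiffOn ℝ (⊤ : ℕ∞) p {x : E3 | r₀ < rr x}
  periodic : ∀ x : E3, v (x + (2 * π) • EuclideanSpace.single (2 : Fin 3) (1 : ℝ)) = v x
  axisym_no_swirl : ∀ x : E3, r₀ < rr x →
    v x 0 = vr (rr x) (x 2) * (x 0 / rr x) ∧
    v x 1 = vr (rr x) (x 2) * (x 1 / rr x) ∧
    v x 2 = vz (rr x) (x 2)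
  momentum : ∀ x : E3, r₀ < rr x → ∀ j : Fin 3,
    (∑ i, v x i * pd i (fun y => v y j) x) + pd j p x
      = ∑ i, pd i (pd i (fun y => v y j)) x
  incompressible : ∀ x : E3, r₀ < rr x → (∑ i, pd i (fun y => v y i) x) = 0

open scoped ContDiff

/-- The half plane `{(r, z) : r₀ < r}` of meridional coordinates. -/
def halfPlane (r₀ : ℝ) : Set (ℝ × ℝ) := {x | r₀ < x.1}

/-- Partial derivative of a function of `(r, z)` in `r`. -/
def dFst (f : ℝ × ℝ → ℝ) (x : ℝ × ℝ) : ℝ := fderiv ℝ f x (1, 0)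

/-- Partial derivative of a function of `(r, z)` in `z`. -/
def dSnd (f : ℝ × ℝ → ℝ) (x : ℝ × ℝ) : ℝ := fderiv ℝ f x (0, 1)

section PartialDerivatives

variable {r₀ : ℝ} {f g : ℝ × ℝ → ℝ} {x : ℝ × ℝ}

lemma isOpen_halfPlane (r₀ : ℝ) : IsOpen (halfPlane r₀) :=
  isOpen_lt continuous_const continuous_fst

lemma halfPlane_mem_nhds (hx : x ∈ halfPlane r₀) : halfPlane r₀ ∈ 𝓝 x :=
  (isOpen_halfPlane r₀).mem_nhds hx

lemma ContDiffOn.differentiableAt_halfPlane (hf : ContDiffOn ℝ ∞ f (halfPlane r₀))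
    (hx : x ∈ halfPlane r₀) : DifferentiableAt ℝ f x :=
  (hf.contDiffAt (halfPlane_mem_nhds hx)).differentiableAt (by simp)

lemma ContDiffOn.dFst (hf : ContDiffOn ℝ ∞ f (halfPlane r₀)) :
    ContDiffOn ℝ ∞ (dFst f) (halfPlane r₀) :=
  (hf.fderiv_of_isOpen (isOpen_halfPlane r₀) (by simp)).clm_apply contDiffOn_const

lemma ContDiffOn.dSnd (hf : ContDiffOn ℝ ∞ f (halfPlane r₀)) :
    ContDiffOn ℝ ∞ (dSnd f) (halfPlane r₀) :=
  (hf.fderiv_of_isOpen (isOpen_halfPlane r₀) (by simp)).clm_apply contDiffOn_const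

lemma dFst_congr (h : EqOn f g (halfPlane r₀)) (hx : x ∈ halfPlane r₀) :
    dFst f x = dFst g x := by
  rw [dFst, dFst, (h.eventuallyEq_of_mem (halfPlane_mem_nhds hx)).fderiv_eq]

lemma dSnd_congr (h : EqOn f g (halfPlane r₀)) (hx : x ∈ halfPlane r₀) :
    dSnd f x = dSnd g x := by
  rw [dSnd, dSnd, (h.eventuallyEq_of_mem (halfPlane_mem_nhds hx)).fderiv_eq]

lemma dFst_add (hf : DifferentiableAt ℝ f x) (hg : DifferentiableAt ℝ g x) :
    dFst (fun y => f y + g y) x = dFst f x + dFst g x := by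
  simp [dFst, fderiv_fun_add hf hg]

lemma dSnd_add (hf : DifferentiableAt ℝ f x) (hg : DifferentiableAt ℝ g x) :
    dSnd (fun y => f y + g y) x = dSnd f x + dSnd g x := by
  simp [dSnd, fderiv_fun_add hf hg]

lemma dFst_sub (hf : DifferentiableAt ℝ f x) (hg : DifferentiableAt ℝ g x) :
    dFst (fun y => f y - g y) x = dFst f x - dFst g x := by
  simp [dFst, fderiv_fun_sub hf hg]

lemma dSnd_sub (hf : DifferentiableAt ℝ f x) (hg : DifferentiableAt ℝ g x) :
    dSnd (fun y => f y - g y) x = dSnd f x - dSnd g x := by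
  simp [dSnd, fderiv_fun_sub hf hg]

lemma dFst_mul (hf : DifferentiableAt ℝ f x) (hg : DifferentiableAt ℝ g x) :
    dFst (fun y => f y * g y) x = dFst f x * g x + f x * dFst g x := by
  simp [dFst, fderiv_fun_mul hf hg]; ring

lemma dSnd_mul (hf : DifferentiableAt ℝ f x) (hg : DifferentiableAt ℝ g x) :
    dSnd (fun y => f y * g y) x = dSnd f x * g x + f x * dSnd g x := by
  simp [dSnd, fderiv_fun_mul hf hg]; ring

@[simp] lemma dFst_fst : dFst (fun y => y.1) x = 1 := by
  simp [dFst, (hasFDerivAt_fst (𝕜 := ℝ) (p := x)).fderiv]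

@[simp] lemma dSnd_fst : dSnd (fun y => y.1) x = 0 := by
  simp [dSnd, (hasFDerivAt_fst (𝕜 := ℝ) (p := x)).fderiv]

@[simp] lemma dFst_const (c : ℝ) : dFst (fun _ => c) x = 0 := by simp [dFst]

@[simp] lemma dSnd_const (c : ℝ) : dSnd (fun _ => c) x = 0 := by simp [dSnd]

lemma hasDerivAt_dFst (hf : DifferentiableAt ℝ f x) :
    HasDerivAt (fun s => f (s, x.2)) (dFst f x) x.1 := by
  have h : HasDerivAt (fun s : ℝ => (s, x.2)) ((1 : ℝ), (0 : ℝ)) x.1 :=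
    (hasDerivAt_id _).prodMk (hasDerivAt_const _ _)
  exact HasFDerivAt.comp_hasDerivAt (f := fun s : ℝ => (s, x.2)) x.1 hf.hasFDerivAt h

lemma hasDerivAt_dSnd (hf : DifferentiableAt ℝ f x) :
    HasDerivAt (fun t => f (x.1, t)) (dSnd f x) x.2 := by
  have h : HasDerivAt (fun t : ℝ => (x.1, t)) ((0 : ℝ), (1 : ℝ)) x.2 :=
    (hasDerivAt_const _ _).prodMk (hasDerivAt_id _)
  exact HasFDerivAt.comp_hasDerivAt (f := fun t : ℝ => (x.1, t)) x.2 hf.hasFDerivAt h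

lemma dFst_dSnd_comm (hf : ContDiffOn ℝ ∞ f (halfPlane r₀)) (hx : x ∈ halfPlane r₀) :
    dFst (dSnd f) x = dSnd (dFst f) x := by
  have hc := hf.contDiffAt (halfPlane_mem_nhds hx)
  have hd : DifferentiableAt ℝ (fderiv ℝ f) x :=
    (hc.fderiv_right (m := ∞) (by simp)).differentiableAt (by simp)
  have hs : IsSymmSndFDerivAt ℝ f x :=
    hc.isSymmSndFDerivAt (by simpa using WithTop.coe_le_coe.2 (le_top : (2 : ℕ∞) ≤ ⊤))
  have h1 : fderiv ℝ (dSnd f) x (1, 0) = fderiv ℝ (fderiv ℝ f) x (1, 0) (0, 1) := by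
    change fderiv ℝ (fun y => fderiv ℝ f y (0, 1)) x (1, 0) = _
    rw [fderiv_clm_apply hd (differentiableAt_const _)]
    simp
  have h2 : fderiv ℝ (dFst f) x (0, 1) = fderiv ℝ (fderiv ℝ f) x (0, 1) (1, 0) := by
    change fderiv ℝ (fun y => fderiv ℝ f y (1, 0)) x (0, 1) = _
    rw [fderiv_clm_apply hd (differentiableAt_const _)]
    simp
  rw [dFst, dSnd, h1, h2, hs.eq]

lemma dFst_periodic {T : ℝ} (hf : ∀ y, f (y + (0, T)) = f y) (x : ℝ × ℝ) :
    dFst f (x + (0, T)) = dFst f x := by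
  rw [dFst, dFst, ← fderiv_comp_add_right]; simp_rw [hf]

lemma dSnd_periodic {T : ℝ} (hf : ∀ y, f (y + (0, T)) = f y) (x : ℝ × ℝ) :
    dSnd f (x + (0, T)) = dSnd f x := by
  rw [dSnd, dSnd, ← fderiv_comp_add_right]; simp_rw [hf]

end PartialDerivatives

section CylindricalCoordinates

/-- The point of the meridional half plane `x₂ = 0` with cylindrical coordinates `(r, z)`. -/
def meridian (y : ℝ × ℝ) : E3 := !₂[y.1, 0, y.2]

/-- The cylindrical coordinates `(r, z)` of a point. -/
def cyl (x : E3) : ℝ × ℝ := (rr x, x 2)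

variable {r₀ : ℝ} {f g : E3 → ℝ} {x : E3}

lemma continuous_rr : Continuous rr := by unfold rr; fun_prop

lemma isOpen_lt_rr (r₀ : ℝ) : IsOpen {x : E3 | r₀ < rr x} :=
  isOpen_lt continuous_const continuous_rr

@[simp] lemma meridian_zero (y : ℝ × ℝ) : meridian y 0 = y.1 := rfl
@[simp] lemma meridian_one (y : ℝ × ℝ) : meridian y 1 = 0 := rfl
@[simp] lemma meridian_two (y : ℝ × ℝ) : meridian y 2 = y.2 := rfl

lemma rr_meridian {y : ℝ × ℝ} (hy : 0 ≤ y.1) : rr (meridian y) = y.1 := by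
  simp [rr, Real.sqrt_sq hy]

lemma cyl_meridian {y : ℝ × ℝ} (hy : 0 ≤ y.1) : cyl (meridian y) = y := by
  simp [cyl, rr_meridian hy]

lemma rr_sq (x : E3) : rr x ^ 2 = x 0 ^ 2 + x 1 ^ 2 := Real.sq_sqrt (by positivity)

lemma contDiff_meridian : ContDiff ℝ ∞ meridian := by
  rw [contDiff_euclidean]
  intro i
  fin_cases i
  · exact contDiff_fst
  · exact contDiff_const
  · exact contDiff_snd

lemma pd_congr (h : EqOn f g {x | r₀ < rr x}) (hx : r₀ < rr x) (i : Fin 3) :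
    pd i f x = pd i g x := by
  rw [pd, pd, (h.eventuallyEq_of_mem ((isOpen_lt_rr r₀).mem_nhds hx)).fderiv_eq]

lemma pd_add (i : Fin 3) (hf : DifferentiableAt ℝ f x) (hg : DifferentiableAt ℝ g x) :
    pd i (fun y => f y + g y) x = pd i f x + pd i g x := by
  simp [pd, fderiv_fun_add hf hg]

lemma pd_mul (i : Fin 3) (hf : DifferentiableAt ℝ f x) (hg : DifferentiableAt ℝ g x) :
    pd i (fun y => f y * g y) x = pd i f x * g x + f x * pd i g x := by
  simp [pd, fderiv_fun_mul hf hg]; ring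

lemma hasFDerivAt_coord (j : Fin 3) (x : E3) :
    HasFDerivAt (fun y : E3 => y j) (EuclideanSpace.proj j : E3 →L[ℝ] ℝ) x :=
  (EuclideanSpace.proj j : E3 →L[ℝ] ℝ).hasFDerivAt

lemma differentiableAt_coord (j : Fin 3) (x : E3) : DifferentiableAt ℝ (fun y : E3 => y j) x :=
  (hasFDerivAt_coord j x).differentiableAt

lemma pd_coord (i j : Fin 3) (x : E3) : pd i (fun y => y j) x = if j = i then 1 else 0 := by
  rw [pd, (hasFDerivAt_coord j x).fderiv]
  simp

lemma hasFDerivAt_rr (hx : 0 < rr x) :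
    HasFDerivAt rr ((x 0 / rr x) • (EuclideanSpace.proj 0 : E3 →L[ℝ] ℝ) +
      (x 1 / rr x) • (EuclideanSpace.proj 1 : E3 →L[ℝ] ℝ)) x := by
  have h0 : x 0 ^ 2 + x 1 ^ 2 ≠ 0 := by rw [← rr_sq]; positivity
  have h := (((hasFDerivAt_coord 0 x).pow 2).add ((hasFDerivAt_coord 1 x).pow 2)).sqrt h0
  refine h.congr_fderiv ?_
  ext1 v
  simp [rr]
  field_simp

lemma hasFDerivAt_cyl (hx : 0 < rr x) :
    HasFDerivAt cyl (((x 0 / rr x) • (EuclideanSpace.proj 0 : E3 →L[ℝ] ℝ) +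
      (x 1 / rr x) • (EuclideanSpace.proj 1 : E3 →L[ℝ] ℝ)).prod
        (EuclideanSpace.proj 2 : E3 →L[ℝ] ℝ)) x :=
  (hasFDerivAt_rr hx).prodMk (hasFDerivAt_coord 2 x)

variable {F : ℝ × ℝ → ℝ}

lemma differentiableAt_comp_cyl (hx : 0 < rr x) (hF : DifferentiableAt ℝ F (cyl x)) :
    DifferentiableAt ℝ (fun y => F (cyl y)) x :=
  hF.comp x (hasFDerivAt_cyl hx).differentiableAt

lemma fderiv_comp_cyl (hx : 0 < rr x) (hF : DifferentiableAt ℝ F (cyl x)) (v : E3) :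
    fderiv ℝ (fun y => F (cyl y)) x v =
      (x 0 / rr x * v 0 + x 1 / rr x * v 1) * dFst F (cyl x) + v 2 * dSnd F (cyl x) := by
  have h : HasFDerivAt (fun y => F (cyl y)) _ x := hF.hasFDerivAt.comp x (hasFDerivAt_cyl hx)
  have hL : ∀ s t : ℝ, fderiv ℝ F (cyl x) (s, t) = s * dFst F (cyl x) + t * dSnd F (cyl x) := by
    intro s t
    have e : ((s, t) : ℝ × ℝ) = s • (1, 0) + t • (0, 1) := by simp
    rw [e, map_add, map_smul, map_smul]; rfl
  rw [h.fderiv, ← hL]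
  simp

lemma pd_zero_comp_cyl (hx : 0 < rr x) (hF : DifferentiableAt ℝ F (cyl x)) :
    pd 0 (fun y => F (cyl y)) x = x 0 * (dFst F (cyl x) * (rr x)⁻¹) := by
  rw [pd, fderiv_comp_cyl hx hF]; simp; ring

lemma pd_one_comp_cyl (hx : 0 < rr x) (hF : DifferentiableAt ℝ F (cyl x)) :
    pd 1 (fun y => F (cyl y)) x = x 1 * (dFst F (cyl x) * (rr x)⁻¹) := by
  rw [pd, fderiv_comp_cyl hx hF]; simp; ring

lemma pd_two_comp_cyl (hx : 0 < rr x) (hF : DifferentiableAt ℝ F (cyl x)) :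
    pd 2 (fun y => F (cyl y)) x = dSnd F (cyl x) := by
  rw [pd, fderiv_comp_cyl hx hF]; simp

lemma hasFDerivAt_meridian (y : ℝ × ℝ) : HasFDerivAt meridian (fderiv ℝ meridian y) y :=
  (contDiff_meridian.differentiable (by simp) y).hasFDerivAt

lemma fderiv_meridian_apply (y v : ℝ × ℝ) : fderiv ℝ meridian y v = meridian v := by
  have h : ∀ i, HasFDerivAt (fun y => meridian y i)
      ((EuclideanSpace.proj i : E3 →L[ℝ] ℝ) ∘L fderiv ℝ meridian y) y :=
    fun i => (hasFDerivAt_coord i _).comp y (hasFDerivAt_meridian y)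
  ext i
  have hi := DFunLike.congr_fun (h i).fderiv v
  change _ = (fderiv ℝ meridian y v) i at hi
  rw [← hi]
  fin_cases i
  · change fderiv ℝ (fun y : ℝ × ℝ => y.1) y v = _
    rw [hasFDerivAt_fst.fderiv]; rfl
  · change fderiv ℝ (fun _ : ℝ × ℝ => (0 : ℝ)) y v = _
    simp
  · change fderiv ℝ (fun y : ℝ × ℝ => y.2) y v = _
    rw [hasFDerivAt_snd.fderiv]; rfl

lemma dFst_comp_meridian {y : ℝ × ℝ} (hf : DifferentiableAt ℝ f (meridian y)) :
    dFst (fun y => f (meridian y)) y = pd 0 f (meridian y) := by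
  have h : HasFDerivAt (fun y => f (meridian y)) _ y :=
    hf.hasFDerivAt.comp y (hasFDerivAt_meridian y)
  rw [dFst, h.fderiv, pd,
    ContinuousLinearMap.comp_apply, fderiv_meridian_apply]
  congr 1
  ext i; fin_cases i <;> simp [meridian]

lemma dSnd_comp_meridian {y : ℝ × ℝ} (hf : DifferentiableAt ℝ f (meridian y)) :
    dSnd (fun y => f (meridian y)) y = pd 2 f (meridian y) := by
  have h : HasFDerivAt (fun y => f (meridian y)) _ y :=
    hf.hasFDerivAt.comp y (hasFDerivAt_meridian y)
  rw [dSnd, h.fderiv, pd,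
    ContinuousLinearMap.comp_apply, fderiv_meridian_apply]
  congr 1
  ext i; fin_cases i <;> simp [meridian]

end CylindricalCoordinates

section MeridionalFlow

variable {r₀ : ℝ}

/-- The quantity `Ω = ω^θ / r` in terms of `a = v^r / r` and `w = v^z`. -/
def scaledVorticity (a w : ℝ × ℝ → ℝ) (x : ℝ × ℝ) : ℝ := dSnd a x - dFst w x * x.1⁻¹

/-- A `2π`-periodic incompressible flow with velocity components `v^r = r a` and `v^z = w`,
whose scaled vorticity satisfies the stationary vorticity equation. -/
structure MeridionalFlow (r₀ : ℝ) (a w : ℝ × ℝ → ℝ) : Prop where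
  smooth_a : ContDiffOn ℝ ∞ a (halfPlane r₀)
  smooth_w : ContDiffOn ℝ ∞ w (halfPlane r₀)
  periodic_a : ∀ x, a (x + (0, 2 * π)) = a x
  periodic_w : ∀ x, w (x + (0, 2 * π)) = w x
  incompressible : ∀ x ∈ halfPlane r₀, 2 * a x + x.1 * dFst a x + dSnd w x = 0
  vorticity : ∀ x ∈ halfPlane r₀,
    x.1 * a x * dFst (scaledVorticity a w) x + w x * dSnd (scaledVorticity a w) x =
      dFst (dFst (scaledVorticity a w)) x + 3 * dFst (scaledVorticity a w) x * x.1⁻¹ +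
        dSnd (dSnd (scaledVorticity a w)) x

lemma dFst_inv_fst {x : ℝ × ℝ} (hx : x.1 ≠ 0) : dFst (fun y => y.1⁻¹) x = -(x.1⁻¹ * x.1⁻¹) := by
  have h1 : HasFDerivAt (fun y : ℝ × ℝ => y.1) (ContinuousLinearMap.fst ℝ ℝ ℝ) x :=
    hasFDerivAt_fst
  have h := (hasDerivAt_inv hx).comp_hasFDerivAt x h1
  have h : HasFDerivAt (fun y : ℝ × ℝ => y.1⁻¹) _ x := h
  rw [dFst, h.fderiv]
  simp [pow_two]

lemma dSnd_inv_fst {x : ℝ × ℝ} (hx : x.1 ≠ 0) : dSnd (fun y => y.1⁻¹) x = 0 := by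
  have h1 : HasFDerivAt (fun y : ℝ × ℝ => y.1) (ContinuousLinearMap.fst ℝ ℝ ℝ) x :=
    hasFDerivAt_fst
  have h := (hasDerivAt_inv hx).comp_hasFDerivAt x h1
  have h : HasFDerivAt (fun y : ℝ × ℝ => y.1⁻¹) _ x := h
  rw [dSnd, h.fderiv]
  simp

lemma contDiffOn_inv_fst (hr₀ : 0 < r₀) :
    ContDiffOn ℝ ∞ (fun x : ℝ × ℝ => x.1⁻¹) (halfPlane r₀) :=
  contDiff_fst.contDiffOn.inv fun _ hx => (hr₀.trans hx).ne'

lemma contDiffOn_scaledVorticity (hr₀ : 0 < r₀) {a w : ℝ × ℝ → ℝ}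
    (ha : ContDiffOn ℝ ∞ a (halfPlane r₀)) (hw : ContDiffOn ℝ ∞ w (halfPlane r₀)) :
    ContDiffOn ℝ ∞ (scaledVorticity a w) (halfPlane r₀) :=
  ha.dSnd.sub (hw.dFst.mul (contDiffOn_inv_fst hr₀))

/-- Eliminating the pressure from the meridional momentum equations. -/
lemma vorticity_equation (hr₀ : 0 < r₀) {a w P : ℝ × ℝ → ℝ}
    (ha : ContDiffOn ℝ ∞ a (halfPlane r₀)) (hw : ContDiffOn ℝ ∞ w (halfPlane r₀))
    (hP : ContDiffOn ℝ ∞ P (halfPlane r₀))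
    (hdiv : ∀ x ∈ halfPlane r₀, 2 * a x + x.1 * dFst a x + dSnd w x = 0)
    (hr : ∀ x ∈ halfPlane r₀,
      x.1 * a x * (a x + x.1 * dFst a x) + x.1 * w x * dSnd a x + dFst P x =
        x.1 * dFst (dFst a) x + 3 * dFst a x + x.1 * dSnd (dSnd a) x)
    (hz : ∀ x ∈ halfPlane r₀,
      x.1 * a x * dFst w x + w x * dSnd w x + dSnd P x =
        dFst (dFst w) x + dFst w x * x.1⁻¹ + dSnd (dSnd w) x)
    {x : ℝ × ℝ} (hx : x ∈ halfPlane r₀) :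
    x.1 * a x * dFst (scaledVorticity a w) x + w x * dSnd (scaledVorticity a w) x =
      dFst (dFst (scaledVorticity a w)) x + 3 * dFst (scaledVorticity a w) x * x.1⁻¹ +
        dSnd (dSnd (scaledVorticity a w)) x := by
  have hx0 : x.1 ≠ 0 := (hr₀.trans hx).ne'
  have e1 := dSnd_congr (f := fun x => x.1 * a x * (a x + x.1 * dFst a x) +
    x.1 * w x * dSnd a x + dFst P x) (g := fun x => x.1 * dFst (dFst a) x + 3 * dFst a x +
      x.1 * dSnd (dSnd a) x) hr hx
  have e2 := dFst_congr (f := fun x => x.1 * a x * dFst w x + w x * dSnd w x + dSnd P x)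
    (g := fun x => dFst (dFst w) x + dFst w x * x.1⁻¹ + dSnd (dSnd w) x) hz hx
  have e3 := hdiv x hx
  have e4 := dSnd_congr (f := fun x => 2 * a x + x.1 * dFst a x + dSnd w x)
    (g := fun _ => 0) hdiv hx
  have e5 := dFst_congr (f := fun x => 2 * a x + x.1 * dFst a x + dSnd w x)
    (g := fun _ => 0) hdiv hx
  have d {f : ℝ × ℝ → ℝ} (hf : ContDiffOn ℝ ∞ f (halfPlane r₀)) {y : ℝ × ℝ}
    (hy : y ∈ halfPlane r₀) : DifferentiableAt ℝ f y := hf.differentiableAt_halfPlane hy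
  have hi := contDiffOn_inv_fst hr₀
  have dr : ∀ y ∈ halfPlane r₀, dFst (scaledVorticity a w) y =
      dFst (dSnd a) y - (dFst (dFst w) y * y.1⁻¹ + dFst w y * -(y.1⁻¹ * y.1⁻¹)) := by
    intro y hy
    change dFst (fun x => dSnd a x - dFst w x * x.1⁻¹) y = _
    rw [dFst_sub (d ha.dSnd hy) ((d hw.dFst hy).fun_mul (d hi hy)), dFst_mul (d hw.dFst hy) (d hi hy),
      dFst_inv_fst (hr₀.trans hy).ne']
  have dz : ∀ y ∈ halfPlane r₀, dSnd (scaledVorticity a w) y =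
      dSnd (dSnd a) y - dSnd (dFst w) y * y.1⁻¹ := by
    intro y hy
    change dSnd (fun x => dSnd a x - dFst w x * x.1⁻¹) y = _
    rw [dSnd_sub (d ha.dSnd hy) ((d hw.dFst hy).fun_mul (d hi hy)), dSnd_mul (d hw.dFst hy) (d hi hy),
      dSnd_inv_fst (hr₀.trans hy).ne']
    ring
  have drr := dFst_congr (g := fun y => dFst (dSnd a) y -
    (dFst (dFst w) y * y.1⁻¹ + dFst w y * -(y.1⁻¹ * y.1⁻¹))) dr hx
  have dzz := dSnd_congr (g := fun y => dSnd (dSnd a) y - dSnd (dFst w) y * y.1⁻¹) dz hx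
  have hneg : ∀ y, dFst w y * -(y.1⁻¹ * y.1⁻¹) = (-1) * (dFst w y * (y.1⁻¹ * y.1⁻¹)) := by
    intro y; ring
  simp only [hneg] at drr
  have h1 := d ha hx
  have h2 := d hw hx
  have h3 := d ha.dFst hx
  have h4 := d ha.dSnd hx
  have h5 := d hw.dFst hx
  have h6 := d hw.dSnd hx
  have h7 := d ha.dFst.dFst hx
  have h8 := d ha.dSnd.dSnd hx
  have h9 := d hw.dFst.dFst hx
  have h10 := d hw.dSnd.dSnd hx
  have h11 := d hP.dFst hx
  have h12 := d hP.dSnd hx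
  have h13 := d hi hx
  have h14 := d ha.dSnd.dFst hx
  have h15 := d hw.dFst.dSnd hx
  simp (disch := fun_prop) only [dSnd_add, dSnd_mul, dSnd_sub, dSnd_fst, dSnd_const,
    dSnd_inv_fst hx0] at e1 e4 dzz
  simp (disch := fun_prop) only [dFst_add, dFst_mul, dFst_sub, dFst_fst, dFst_const,
    dFst_inv_fst hx0] at e2 e5 drr
  have c1 := dFst_dSnd_comm ha hx
  have c2 := dFst_dSnd_comm hw hx
  have c3 := dFst_dSnd_comm hP hx
  have c4 : dFst (dFst (dSnd a)) x = dSnd (dFst (dFst a)) x := by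
    rw [dFst_congr (fun y hy => dFst_dSnd_comm ha hy) hx, dFst_dSnd_comm ha.dFst hx]
  have c5 : dFst (dSnd (dSnd w)) x = dSnd (dSnd (dFst w)) x := by
    rw [dFst_dSnd_comm hw.dSnd hx, dSnd_congr (fun y hy => dFst_dSnd_comm hw hy) hx]
  rw [dr x hx, dz x hx, drr, dzz]
  rw [c4, c1]
  rw [c3, c2, c5] at e2
  rw [c2] at e5
  have hm : x.1 * x.1⁻¹ = 1 := mul_inv_cancel₀ hx0
  generalize x.1⁻¹ = s at *
  generalize x.1 = r at *
  generalize dSnd (dFst (dFst a)) x = A1 at *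
  generalize dSnd (dSnd (dSnd a)) x = A2 at *
  generalize dSnd (dFst P) x = P1 at *
  generalize dSnd (dFst a) x = arz at *
  generalize dFst (dFst (dFst w)) x = w3 at *
  generalize dSnd (dSnd (dFst w)) x = w4 at *
  generalize dFst (dFst w) x = wrr at *
  generalize dSnd (dFst w) x = wrz at *
  generalize dSnd (dSnd w) x = wzz at *
  generalize dSnd (dSnd a) x = azz at *
  generalize dFst (dFst a) x = arr at *
  generalize dFst a x = ar at *
  generalize dSnd a x = az at *
  generalize dFst w x = wr at *
  generalize dSnd w x = wz at *
  generalize a x = a0 at *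
  generalize w x = w0 at *
  have hs : s = r⁻¹ := eq_inv_of_mul_eq_one_right hm
  subst hs
  field_simp at e2 ⊢
  linear_combination r ^ 2 * e1 - e2 + (r ^ 2 * wr - r ^ 3 * az) * e3

end MeridionalFlow

section Reduction

variable {r₀ : ℝ} {x : E3} {F : ℝ × ℝ → ℝ}

lemma pd_coord_mul_comp_cyl (i k : Fin 3) (hx : 0 < rr x) (hF : DifferentiableAt ℝ F (cyl x)) :
    pd i (fun y => y k * F (cyl y)) x =
      (if k = i then 1 else 0) * F (cyl x) + x k * pd i (fun y => F (cyl y)) x := by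
  rw [pd_mul i (differentiableAt_coord k x) (differentiableAt_comp_cyl hx hF), pd_coord]

lemma contDiffOn_comp_meridian (hr₀ : 0 < r₀) {g : E3 → ℝ}
    (hg : ContDiffOn ℝ ∞ g {x : E3 | r₀ < rr x}) :
    ContDiffOn ℝ ∞ (fun y => g (meridian y)) (halfPlane r₀) :=
  hg.comp contDiff_meridian.contDiffOn fun y (hy : r₀ < y.1) => by
    change r₀ < rr (meridian y)
    rwa [rr_meridian (hr₀.trans hy).le]

/-- The velocity field with cylindrical components `v^r = r a`, `v^θ = 0`, `v^z = w`. -/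
structure IsCylindrical (r₀ : ℝ) (v : E3 → E3) (a w : ℝ × ℝ → ℝ) : Prop where
  smooth_a : ContDiffOn ℝ ∞ a (halfPlane r₀)
  smooth_w : ContDiffOn ℝ ∞ w (halfPlane r₀)
  zero : ∀ x, r₀ < rr x → v x 0 = x 0 * a (cyl x)
  one : ∀ x, r₀ < rr x → v x 1 = x 1 * a (cyl x)
  two : ∀ x, r₀ < rr x → v x 2 = w (cyl x)

namespace IsCylindrical

variable {v : E3 → E3} {a w : ℝ × ℝ → ℝ}

lemma pd_component_zero (h : IsCylindrical r₀ v a w) (hr₀ : 0 < r₀) (i : Fin 3)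
    (hx : r₀ < rr x) :
    pd i (fun y => v y 0) x =
      (if 0 = i then 1 else 0) * a (cyl x) + x 0 * pd i (fun y => a (cyl y)) x := by
  rw [pd_congr (fun y hy => h.zero y hy) hx, pd_coord_mul_comp_cyl i 0 (hr₀.trans hx)
    (h.smooth_a.differentiableAt_halfPlane hx)]

lemma pd_component_one (h : IsCylindrical r₀ v a w) (hr₀ : 0 < r₀) (i : Fin 3)
    (hx : r₀ < rr x) :
    pd i (fun y => v y 1) x =
      (if 1 = i then 1 else 0) * a (cyl x) + x 1 * pd i (fun y => a (cyl y)) x := by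
  rw [pd_congr (fun y hy => h.one y hy) hx, pd_coord_mul_comp_cyl i 1 (hr₀.trans hx)
    (h.smooth_a.differentiableAt_halfPlane hx)]

lemma pd_component_two (h : IsCylindrical r₀ v a w) (i : Fin 3) (hx : r₀ < rr x) :
    pd i (fun y => v y 2) x = pd i (fun y => w (cyl y)) x :=
  pd_congr (fun y hy => h.two y hy) hx i

/-- The gradient controls `∂_z v^r`, `∂_r v^z` and `v^r / r`. -/
lemma le_gradSq3 (h : IsCylindrical r₀ v a w) (hr₀ : 0 < r₀) (hx : r₀ < rr x) :
    (rr x * dSnd a (cyl x)) ^ 2 + dFst w (cyl x) ^ 2 + a (cyl x) ^ 2 ≤ gradSq3 v x := by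
  have hρ : 0 < rr x := hr₀.trans hx
  have da := h.smooth_a.differentiableAt_halfPlane (x := cyl x) hx
  have dw := h.smooth_w.differentiableAt_halfPlane (x := cyl x) hx
  simp only [gradSq3, Fin.sum_univ_three, h.pd_component_zero hr₀ _ hx,
    h.pd_component_one hr₀ _ hx, h.pd_component_two _ hx,
    pd_zero_comp_cyl hρ da, pd_one_comp_cyl hρ da, pd_two_comp_cyl hρ da,
    pd_zero_comp_cyl hρ dw, pd_one_comp_cyl hρ dw, pd_two_comp_cyl hρ dw]
  simp only [Fin.isValue, if_true, zero_ne_one, one_ne_zero, if_false, Fin.reduceEq]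
  have hs : x 0 ^ 2 + x 1 ^ 2 = rr x ^ 2 := (rr_sq x).symm
  have hm : rr x * (rr x)⁻¹ = 1 := mul_inv_cancel₀ hρ.ne'
  generalize (rr x)⁻¹ = s at *
  generalize rr x = r at *
  generalize dSnd a (cyl x) = az
  generalize dFst w (cyl x) = wr
  generalize dSnd w (cyl x) = wz
  generalize dFst a (cyl x) = ar
  generalize a (cyl x) = a0
  have e1 : (x 0 * (wr * s)) ^ 2 + (x 1 * (wr * s)) ^ 2 = wr ^ 2 := by
    linear_combination wr ^ 2 * s ^ 2 * hs + wr ^ 2 * (r * s + 1) * hm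
  have e2 : (x 0 * az) ^ 2 + (x 1 * az) ^ 2 = (r * az) ^ 2 := by
    linear_combination az ^ 2 * hs
  have e3 : a0 ^ 2 ≤ (1 * a0 + x 0 * (x 0 * (ar * s))) ^ 2 + (x 0 * (x 1 * (ar * s))) ^ 2 +
      (x 1 * (x 0 * (ar * s))) ^ 2 + (1 * a0 + x 1 * (x 1 * (ar * s))) ^ 2 := by
    nlinarith [sq_nonneg (a0 + (x 0 ^ 2 + x 1 ^ 2) * (ar * s))]
  nlinarith [sq_nonneg wz]

variable {y : ℝ × ℝ}

lemma divergence (h : IsCylindrical r₀ v a w) (hr₀ : 0 < r₀)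
    (hdiv : ∀ x : E3, r₀ < rr x → (∑ i, pd i (fun y => v y i) x) = 0) (hy : y ∈ halfPlane r₀) :
    2 * a y + y.1 * dFst a y + dSnd w y = 0 := by
  have hy0 : 0 < y.1 := hr₀.trans hy
  have hc : cyl (meridian y) = y := cyl_meridian hy0.le
  have hr : rr (meridian y) = y.1 := rr_meridian hy0.le
  have hx : r₀ < rr (meridian y) := by rw [hr]; exact hy
  have hρ : 0 < rr (meridian y) := hr₀.trans hx
  have da := h.smooth_a.differentiableAt_halfPlane (x := cyl (meridian y)) hx
  have dw := h.smooth_w.differentiableAt_halfPlane (x := cyl (meridian y)) hx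
  have e := hdiv _ hx
  simp only [Fin.sum_univ_three, h.pd_component_zero hr₀ _ hx,
    h.pd_component_one hr₀ _ hx, h.pd_component_two _ hx,
    pd_zero_comp_cyl hρ da, pd_one_comp_cyl hρ da, pd_two_comp_cyl hρ dw, hc, hr,
    meridian_zero, meridian_one, if_true] at e
  have hm : y.1 * y.1⁻¹ = 1 := mul_inv_cancel₀ hy0.ne'
  linear_combination e - y.1 * dFst a y * hm

lemma smooth_quot (h : IsCylindrical r₀ v a w) (hr₀ : 0 < r₀) :
    ContDiffOn ℝ ∞ (fun y => dFst a y * y.1⁻¹) (halfPlane r₀) :=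
  h.smooth_a.dFst.mul (contDiffOn_inv_fst hr₀)

lemma smooth_quot_axial (h : IsCylindrical r₀ v a w) (hr₀ : 0 < r₀) :
    ContDiffOn ℝ ∞ (fun y => dFst w y * y.1⁻¹) (halfPlane r₀) :=
  h.smooth_w.dFst.mul (contDiffOn_inv_fst hr₀)

lemma pd_pd_radial (h : IsCylindrical r₀ v a w) (hr₀ : 0 < r₀) (hy : y ∈ halfPlane r₀) :
    ∑ i, pd i (pd i (fun x => v x 0)) (meridian y) =
      y.1 * dFst (dFst a) y + 3 * dFst a y + y.1 * dSnd (dSnd a) y := by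
  have hy0 : 0 < y.1 := hr₀.trans hy
  have hc : cyl (meridian y) = y := cyl_meridian hy0.le
  have hr : rr (meridian y) = y.1 := rr_meridian hy0.le
  have hx : r₀ < rr (meridian y) := by rw [hr]; exact hy
  have hρ : 0 < rr (meridian y) := hr₀.trans hx
  have d {f : ℝ × ℝ → ℝ} (hf : ContDiffOn ℝ ∞ f (halfPlane r₀)) {z : E3} (hz : r₀ < rr z) :
    DifferentiableAt ℝ f (cyl z) := hf.differentiableAt_halfPlane hz
  let G : ℝ × ℝ → ℝ := fun y => dFst a y * y.1⁻¹
  have hG : ContDiffOn ℝ ∞ G (halfPlane r₀) := h.smooth_quot hr₀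
  have dG := differentiableAt_comp_cyl hρ (d hG hx)
  have dGk (k : Fin 3) := (differentiableAt_coord k (meridian y)).fun_mul dG
  have e0 : EqOn (pd 0 (fun x => v x 0)) (fun x => a (cyl x) + x 0 * (x 0 * G (cyl x)))
      {x | r₀ < rr x} := fun z hz => by
    rw [h.pd_component_zero hr₀ _ hz, pd_zero_comp_cyl (hr₀.trans hz) (d h.smooth_a hz)]
    simp [G, cyl]
  have e1 : EqOn (pd 1 (fun x => v x 0)) (fun x => x 0 * (x 1 * G (cyl x)))
      {x | r₀ < rr x} := fun z hz => by
    rw [h.pd_component_zero hr₀ _ hz, pd_one_comp_cyl (hr₀.trans hz) (d h.smooth_a hz)]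
    simp [G, cyl]
  have e2 : EqOn (pd 2 (fun x => v x 0)) (fun x => x 0 * dSnd a (cyl x))
      {x | r₀ < rr x} := fun z hz => by
    rw [h.pd_component_zero hr₀ _ hz, pd_two_comp_cyl (hr₀.trans hz) (d h.smooth_a hz)]
    simp
  have hGr : dFst G y = dFst (dFst a) y * y.1⁻¹ + dFst a y * -(y.1⁻¹ * y.1⁻¹) := by
    rw [dFst_mul (h.smooth_a.dFst.differentiableAt_halfPlane hy)
      ((contDiffOn_inv_fst hr₀).differentiableAt_halfPlane hy), dFst_inv_fst hy0.ne']
  rw [Fin.sum_univ_three, pd_congr e0 hx, pd_congr e1 hx, pd_congr e2 hx,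
    pd_add 0 (differentiableAt_comp_cyl hρ (d h.smooth_a hx))
      ((differentiableAt_coord 0 _).fun_mul (dGk 0)),
    pd_mul 0 (differentiableAt_coord 0 _) (dGk 0), pd_mul 1 (differentiableAt_coord 0 _) (dGk 1),
    pd_coord_mul_comp_cyl 0 0 hρ (d hG hx), pd_coord_mul_comp_cyl 1 1 hρ (d hG hx),
    pd_coord_mul_comp_cyl 2 0 hρ (d h.smooth_a.dSnd hx), pd_zero_comp_cyl hρ (d h.smooth_a hx),
    pd_zero_comp_cyl hρ (d hG hx), pd_two_comp_cyl hρ (d h.smooth_a.dSnd hx), pd_coord, pd_coord,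
    hc, hr, hGr]
  simp [G]
  field_simp
  ring

lemma pd_pd_axial (h : IsCylindrical r₀ v a w) (hr₀ : 0 < r₀) (hy : y ∈ halfPlane r₀) :
    ∑ i, pd i (pd i (fun x => v x 2)) (meridian y) =
      dFst (dFst w) y + dFst w y * y.1⁻¹ + dSnd (dSnd w) y := by
  have hy0 : 0 < y.1 := hr₀.trans hy
  have hc : cyl (meridian y) = y := cyl_meridian hy0.le
  have hr : rr (meridian y) = y.1 := rr_meridian hy0.le
  have hx : r₀ < rr (meridian y) := by rw [hr]; exact hy
  have hρ : 0 < rr (meridian y) := hr₀.trans hx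
  have d {f : ℝ × ℝ → ℝ} (hf : ContDiffOn ℝ ∞ f (halfPlane r₀)) {z : E3} (hz : r₀ < rr z) :
    DifferentiableAt ℝ f (cyl z) := hf.differentiableAt_halfPlane hz
  let G : ℝ × ℝ → ℝ := fun y => dFst w y * y.1⁻¹
  have hG : ContDiffOn ℝ ∞ G (halfPlane r₀) := h.smooth_quot_axial hr₀
  have e0 : EqOn (pd 0 (fun x => v x 2)) (fun x => x 0 * G (cyl x))
      {x | r₀ < rr x} := fun z hz => by
    rw [h.pd_component_two _ hz, pd_zero_comp_cyl (hr₀.trans hz) (d h.smooth_w hz)]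
    simp [G, cyl]
  have e1 : EqOn (pd 1 (fun x => v x 2)) (fun x => x 1 * G (cyl x))
      {x | r₀ < rr x} := fun z hz => by
    rw [h.pd_component_two _ hz, pd_one_comp_cyl (hr₀.trans hz) (d h.smooth_w hz)]
    simp [G, cyl]
  have e2 : EqOn (pd 2 (fun x => v x 2)) (fun x => dSnd w (cyl x))
      {x | r₀ < rr x} := fun z hz => by
    rw [h.pd_component_two _ hz, pd_two_comp_cyl (hr₀.trans hz) (d h.smooth_w hz)]
  have hGr : dFst G y = dFst (dFst w) y * y.1⁻¹ + dFst w y * -(y.1⁻¹ * y.1⁻¹) := by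
    rw [dFst_mul (h.smooth_w.dFst.differentiableAt_halfPlane hy)
      ((contDiffOn_inv_fst hr₀).differentiableAt_halfPlane hy), dFst_inv_fst hy0.ne']
  rw [Fin.sum_univ_three, pd_congr e0 hx, pd_congr e1 hx, pd_congr e2 hx,
    pd_coord_mul_comp_cyl 0 0 hρ (d hG hx), pd_coord_mul_comp_cyl 1 1 hρ (d hG hx),
    pd_zero_comp_cyl hρ (d hG hx), pd_two_comp_cyl hρ (d h.smooth_w.dSnd hx), hc, hr, hGr]
  simp [G]
  field_simp
  ring

end IsCylindrical

variable {v : E3 → E3} {p : E3 → ℝ} {vr vz : ℝ → ℝ → ℝ}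

/-- `v^r / r` as a function on the meridional half plane. -/
def radialQuotient (v : E3 → E3) (y : ℝ × ℝ) : ℝ := v (meridian y) 0 * y.1⁻¹

/-- `v^z` as a function on the meridional half plane. -/
def axialVelocity (v : E3 → E3) (y : ℝ × ℝ) : ℝ := v (meridian y) 2

namespace AxisymNoSwirlNSSlab

lemma radial_eq (h : AxisymNoSwirlNSSlab r₀ v p vr vz) (hr₀ : 0 < r₀) {y : ℝ × ℝ}
    (hy : y ∈ halfPlane r₀) : vr y.1 y.2 = y.1 * radialQuotient v y := by
  have hy0 : 0 < y.1 := hr₀.trans hy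
  have hr : rr (meridian y) = y.1 := rr_meridian hy0.le
  have e := (h.axisym_no_swirl (meridian y) (by rw [hr]; exact hy)).1
  rw [hr, meridian_zero, meridian_two, div_self hy0.ne', mul_one] at e
  rw [radialQuotient, e]
  field_simp

lemma axial_eq (h : AxisymNoSwirlNSSlab r₀ v p vr vz) (hr₀ : 0 < r₀) {y : ℝ × ℝ}
    (hy : y ∈ halfPlane r₀) : vz y.1 y.2 = axialVelocity v y := by
  have hy0 : 0 < y.1 := hr₀.trans hy
  have hr : rr (meridian y) = y.1 := rr_meridian hy0.le
  have e := (h.axisym_no_swirl (meridian y) (by rw [hr]; exact hy)).2.2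
  rw [hr, meridian_two] at e
  rw [axialVelocity, e]

lemma isCylindrical (h : AxisymNoSwirlNSSlab r₀ v p vr vz) (hr₀ : 0 < r₀) :
    IsCylindrical r₀ v (radialQuotient v) (axialVelocity v) where
  smooth_a := (contDiffOn_comp_meridian hr₀
    ((contDiffOn_euclidean.1 h.smooth_v) 0)).mul (contDiffOn_inv_fst hr₀)
  smooth_w := contDiffOn_comp_meridian hr₀ ((contDiffOn_euclidean.1 h.smooth_v) 2)
  zero x hx := by
    have e := h.radial_eq hr₀ (y := cyl x) hx
    have : rr x ≠ 0 := (hr₀.trans hx).ne'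
    rw [(h.axisym_no_swirl x hx).1]
    simp only [cyl] at e ⊢
    rw [e]; field_simp
  one x hx := by
    have e := h.radial_eq hr₀ (y := cyl x) hx
    have : rr x ≠ 0 := (hr₀.trans hx).ne'
    rw [(h.axisym_no_swirl x hx).2.1]
    simp only [cyl] at e ⊢
    rw [e]; field_simp
  two x hx := by
    rw [(h.axisym_no_swirl x hx).2.2]
    exact h.axial_eq hr₀ (y := cyl x) hx

lemma Om_eq (h : AxisymNoSwirlNSSlab r₀ v p vr vz) (hr₀ : 0 < r₀) {y : ℝ × ℝ}
    (hy : y ∈ halfPlane r₀) :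
    Om vr vz y.1 y.2 = scaledVorticity (radialQuotient v) (axialVelocity v) y := by
  have hy0 : 0 < y.1 := hr₀.trans hy
  have hc := h.isCylindrical hr₀
  have e1 : dzz vr y.1 y.2 = y.1 * dSnd (radialQuotient v) y := by
    have : (fun t => vr y.1 t) = fun t => y.1 * radialQuotient v (y.1, t) :=
      funext fun t => h.radial_eq hr₀ (y := (y.1, t)) hy
    rw [dzz, this]
    exact ((hasDerivAt_dSnd (hc.smooth_a.differentiableAt_halfPlane hy)).const_mul _).deriv
  have e2 : dr vz y.1 y.2 = dFst (axialVelocity v) y := by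
    have : (fun s => vz s y.2) =ᶠ[𝓝 y.1] fun s => axialVelocity v (s, y.2) := by
      filter_upwards [lt_mem_nhds (show r₀ < y.1 from hy)] with s hs
      exact h.axial_eq hr₀ (y := (s, y.2)) hs
    rw [dr, this.deriv_eq]
    exact (hasDerivAt_dFst (hc.smooth_w.differentiableAt_halfPlane hy)).deriv
  rw [Om, omTheta, e1, e2, scaledVorticity]
  field_simp

lemma meridian_add (y : ℝ × ℝ) : meridian (y + (0, 2 * π)) =
    meridian y + (2 * π) • EuclideanSpace.single (2 : Fin 3) (1 : ℝ) := by
  ext i; fin_cases i <;> simp [meridian]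

lemma meridionalFlow (h : AxisymNoSwirlNSSlab r₀ v p vr vz) (hr₀ : 0 < r₀) :
    MeridionalFlow r₀ (radialQuotient v) (axialVelocity v) := by
  have hc := h.isCylindrical hr₀
  have hdiv : ∀ y ∈ halfPlane r₀, _ := fun y hy => hc.divergence hr₀ h.incompressible hy
  refine ⟨hc.smooth_a, hc.smooth_w, fun y => ?_, fun y => ?_, hdiv, fun y hy =>
    vorticity_equation hr₀ (P := fun y => p (meridian y)) hc.smooth_a hc.smooth_w
      (contDiffOn_comp_meridian hr₀ h.smooth_p) hdiv (fun y hy => ?_) (fun y hy => ?_) hy⟩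
  · rw [radialQuotient, meridian_add, h.periodic]; simp [radialQuotient]
  · rw [axialVelocity, meridian_add, h.periodic]; rfl
  all_goals
    have hy0 : 0 < y.1 := hr₀.trans hy
    have hcm : cyl (meridian y) = y := cyl_meridian hy0.le
    have hr : rr (meridian y) = y.1 := rr_meridian hy0.le
    have hx : r₀ < rr (meridian y) := by rw [hr]; exact hy
    have hρ : 0 < rr (meridian y) := hr₀.trans hx
    have da := hc.smooth_a.differentiableAt_halfPlane (x := cyl (meridian y)) hx
    have dw := hc.smooth_w.differentiableAt_halfPlane (x := cyl (meridian y)) hx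
    have dp : DifferentiableAt ℝ p (meridian y) :=
      (h.smooth_p.contDiffAt ((isOpen_lt_rr r₀).mem_nhds hx)).differentiableAt (by simp)
  · have e := h.momentum _ hx 0
    rw [hc.pd_pd_radial hr₀ hy] at e
    simp only [Fin.sum_univ_three, hc.pd_component_zero hr₀ _ hx, hc.zero _ hx, hc.one _ hx,
      hc.two _ hx, pd_zero_comp_cyl hρ da, pd_two_comp_cyl hρ da, hcm, hr, meridian_zero,
      meridian_one, if_true, ← dFst_comp_meridian dp] at e
    simp only [Fin.isValue, Fin.reduceEq, if_false, zero_mul, zero_add, add_zero] at e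
    rw [← e]
    field_simp
  · have e := h.momentum _ hx 2
    rw [hc.pd_pd_axial hr₀ hy] at e
    simp only [Fin.sum_univ_three, hc.pd_component_two _ hx, hc.zero _ hx, hc.one _ hx,
      hc.two _ hx, pd_zero_comp_cyl hρ dw, pd_two_comp_cyl hρ dw, hcm, hr, meridian_zero,
      meridian_one, ← dSnd_comp_meridian dp] at e
    rw [← e]
    field_simp
    ring

end AxisymNoSwirlNSSlab

end Reduction

section CylindricalIntegration

/-- Integration in cylindrical coordinates of an axisymmetric function. -/
lemma lintegral_comp_cyl {G : ℝ × ℝ → ENNReal} (hG : Measurable G) :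
    ∫⁻ x : E3, G (cyl x) =
      ENNReal.ofReal (2 * π) * ∫⁻ y in {y : ℝ × ℝ | 0 < y.1}, ENNReal.ofReal y.1 * G y := by
  have h1 : MeasurePreserving (fun x : E3 => (x 2, (x 0, x 1)))
      (volume : Measure E3) (volume : Measure (ℝ × (ℝ × ℝ))) := by
    have := ((MeasurePreserving.id (volume : Measure ℝ)).prod
      (volume_preserving_finTwoArrow ℝ)).comp
        ((volume_preserving_piFinSuccAbove (fun _ : Fin 3 => ℝ) 2).comp
          (EuclideanSpace.volume_preserving_symm_measurableEquiv_toLp (Fin 3)))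
    exact this
  let H : ℝ × (ℝ × ℝ) → ENNReal := fun s => G (√(s.2.1 ^ 2 + s.2.2 ^ 2), s.1)
  have hH : Measurable H := hG.comp (by fun_prop)
  have h2 : ∫⁻ x : E3, G (cyl x) = ∫⁻ s, H s := h1.lintegral_comp hH
  have h3 : ∀ z, ∫⁻ t : ℝ × ℝ, H (z, t) =
      ENNReal.ofReal (2 * π) * ∫⁻ r in Ioi (0 : ℝ), ENNReal.ofReal r * G (r, z) := by
    intro z
    have hmeas : Measurable fun r => ENNReal.ofReal r * G (r, z) :=
      ENNReal.measurable_ofReal.mul (hG.comp (by fun_prop))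
    rw [← lintegral_comp_polarCoord_symm]
    have : ∫⁻ p in polarCoord.target, ENNReal.ofReal p.1 • H (z, polarCoord.symm p) =
        ∫⁻ p in Ioi (0 : ℝ) ×ˢ Ioo (-π) π, ENNReal.ofReal p.1 * G (p.1, z) := by
      rw [polarCoord_target]
      refine setLIntegral_congr_fun (by measurability) fun p hp => ?_
      have hs : (p.1 * cos p.2) ^ 2 + (p.1 * sin p.2) ^ 2 = p.1 ^ 2 := by
        linear_combination p.1 ^ 2 * sin_sq_add_cos_sq p.2
      simp only [H, polarCoord_symm_apply, hs, Real.sqrt_sq (le_of_lt hp.1), smul_eq_mul]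
    have hm' : Measurable fun p : ℝ × ℝ => ENNReal.ofReal p.1 * G (p.1, z) :=
      hmeas.comp measurable_fst
    rw [this, Measure.volume_eq_prod, ← Measure.prod_restrict, lintegral_prod _ hm'.aemeasurable]
    simp only [lintegral_const, Measure.restrict_apply_univ, Real.volume_Ioo]
    rw [lintegral_mul_const _ hmeas, mul_comm]
    congr 2
    ring
  have hset : {y : ℝ × ℝ | 0 < y.1} = Ioi (0 : ℝ) ×ˢ univ := by ext; simp
  rw [h2, Measure.volume_eq_prod, lintegral_prod _ hH.aemeasurable]
  simp only [h3]
  have hm2 : Measurable fun y : ℝ × ℝ => ENNReal.ofReal y.1 * G y :=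
    (ENNReal.measurable_ofReal.comp measurable_fst).mul hG
  rw [lintegral_const_mul _ (by
    exact Measurable.lintegral_prod_left' (f := fun y : ℝ × ℝ => ENNReal.ofReal y.1 * G y) hm2),
    hset, Measure.volume_eq_prod, ← Measure.prod_restrict, lintegral_prod_symm _ hm2.aemeasurable,
    Measure.restrict_univ]

/-- The part of `|∇v|²` that involves `∂_z v^r`, `∂_r v^z` and `v^r / r`. -/
def meridionalGradSq (a w : ℝ × ℝ → ℝ) (x : ℝ × ℝ) : ℝ :=
  (x.1 * dSnd a x) ^ 2 + dFst w x ^ 2 + a x ^ 2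

lemma meridionalGradSq_nonneg (a w : ℝ × ℝ → ℝ) (x : ℝ × ℝ) : 0 ≤ meridionalGradSq a w x := by
  unfold meridionalGradSq; positivity

lemma continuousOn_meridionalGradSq_rpow {r₀ q : ℝ} (hq : 2 < q) {a w : ℝ × ℝ → ℝ}
    (ha : ContDiffOn ℝ ∞ a (halfPlane r₀)) (hw : ContDiffOn ℝ ∞ w (halfPlane r₀)) :
    ContinuousOn (fun x => meridionalGradSq a w x ^ (q / 2)) (halfPlane r₀) := by
  have h1 := ha.continuousOn
  have h2 := ha.dSnd.continuousOn
  have h3 := hw.dFst.continuousOn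
  refine ContinuousOn.rpow_const ?_ fun _ _ => Or.inr (by linarith)
  unfold meridionalGradSq
  fun_prop

lemma Icc_subset_halfPlane {r₀ A : ℝ} (hA : r₀ < A) (b c d : ℝ) :
    Icc (A, c) (b, d) ⊆ halfPlane r₀ := fun _ hx => lt_of_lt_of_le hA hx.1.1

lemma IsCylindrical.exists_integral_le {r₀ q : ℝ} (hr₀ : 0 < r₀) (hq : 2 < q) {v : E3 → E3}
    {a w : ℝ × ℝ → ℝ} (h : IsCylindrical r₀ v a w)
    (hdiri : ∫⁻ x : E3 in {x : E3 | r₀ < rr x ∧ x 2 ∈ Icc (-π) π},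
      ENNReal.ofReal ((gradSq3 v x) ^ (q / 2)) < ⊤) :
    ∃ M : ℝ, ∀ A B : ℝ, r₀ < A →
      ∫ x in Icc (A, -π) (B, π), x.1 * meridionalGradSq a w x ^ (q / 2) ≤ M := by
  set N := meridionalGradSq a w
  let S : Set (ℝ × ℝ) := {y | r₀ < y.1 ∧ y.2 ∈ Icc (-π) π}
  have hS : MeasurableSet S :=
    (measurableSet_lt measurable_const measurable_fst).inter (measurable_snd measurableSet_Icc)
  have hcont := continuousOn_meridionalGradSq_rpow hq h.smooth_a h.smooth_w
  have hSsub : S ⊆ halfPlane r₀ := fun y hy => hy.1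
  let G : ℝ × ℝ → ENNReal := S.indicator fun y => ENNReal.ofReal (N y ^ (q / 2))
  have hG : Measurable G := by
    have : Measurable (S.piecewise (fun y => N y ^ (q / 2)) fun _ => 0) :=
      (hcont.mono hSsub).measurable_piecewise continuousOn_const hS
    have e : G = fun y => ENNReal.ofReal (S.piecewise (fun y => N y ^ (q / 2)) (fun _ => 0) y) := by
      ext y
      by_cases hy : y ∈ S <;> simp [G, hy]
    rw [e]
    exact ENNReal.measurable_ofReal.comp this
  have hfin : ∫⁻ y in {y : ℝ × ℝ | 0 < y.1}, ENNReal.ofReal y.1 * G y < ⊤ := by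
    have h1 : ∫⁻ x : E3, G (cyl x) < ⊤ := by
      refine lt_of_le_of_lt ?_ hdiri
      have hmS : MeasurableSet {x : E3 | r₀ < rr x ∧ x 2 ∈ Icc (-π) π} :=
        (measurableSet_lt measurable_const continuous_rr.measurable).inter
          ((by fun_prop : Measurable fun x : E3 => x 2) measurableSet_Icc)
      rw [← lintegral_indicator hmS]
      refine lintegral_mono fun x => ?_
      by_cases hx : r₀ < rr x ∧ x 2 ∈ Icc (-π) π
      · rw [indicator_of_mem (show x ∈ {x : E3 | r₀ < rr x ∧ x 2 ∈ Icc (-π) π} from hx)]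
        simp only [G]
        rw [indicator_of_mem (show cyl x ∈ S from hx)]
        exact ENNReal.ofReal_le_ofReal (Real.rpow_le_rpow (meridionalGradSq_nonneg _ _ _)
          (h.le_gradSq3 hr₀ hx.1) (by linarith))
      · simp only [G]
        rw [indicator_of_notMem (show cyl x ∉ S from hx)]
        exact zero_le
    rw [lintegral_comp_cyl hG] at h1
    by_contra hcon
    rw [not_lt, top_le_iff] at hcon
    rw [hcon, ENNReal.mul_top (by simp [pi_pos])] at h1
    exact lt_irrefl _ h1
  refine ⟨(∫⁻ y in {y : ℝ × ℝ | 0 < y.1}, ENNReal.ofReal y.1 * G y).toReal, fun A B hA => ?_⟩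
  have hsub : Icc (A, -π) (B, π) ⊆ S := fun x hx => ⟨lt_of_lt_of_le hA hx.1.1, hx.1.2, hx.2.2⟩
  have hsub' : Icc (A, -π) (B, π) ⊆ {y : ℝ × ℝ | 0 < y.1} :=
    hsub.trans fun y hy => hr₀.trans hy.1
  have hc : ContinuousOn (fun x : ℝ × ℝ => x.1 * N x ^ (q / 2)) (Icc (A, -π) (B, π)) :=
    continuousOn_fst.mul (hcont.mono (hsub.trans hSsub))
  rw [integral_eq_lintegral_of_nonneg_ae]
  · refine ENNReal.toReal_mono hfin.ne ?_
    refine le_trans (setLIntegral_mono_ae' measurableSet_Icc (ae_of_all _ fun x hx => ?_))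
      (lintegral_mono_set hsub')
    simp only [G]
    rw [indicator_of_mem (hsub hx), ENNReal.ofReal_mul (le_of_lt (hsub' hx))]
  · refine (ae_restrict_iff' measurableSet_Icc).2 (ae_of_all _ fun x hx => ?_)
    exact mul_nonneg (le_of_lt (hsub' hx)) (Real.rpow_nonneg (meridionalGradSq_nonneg _ _ _) _)
  · exact hc.aestronglyMeasurable measurableSet_Icc

end CylindricalIntegration

section PowerFunctions

variable {q : ℝ}

lemma hasDerivAt_rpow_abs_mul_self (hq : 2 < q) (s : ℝ) :
    HasDerivAt (fun s : ℝ => q * |s| ^ (q - 2) * s) (q * (q - 1) * |s| ^ (q - 2)) s := by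
  rcases eq_or_ne s 0 with rfl | hs
  · rw [abs_zero, Real.zero_rpow (by linarith), mul_zero, hasDerivAt_iff_tendsto_slope]
    have hc : Continuous fun s : ℝ => q * |s| ^ (q - 2) :=
      continuous_const.mul (continuous_abs.rpow_const fun _ => Or.inr (by linarith))
    have h0 : Tendsto (fun s : ℝ => q * |s| ^ (q - 2)) (𝓝[≠] 0) (𝓝 0) := by
      have := hc.tendsto 0
      simp only [abs_zero, Real.zero_rpow (show q - 2 ≠ 0 by linarith), mul_zero] at this
      exact this.mono_left nhdsWithin_le_nhds
    refine h0.congr' (eventually_nhdsWithin_of_forall fun s hs => ?_)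
    have hs : s ≠ 0 := hs
    simp [slope_def_field, hs]
  · have habs : HasDerivAt (fun s : ℝ => |s|) (SignType.sign s : ℝ) s := hasDerivAt_abs hs
    have hpos : 0 < |s| := abs_pos.2 hs
    have h := (((habs.rpow_const (p := q - 2) (Or.inl hpos.ne')).const_mul q).mul
      (hasDerivAt_id s))
    refine h.congr_deriv ?_
    have e : (SignType.sign s : ℝ) * s = |s| := sign_mul_self s
    have e2 : |s| ^ (q - 2) = |s| ^ (q - 2 - 1) * |s| := by
      rw [← Real.rpow_add_one hpos.ne']; ring_nf
    simp only [id]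
    rw [e2]
    linear_combination q * (q - 2) * |s| ^ (q - 2 - 1) * e

lemma hasDerivAt_rpow_abs (hq : 2 < q) (s : ℝ) :
    HasDerivAt (fun s : ℝ => |s| ^ q) (q * |s| ^ (q - 2) * s) s :=
  hasDerivAt_abs_rpow s (by linarith)

lemma sq_rpow_abs_le (hq : 2 < q) (s : ℝ) :
    (q * |s| ^ (q - 2) * s) ^ 2 ≤ 2 * |s| ^ q * (q * (q - 1) * |s| ^ (q - 2)) := by
  rcases eq_or_ne s 0 with rfl | hs
  · simp only [abs_zero, mul_zero]
    rw [Real.zero_rpow (by linarith), Real.zero_rpow (by linarith)]; simp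
  have hpos : 0 < |s| := abs_pos.2 hs
  have e2 : |s| ^ q = |s| ^ (q - 2) * s ^ 2 := by
    rw [← sq_abs, ← Real.rpow_natCast, ← Real.rpow_add hpos]; norm_num
  rw [e2]
  have hA : 0 ≤ (|s| ^ (q - 2)) ^ 2 * s ^ 2 := by positivity
  nlinarith [mul_nonneg hA (show 0 ≤ q * (q - 2) by nlinarith)]

end PowerFunctions

section Energy

variable {r₀ : ℝ} {f : ℝ × ℝ → ℝ} {x : ℝ × ℝ}

lemma dFst_comp {φ : ℝ → ℝ} {φ' : ℝ} (hφ : HasDerivAt φ φ' (f x)) (hf : DifferentiableAt ℝ f x) :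
    dFst (fun y => φ (f y)) x = φ' * dFst f x := by
  have h := hφ.comp_hasFDerivAt x hf.hasFDerivAt
  have h : HasFDerivAt (fun y => φ (f y)) _ x := h
  rw [dFst, h.fderiv]; simp [dFst]

lemma dSnd_comp {φ : ℝ → ℝ} {φ' : ℝ} (hφ : HasDerivAt φ φ' (f x)) (hf : DifferentiableAt ℝ f x) :
    dSnd (fun y => φ (f y)) x = φ' * dSnd f x := by
  have h := hφ.comp_hasFDerivAt x hf.hasFDerivAt
  have h : HasFDerivAt (fun y => φ (f y)) _ x := h
  rw [dSnd, h.fderiv]; simp [dSnd]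

lemma integral_divergence_eq_zero {A B : ℝ} (hA : r₀ < A) (hAB : A ≤ B) {f g : ℝ × ℝ → ℝ}
    (hf : ∀ x ∈ halfPlane r₀, DifferentiableAt ℝ f x)
    (hg : ∀ x ∈ halfPlane r₀, DifferentiableAt ℝ g x)
    (hfA : ∀ z, f (A, z) = 0) (hfB : ∀ z, f (B, z) = 0) (hgp : ∀ r, g (r, π) = g (r, -π))
    (hi : ContinuousOn (fun x => dFst f x + dSnd g x) (Icc (A, -π) (B, π))) :
    ∫ x in Icc (A, -π) (B, π), (dFst f x + dSnd g x) = 0 := by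
  have hsub := Icc_subset_halfPlane hA B (-π) π
  have hle : ((A, -π) : ℝ × ℝ) ≤ (B, π) := ⟨hAB, by linarith [pi_pos]⟩
  have h := integral_divergence_prod_Icc_of_hasFDerivAt_of_le f g (fderiv ℝ f) (fderiv ℝ g)
    (A, -π) (B, π) hle (fun x hx => (hf x (hsub hx)).continuousAt.continuousWithinAt)
    (fun x hx => (hg x (hsub hx)).continuousAt.continuousWithinAt)
    (fun x hx => (hf x (hA.trans hx.1.1)).hasFDerivAt)
    (fun x hx => (hg x (hA.trans hx.1.1)).hasFDerivAt) (hi.integrableOn_compact isCompact_Icc)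
  refine h.trans ?_
  simp [hfA, hfB, hgp]

/-- Caccioppoli type estimate for a convex function of the scaled vorticity. -/
lemma MeridionalFlow.weighted_energy (hr₀ : 0 < r₀) {a w : ℝ × ℝ → ℝ}
    (h : MeridionalFlow r₀ a w) {φ φ₁ φ₂ : ℝ → ℝ} (hφ : ∀ s, HasDerivAt φ (φ₁ s) s)
    (hφ₁ : ∀ s, HasDerivAt φ₁ (φ₂ s) s) (hφ₂ : Continuous φ₂) (hφ0 : ∀ s, 0 ≤ φ s)
    (hφ₂0 : ∀ s, 0 ≤ φ₂ s) (hle : ∀ s, φ₁ s ^ 2 ≤ 2 * φ s * φ₂ s) {η η' : ℝ → ℝ}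
    (hη : ∀ r, HasDerivAt η (η' r) r) (hη' : Continuous η') {A B : ℝ} (hA : r₀ < A)
    (hAB : A ≤ B) (hηA : η A = 0) (hηB : η B = 0) :
    ∫ x in Icc (A, -π) (B, π), x.1 * φ₂ (scaledVorticity a w x) *
        (dFst (scaledVorticity a w) x ^ 2 + dSnd (scaledVorticity a w) x ^ 2) * η x.1 ^ 2 ≤
      2 * ∫ x in Icc (A, -π) (B, π), φ (scaledVorticity a w x) *
        (4 * x.1 * η' x.1 ^ 2 + 2 * |η x.1 * η' x.1| * (2 + x.1 * |x.1 * a x|)) := by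
  set Ω := scaledVorticity a w with hΩ
  have sΩ : ContDiffOn ℝ ∞ Ω (halfPlane r₀) := contDiffOn_scaledVorticity hr₀ h.smooth_a h.smooth_w
  have pΩ : ∀ x, Ω (x + (0, 2 * π)) = Ω x := by
    intro x
    simp [hΩ, scaledVorticity, dSnd_periodic h.periodic_a, dFst_periodic h.periodic_w]
  have hcη : Continuous η := continuous_iff_continuousAt.2 fun r => (hη r).continuousAt
  have hcφ : Continuous φ := continuous_iff_continuousAt.2 fun r => (hφ r).continuousAt
  have hcφ₁ : Continuous φ₁ := continuous_iff_continuousAt.2 fun r => (hφ₁ r).continuousAt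
  have d {f : ℝ × ℝ → ℝ} (hf : ContDiffOn ℝ ∞ f (halfPlane r₀)) {y : ℝ × ℝ}
    (hy : y ∈ halfPlane r₀) : DifferentiableAt ℝ f y := hf.differentiableAt_halfPlane hy
  obtain ⟨F, hF⟩ : ∃ F : ℝ × ℝ → ℝ, F = fun x => φ (Ω x) := ⟨_, rfl⟩
  obtain ⟨F₁, hF₁⟩ : ∃ F : ℝ × ℝ → ℝ, F = fun x => φ₁ (Ω x) := ⟨_, rfl⟩
  obtain ⟨F₂, hF₂⟩ : ∃ F : ℝ × ℝ → ℝ, F = fun x => φ₂ (Ω x) := ⟨_, rfl⟩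
  obtain ⟨E, hE⟩ : ∃ F : ℝ × ℝ → ℝ, F = fun x => η x.1 := ⟨_, rfl⟩
  obtain ⟨E', hE'⟩ : ∃ F : ℝ × ℝ → ℝ, F = fun x => η' x.1 := ⟨_, rfl⟩
  obtain ⟨g, hg⟩ : ∃ g : ℝ × ℝ → ℝ, g = fun x =>
    x.1 * (F₁ x * dFst Ω x) + 2 * F x - x.1 * (x.1 * a x) * F x := ⟨_, rfl⟩
  obtain ⟨K, hK⟩ : ∃ K : ℝ × ℝ → ℝ, K = fun x => w x * F x - F₁ x * dSnd Ω x := ⟨_, rfl⟩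
  have dF {y : ℝ × ℝ} (hy : y ∈ halfPlane r₀) : DifferentiableAt ℝ F y := by
    rw [hF]; exact ((hφ (Ω y)).comp_hasFDerivAt y (d sΩ hy).hasFDerivAt).differentiableAt
  have dF₁ {y : ℝ × ℝ} (hy : y ∈ halfPlane r₀) : DifferentiableAt ℝ F₁ y := by
    rw [hF₁]; exact ((hφ₁ (Ω y)).comp_hasFDerivAt y (d sΩ hy).hasFDerivAt).differentiableAt
  have dE (y : ℝ × ℝ) : DifferentiableAt ℝ E y := by
    rw [hE]
    exact ((hη y.1).comp_hasFDerivAt y (hasFDerivAt_fst (𝕜 := ℝ) (p := y))).differentiableAt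
  have dg {y : ℝ × ℝ} (hy : y ∈ halfPlane r₀) : DifferentiableAt ℝ g y := by
    have h1 := dF hy
    have h2 := dF₁ hy
    have h3 := d h.smooth_a hy
    have h4 := d sΩ.dFst hy
    rw [hg]
    fun_prop
  have dK {y : ℝ × ℝ} (hy : y ∈ halfPlane r₀) : DifferentiableAt ℝ K y := by
    have h1 := dF hy
    have h2 := dF₁ hy
    have h3 := d h.smooth_w hy
    have h4 := d sΩ.dSnd hy
    rw [hK]
    fun_prop
  have hgr : ∀ y ∈ halfPlane r₀, dFst g y =
      y.1 * F₂ y * (dFst Ω y ^ 2 + dSnd Ω y ^ 2) + y.1 * dSnd K y := by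
    intro y hy
    have hy0 : y.1 ≠ 0 := (hr₀.trans hy).ne'
    have h1 := dF hy
    have h2 := dF₁ hy
    have h3 := d h.smooth_a hy
    have h4 := d sΩ.dFst hy
    have h5 := d h.smooth_w hy
    have h6 := d sΩ.dSnd hy
    have e1 : dFst F y = F₁ y * dFst Ω y := by rw [hF, hF₁, dFst_comp (hφ (Ω y)) (d sΩ hy)]
    have e2 : dFst F₁ y = F₂ y * dFst Ω y := by rw [hF₁, hF₂, dFst_comp (hφ₁ (Ω y)) (d sΩ hy)]
    have e3 : dSnd F y = F₁ y * dSnd Ω y := by rw [hF, hF₁, dSnd_comp (hφ (Ω y)) (d sΩ hy)]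
    have e4 : dSnd F₁ y = F₂ y * dSnd Ω y := by rw [hF₁, hF₂, dSnd_comp (hφ₁ (Ω y)) (d sΩ hy)]
    rw [hg, hK]
    simp (disch := fun_prop) only [dFst_sub, dFst_add, dFst_mul, dFst_fst, dFst_const, dSnd_sub,
      dSnd_mul, e1, e2, e3, e4]
    have v := h.vorticity y hy
    rw [← hΩ] at v
    have i := h.incompressible y hy
    have hm : y.1 * y.1⁻¹ = 1 := mul_inv_cancel₀ hy0
    linear_combination (-F₁ y * y.1) * v - F y * y.1 * i - 3 * F₁ y * dFst Ω y * hm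
  obtain ⟨I, hI⟩ : ∃ I : ℝ × ℝ → ℝ, I = fun x =>
    x.1 * F₂ x * (dFst Ω x ^ 2 + dSnd Ω x ^ 2) * E x ^ 2 := ⟨_, rfl⟩
  obtain ⟨W, hW⟩ : ∃ W : ℝ × ℝ → ℝ, W = fun x => F x *
    (4 * x.1 * E' x ^ 2 + 2 * |E x * E' x| * (2 + x.1 * |x.1 * a x|)) := ⟨_, rfl⟩
  obtain ⟨J, hJ⟩ : ∃ J : ℝ × ℝ → ℝ, J = fun x => 2 * g x * (E x * E' x) := ⟨_, rfl⟩
  have hdiv : ∀ y ∈ halfPlane r₀, dFst (fun x => g x * (E x * E x)) y +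
      dSnd (fun x => -1 * (x.1 * (K x * (E x * E x)))) y = I y + J y := by
    intro y hy
    have h1 := dg hy
    have h2 := dK hy
    have h3 := dE y
    have e1 : dFst E y = E' y := by
      rw [hE, hE', dFst_comp (f := fun y => y.1) (hη y.1) (by fun_prop)]; simp
    have e2 : dSnd E y = 0 := by
      rw [hE, dSnd_comp (f := fun y => y.1) (hη y.1) (by fun_prop)]; simp
    simp (disch := fun_prop) only [dFst_mul, dSnd_mul, e1, e2, dSnd_fst, hgr y hy,
      dSnd_const]
    simp only [hI, hJ]
    ring
  have hsub := Icc_subset_halfPlane hA B (-π) π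
  have cΩ : ContinuousOn Ω (Icc (A, -π) (B, π)) := sΩ.continuousOn.mono hsub
  have cΩr := sΩ.dFst.continuousOn.mono hsub
  have cΩz := sΩ.dSnd.continuousOn.mono hsub
  have ca := h.smooth_a.continuousOn.mono hsub
  have cF : ContinuousOn F (Icc (A, -π) (B, π)) := hF ▸ hcφ.comp_continuousOn cΩ
  have cF₂ : ContinuousOn F₂ (Icc (A, -π) (B, π)) := hF₂ ▸ hφ₂.comp_continuousOn cΩ
  have cE : Continuous E := hE ▸ hcη.comp continuous_fst
  have cE' : Continuous E' := hE' ▸ hη'.comp continuous_fst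
  have cg : ContinuousOn g (Icc (A, -π) (B, π)) := fun y hy =>
    (dg (hsub hy)).continuousAt.continuousWithinAt
  have cI : ContinuousOn I (Icc (A, -π) (B, π)) := by rw [hI]; fun_prop
  have cW : ContinuousOn W (Icc (A, -π) (B, π)) := by rw [hW]; fun_prop
  have cJ : ContinuousOn J (Icc (A, -π) (B, π)) := by rw [hJ]; fun_prop
  have iI := cI.integrableOn_compact (μ := volume) isCompact_Icc
  have iW := cW.integrableOn_compact (μ := volume) isCompact_Icc
  have iJ := cJ.integrableOn_compact (μ := volume) isCompact_Icc
  have hz := integral_divergence_eq_zero hA hAB (f := fun x => g x * (E x * E x))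
    (g := fun x => -1 * (x.1 * (K x * (E x * E x))))
    (fun y hy => by have := dg hy; have := dE y; fun_prop)
    (fun y hy => by have := dK hy; have := dE y; fun_prop) (by simp [hE, hηA]) (by simp [hE, hηB])
    (fun r => by
      have hp : ((r, π) : ℝ × ℝ) = (r, -π) + (0, 2 * π) := by ext <;> simp; ring
      simp only [hK, hF, hF₁, hE]
      rw [hp, pΩ, h.periodic_w, dSnd_periodic pΩ])
    ((cI.add cJ).congr fun y hy => hdiv y (hsub hy))
  rw [setIntegral_congr_fun measurableSet_Icc fun y hy => hdiv y (hsub hy),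
    integral_add iI iJ] at hz
  have hmono : ∫ x in Icc (A, -π) (B, π), -J x ≤ ∫ x in Icc (A, -π) (B, π), (1 / 2 * I x + W x) := by
    refine setIntegral_mono_on iJ.neg ((iI.const_mul _).add iW) measurableSet_Icc fun y hy => ?_
    have hy0 : 0 < y.1 := hr₀.trans (hsub hy)
    have young : -(2 * (φ₁ (Ω y) * dFst Ω y * (η y.1 * η' y.1))) ≤
        1 / 2 * φ₂ (Ω y) * (dFst Ω y * η y.1) ^ 2 + 4 * φ (Ω y) * η' y.1 ^ 2 := by
      have p1 := hφ0 (Ω y)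
      have p2 := hφ₂0 (Ω y)
      refine le_trans (neg_le_abs _) (abs_le_of_sq_le_sq ?_ (by positivity))
      have := mul_le_mul_of_nonneg_right (hle (Ω y)) (sq_nonneg (dFst Ω y * η y.1 * η' y.1))
      nlinarith [sq_nonneg (1 / 2 * φ₂ (Ω y) * (dFst Ω y * η y.1) ^ 2 -
        4 * φ (Ω y) * η' y.1 ^ 2)]
    have t1 : -(2 * (2 * φ (Ω y) - y.1 * (y.1 * a y) * φ (Ω y)) * (η y.1 * η' y.1)) ≤
        φ (Ω y) * (2 * |η y.1 * η' y.1| * (2 + y.1 * |y.1 * a y|)) := by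
      refine le_trans (neg_le_abs _) (le_of_eq_of_le
        (b := φ (Ω y) * (2 * |η y.1 * η' y.1| * |2 - y.1 * (y.1 * a y)|)) ?_ ?_)
      · rw [show 2 * (2 * φ (Ω y) - y.1 * (y.1 * a y) * φ (Ω y)) * (η y.1 * η' y.1) =
          φ (Ω y) * (2 * (η y.1 * η' y.1) * (2 - y.1 * (y.1 * a y))) by ring]
        rw [abs_mul, abs_mul, abs_mul, abs_of_nonneg (hφ0 _), abs_two]
      · refine mul_le_mul_of_nonneg_left (mul_le_mul_of_nonneg_left ?_ (by positivity)) (hφ0 _)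
        refine (abs_sub _ _).trans (le_of_eq ?_)
        rw [abs_two, abs_mul y.1, abs_of_pos hy0]
    have p3 : 0 ≤ 1 / 2 * (y.1 * φ₂ (Ω y) * dSnd Ω y ^ 2 * η y.1 ^ 2) := by
      have := hφ₂0 (Ω y)
      positivity
    have := mul_le_mul_of_nonneg_left young hy0.le
    simp only [hJ, hI, hW, hg, hF, hF₁, hF₂, hE, hE']
    linarith
  have goal : ∫ x in Icc (A, -π) (B, π), I x ≤ 2 * ∫ x in Icc (A, -π) (B, π), W x := by
    rw [integral_neg, integral_add (iI.const_mul _) iW, integral_const_mul] at hmono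
    linarith
  simpa only [hI, hW, hF, hF₂, hE, hE'] using goal

end Energy

section Cutoff

/-- A cutoff function whose derivative is small wherever `h` is large. -/
lemma exists_cutoff {R C : ℝ} (hR : 0 < R) (hC : 0 ≤ C) {h : ℝ → ℝ} (hc : Continuous h)
    (h0 : ∀ r, 0 ≤ h r) (hint : ∫ r in R..4 * R, h r ≤ C * R ^ 2) :
    ∃ η η' : ℝ → ℝ, (∀ r, HasDerivAt η (η' r) r) ∧ Continuous η' ∧ η R = 0 ∧ η (4 * R) = 0 ∧
      (∀ r ∈ Icc R (4 * R), 0 ≤ η r ∧ η r ≤ 9 * R ^ 2 ∧ |η' r| ≤ 3 * R ∧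
        |η' r| * h r ≤ 3 * R ^ 2) ∧
      ∀ r ∈ Icc (2 * R) (3 * R), (R / (1 + C)) ^ 2 ≤ η r := by
  obtain ⟨k, hk⟩ : ∃ k : ℝ → ℝ, ∀ r, k r = R / (R + h r) := ⟨_, fun _ => rfl⟩
  have hpos : ∀ r, 0 < R + h r := fun r => by linarith [h0 r]
  have kc : Continuous k := by
    rw [funext hk]
    exact continuous_const.div (continuous_const.add hc) fun r => (hpos r).ne'
  have k0 : ∀ r, 0 ≤ k r := fun r => hk r ▸ (div_nonneg hR.le (hpos r).le)
  have k1 : ∀ r, k r ≤ 1 := fun r => by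
    rw [hk, div_le_one (hpos r)]; linarith [h0 r]
  have kh : ∀ r, k r * h r ≤ R := fun r => by
    rw [hk, div_mul_eq_mul_div, div_le_iff₀ (hpos r)]; nlinarith [h0 r]
  have ki : ∀ x y, IntervalIntegrable k volume x y := fun x y => kc.intervalIntegrable x y
  have hi : ∀ x y, IntervalIntegrable h volume x y := fun x y => hc.intervalIntegrable x y
  have hlow : ∀ x, R ≤ x → x + R ≤ 4 * R → R / (1 + C) ≤ ∫ r in x..x + R, k r := by
    intro x hx hx'
    obtain ⟨s, hs⟩ : ∃ s : ℝ, s = 1 / (1 + C) := ⟨_, rfl⟩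
    have hsC : s * (1 + C) = 1 := by rw [hs]; field_simp
    have e1 : ∫ r in x..x + R, (2 * s - s ^ 2 - s ^ 2 / R * h r) ≤ ∫ r in x..x + R, k r := by
      refine intervalIntegral.integral_mono_on (by linarith)
        ((continuous_const.sub (continuous_const.mul hc)).intervalIntegrable _ _) (ki _ _)
        fun r _ => ?_
      have : k r - (2 * s - s ^ 2 - s ^ 2 / R * h r) = (R - s * (R + h r)) ^ 2 / (R * (R + h r)) := by
        rw [hk]
        have := (hpos r).ne'
        field_simp
        ring
      have h2 : 0 ≤ (R - s * (R + h r)) ^ 2 / (R * (R + h r)) :=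
        div_nonneg (sq_nonneg _) (mul_pos hR (hpos r)).le
      linarith
    have e2 : ∫ r in x..x + R, h r ≤ ∫ r in R..4 * R, h r :=
      intervalIntegral.integral_mono_interval hx (by linarith) hx' (ae_of_all _ h0) (hi _ _)
    rw [intervalIntegral.integral_sub intervalIntegrable_const ((hi _ _).const_mul _),
      intervalIntegral.integral_const, intervalIntegral.integral_const_mul, smul_eq_mul] at e1
    have e3 : s ^ 2 / R * ∫ r in x..x + R, h r ≤ s ^ 2 / R * (C * R ^ 2) :=
      mul_le_mul_of_nonneg_left (e2.trans hint) (by positivity)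
    have e4 : s ^ 2 / R * (C * R ^ 2) = s ^ 2 * C * R := by field_simp
    have e5 : R / (1 + C) = s * R := by rw [hs]; ring
    have e6 : s ^ 2 + s ^ 2 * C = s := by linear_combination s * hsC
    rw [e5]
    nlinarith
  have hup : ∀ x y, x ≤ y → y - x ≤ 3 * R → 0 ≤ (∫ r in x..y, k r) ∧ (∫ r in x..y, k r) ≤ 3 * R := by
    intro x y hxy hd
    refine ⟨intervalIntegral.integral_nonneg hxy fun r _ => k0 r, ?_⟩
    have := intervalIntegral.integral_mono_on hxy (ki x y) (intervalIntegrable_const (c := (1 : ℝ)))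
      fun r _ => k1 r
    simp only [intervalIntegral.integral_const, smul_eq_mul, mul_one] at this
    linarith
  obtain ⟨T, hT⟩ : ∃ T : ℝ → ℝ, ∀ r, T r = ∫ t in R..r, k t := ⟨_, fun _ => rfl⟩
  obtain ⟨S, hS⟩ : ∃ S : ℝ → ℝ, ∀ r, S r = ∫ t in r..4 * R, k t := ⟨_, fun _ => rfl⟩
  have dT : ∀ r, HasDerivAt T (k r) r := fun r => by
    rw [funext hT]; exact (kc.integral_hasStrictDerivAt R r).hasDerivAt
  have dS : ∀ r, HasDerivAt S (-k r) r := fun r => by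
    have := (kc.integral_hasStrictDerivAt (4 * R) r).hasDerivAt.neg
    refine this.congr_of_eventuallyEq (Eventually.of_forall fun t => ?_)
    rw [hS, intervalIntegral.integral_symm]; rfl
  have cT : Continuous T := continuous_iff_continuousAt.2 fun r => (dT r).continuousAt
  have cS : Continuous S := continuous_iff_continuousAt.2 fun r => (dS r).continuousAt
  have bT : ∀ r ∈ Icc R (4 * R), 0 ≤ T r ∧ T r ≤ 3 * R := fun r hr => by
    rw [hT]; exact hup _ _ hr.1 (by linarith [hr.2])
  have bS : ∀ r ∈ Icc R (4 * R), 0 ≤ S r ∧ S r ≤ 3 * R := fun r hr => by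
    rw [hS]; exact hup _ _ hr.2 (by linarith [hr.1])
  refine ⟨fun r => T r * S r, fun r => k r * S r + T r * -k r, fun r => (dT r).mul (dS r),
    by fun_prop, by simp [hT], by simp [hS], fun r hr => ?_, fun r hr => ?_⟩
  · obtain ⟨t0, t1⟩ := bT r hr
    obtain ⟨s0, s1⟩ := bS r hr
    have e : |k r * S r + T r * -k r| = k r * |S r - T r| := by
      rw [show k r * S r + T r * -k r = k r * (S r - T r) by ring, abs_mul, abs_of_nonneg (k0 r)]
    have e' : |S r - T r| ≤ 3 * R := abs_le.2 ⟨by linarith, by linarith⟩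
    refine ⟨mul_nonneg t0 s0, by nlinarith, ?_, ?_⟩
    · rw [e]; nlinarith [k0 r, k1 r, abs_nonneg (S r - T r)]
    · rw [e]
      have := mul_le_mul (kh r) e' (abs_nonneg _) hR.le
      nlinarith
  · have hT' : R / (1 + C) ≤ T r := by
      refine (hlow R le_rfl (by linarith)).trans ?_
      rw [hT]
      exact intervalIntegral.integral_mono_interval le_rfl (by linarith) (by linarith [hr.1])
        (ae_of_all _ k0) (ki _ _)
    have hS' : R / (1 + C) ≤ S r := by
      refine (hlow (3 * R) (by linarith) (by linarith)).trans ?_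
      rw [hS]
      exact intervalIntegral.integral_mono_interval hr.2 (by linarith) (by linarith)
        (ae_of_all _ k0) (ki _ _)
    have : 0 ≤ R / (1 + C) := by positivity
    rw [pow_two]
    exact mul_le_mul hT' hS' this (this.trans hT')

end Cutoff

section Slices

/-- One-dimensional Sobolev inequality on a period interval. -/
lemma abs_le_integral_abs_add_abs_deriv {f f' : ℝ → ℝ} (hf : ∀ z, HasDerivAt f (f' z) z)
    (hf' : Continuous f') {z : ℝ} (hz : z ∈ Icc (-π) π) :
    |f z| ≤ ∫ y in (-π)..π, (|f y| + |f' y|) := by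
  have hπ := pi_pos
  have hc : Continuous f := continuous_iff_continuousAt.2 fun r => (hf r).continuousAt
  have i1 : ∀ x y, IntervalIntegrable (fun y => |f y|) volume x y := fun x y =>
    hc.abs.intervalIntegrable x y
  have i2 : ∀ x y, IntervalIntegrable (fun y => |f' y|) volume x y := fun x y =>
    hf'.abs.intervalIntegrable x y
  have h1 : ∀ y ∈ Icc (-π) π, |f z| ≤ |f y| + ∫ t in (-π)..π, |f' t| := by
    intro y hy
    have e : ∫ t in y..z, f' t = f z - f y :=
      intervalIntegral.integral_eq_sub_of_hasDerivAt (fun x _ => hf x) (hf'.intervalIntegrable _ _)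
    have e2 : |∫ t in y..z, f' t| ≤ ∫ t in (-π)..π, |f' t| := by
      refine (intervalIntegral.norm_integral_le_integral_norm_uIoc (f := f')).trans ?_
      simp only [Real.norm_eq_abs]
      rw [intervalIntegral.integral_of_le (by linarith)]
      refine setIntegral_mono_set (i2 _ _).1 (ae_of_all _ fun _ => abs_nonneg _) ?_
      refine (Ioc_subset_Ioc ?_ ?_).eventuallyLE
      · exact le_min hy.1 hz.1
      · exact max_le hy.2 hz.2
    rw [e] at e2
    have := abs_sub_abs_le_abs_sub (f z) (f y)
    linarith
  have h2 := intervalIntegral.integral_mono_on (by linarith : -π ≤ π)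
    (intervalIntegrable_const (c := |f z|)) ((i1 _ _).add intervalIntegrable_const) h1
  rw [intervalIntegral.integral_add (i1 _ _) intervalIntegrable_const,
    intervalIntegral.integral_const, intervalIntegral.integral_const, smul_eq_mul,
    smul_eq_mul] at h2
  rw [intervalIntegral.integral_add (i1 _ _) (i2 _ _)]
  have h3 : 0 ≤ ∫ y in (-π)..π, |f y| :=
    intervalIntegral.integral_nonneg (by linarith) fun _ _ => abs_nonneg _
  have h4 : (π - -π) * |f z| ≤ (π - -π) * ((∫ y in (-π)..π, |f y|) + ∫ y in (-π)..π, |f' y|) := by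
    nlinarith [pi_gt_three]
  exact le_of_mul_le_mul_left h4 (by linarith)

variable {A B : ℝ} {F : ℝ × ℝ → ℝ}

lemma integral_Icc_prod_eq (hAB : A ≤ B) (hF : ContinuousOn F (Icc (A, -π) (B, π))) :
    ∫ x in Icc (A, -π) (B, π), F x = ∫ r in A..B, ∫ z in (-π)..π, F (r, z) := by
  have hi := hF.integrableOn_compact (μ := volume) isCompact_Icc
  rw [Icc_prod_eq, Measure.volume_eq_prod] at *
  rw [setIntegral_prod _ hi, intervalIntegral.integral_of_le hAB, integral_Icc_eq_integral_Ioc]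
  refine setIntegral_congr_fun measurableSet_Ioc fun r _ => ?_
  rw [intervalIntegral.integral_of_le (by linarith [pi_pos]), integral_Icc_eq_integral_Ioc]

lemma exists_slice_integral_le (hAB : A < B) (hF : ContinuousOn F (Icc (A, -π) (B, π))) :
    ∃ r ∈ Icc A B, (B - A) * ∫ z in (-π)..π, F (r, z) ≤ ∫ x in Icc (A, -π) (B, π), F x := by
  rw [integral_Icc_prod_eq hAB.le hF]
  have hi := hF.integrableOn_compact (μ := volume) isCompact_Icc
  rw [Icc_prod_eq, Measure.volume_eq_prod, IntegrableOn, ← Measure.prod_restrict] at hi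
  have h1 := hi.integral_prod_left
  have h2 : IntegrableOn (fun r => ∫ z in (-π)..π, F (r, z)) (Icc A B) := by
    refine h1.congr (ae_of_all _ fun r => ?_)
    simp only []
    rw [intervalIntegral.integral_of_le (by linarith [pi_pos]), integral_Icc_eq_integral_Ioc]
  obtain ⟨r, hr, hle⟩ := exists_le_setAverage (μ := volume) (s := Icc A B) (by simp [hAB]) (by simp) h2
  refine ⟨r, hr, ?_⟩
  rw [setAverage_eq, smul_eq_mul, integral_Icc_eq_integral_Ioc,
    ← intervalIntegral.integral_of_le hAB.le] at hle
  have hv : volume.real (Icc A B) = B - A := by simp [Measure.real, hAB.le]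
  rw [hv] at hle
  have := mul_le_mul_of_nonneg_left hle (sub_pos.2 hAB).le
  rwa [← mul_assoc, mul_inv_cancel₀ (sub_pos.2 hAB).ne', one_mul] at this

end Slices

section PointwiseBounds

variable {q : ℝ}

lemma sqrt_le_one_add_rpow (hq : 2 < q) {t : ℝ} (ht : 0 ≤ t) : √t ≤ 1 + t ^ (q / 2) := by
  rcases le_total t 1 with h | h
  · have : √t ≤ 1 := Real.sqrt_le_one.2 h
    have := Real.rpow_nonneg ht (q / 2)
    linarith
  · have := Real.rpow_le_rpow_of_exponent_le h (show (1 / 2 : ℝ) ≤ q / 2 by linarith)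
    rw [← Real.sqrt_eq_rpow] at this
    linarith

variable {a w : ℝ × ℝ → ℝ} {x : ℝ × ℝ}

lemma abs_quotient_le (hq : 2 < q) (a w : ℝ × ℝ → ℝ) (x : ℝ × ℝ) :
    |a x| ≤ 1 + meridionalGradSq a w x ^ (q / 2) := by
  refine le_trans ?_ (sqrt_le_one_add_rpow hq (meridionalGradSq_nonneg a w x))
  refine Real.abs_le_sqrt ?_
  unfold meridionalGradSq
  nlinarith [sq_nonneg (x.1 * dSnd a x), sq_nonneg (dFst w x)]

lemma abs_mul_dSnd_le (hq : 2 < q) (a w : ℝ × ℝ → ℝ) (x : ℝ × ℝ) :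
    |x.1 * dSnd a x| ≤ 1 + meridionalGradSq a w x ^ (q / 2) := by
  refine le_trans ?_ (sqrt_le_one_add_rpow hq (meridionalGradSq_nonneg a w x))
  refine Real.abs_le_sqrt ?_
  unfold meridionalGradSq
  nlinarith [sq_nonneg (a x), sq_nonneg (dFst w x)]

lemma rpow_abs_scaledVorticity_le (hq : 2 < q) (a w : ℝ × ℝ → ℝ) {R : ℝ} (hR : 0 < R)
    (hx : R ≤ x.1) : |scaledVorticity a w x| ^ q ≤
      2 ^ (q / 2) * R ^ (-(q + 1)) * (x.1 * meridionalGradSq a w x ^ (q / 2)) := by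
  have hx0 : 0 < x.1 := hR.trans_le hx
  have hN := meridionalGradSq_nonneg a w x
  have h1 : |scaledVorticity a w x| ≤ √(2 * meridionalGradSq a w x) * x.1⁻¹ := by
    have e : scaledVorticity a w x = (x.1 * dSnd a x - dFst w x) * x.1⁻¹ := by
      unfold scaledVorticity; field_simp
    rw [e, abs_mul, abs_of_pos (inv_pos.2 hx0)]
    refine mul_le_mul_of_nonneg_right (Real.abs_le_sqrt ?_) (inv_pos.2 hx0).le
    unfold meridionalGradSq
    nlinarith [sq_nonneg (x.1 * dSnd a x + dFst w x), sq_nonneg (a x)]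
  refine (Real.rpow_le_rpow (abs_nonneg _) h1 (by linarith)).trans ?_
  rw [Real.mul_rpow (Real.sqrt_nonneg _) (inv_pos.2 hx0).le, Real.sqrt_eq_rpow,
    ← Real.rpow_mul (by positivity), Real.mul_rpow (by norm_num) hN,
    show 1 / 2 * q = q / 2 by ring, Real.inv_rpow hx0.le, ← Real.rpow_neg hx0.le]
  have e : x.1 ^ (-q) = x.1 ^ (-(q + 1)) * x.1 := by
    rw [← Real.rpow_add_one hx0.ne']; ring_nf
  have h2 : x.1 ^ (-(q + 1)) ≤ R ^ (-(q + 1)) :=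
    Real.rpow_le_rpow_of_nonpos hR hx (by linarith)
  rw [e]
  have hp : 0 ≤ 2 ^ (q / 2) * meridionalGradSq a w x ^ (q / 2) * x.1 :=
    mul_nonneg (mul_nonneg (by positivity) (Real.rpow_nonneg hN _)) hx0.le
  nlinarith [mul_le_mul_of_nonneg_left h2 hp]

end PointwiseBounds

section GoodRadius

variable {r₀ q M R : ℝ} {a w : ℝ × ℝ → ℝ}

lemma exists_radial_majorant (hr₀ : 0 < r₀) (hq : 2 < q)
    (ha : ContDiffOn ℝ ∞ a (halfPlane r₀)) (hw : ContDiffOn ℝ ∞ w (halfPlane r₀)) (hM0 : 0 ≤ M)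
    (hM : ∀ A B : ℝ, r₀ < A →
      ∫ x in Icc (A, -π) (B, π), x.1 * meridionalGradSq a w x ^ (q / 2) ≤ M)
    (hR : 1 ≤ R) (hR₀ : r₀ < R) :
    ∃ g : ℝ → ℝ, Continuous g ∧ (∀ r, 0 ≤ g r) ∧
      (∀ r, R ≤ r → ∀ z ∈ Icc (-π) π, |r * a (r, z)| ≤ g r) ∧
      ∫ r in R..4 * R, g r ≤ (48 * π + 2 * M) * R ^ 2 := by
  have hπ := pi_pos
  obtain ⟨U, hU⟩ : ∃ U : ℝ × ℝ → ℝ, ∀ x, U x = |x.1 * a x| + |x.1 * dSnd a x| := ⟨_, fun _ => rfl⟩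
  have ca := ha.continuousOn
  have caz := ha.dSnd.continuousOn
  have cU : ContinuousOn U (halfPlane r₀) := by rw [funext hU]; fun_prop
  have hsub := Icc_subset_halfPlane hR₀ (4 * R) (-π) π
  refine ⟨fun r => ∫ z in (-π)..π, U (max r R, z), ?_, ?_, ?_, ?_⟩
  · refine intervalIntegral.continuous_parametric_intervalIntegral_of_continuous' ?_ _ _
    exact cU.comp_continuous (f := fun p : ℝ × ℝ => (max p.1 R, p.2)) (by fun_prop)
      fun p => lt_of_lt_of_le hR₀ (le_max_right _ _)
  · intro r
    refine intervalIntegral.integral_nonneg (by linarith) fun z _ => ?_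
    rw [hU]; positivity
  · intro r hr z hz
    have hr' : ∀ z, ((r, z) : ℝ × ℝ) ∈ halfPlane r₀ := fun z => hR₀.trans_le hr
    have := abs_le_integral_abs_add_abs_deriv (f := fun z => r * a (r, z))
      (f' := fun z => r * dSnd a (r, z))
      (fun z => (hasDerivAt_dSnd (ha.differentiableAt_halfPlane (hr' z))).const_mul r)
      (continuous_const.mul (caz.comp_continuous (by fun_prop) hr')) hz
    simpa only [max_eq_left hr, hU] using this
  · have e : ∫ r in R..4 * R, ∫ z in (-π)..π, U (max r R, z) =
        ∫ x in Icc (R, -π) (4 * R, π), U x := by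
      rw [integral_Icc_prod_eq (by linarith) (cU.mono hsub)]
      refine intervalIntegral.integral_congr fun r hr => ?_
      rw [uIcc_of_le (by linarith)] at hr
      simp only [max_eq_left hr.1]
    rw [e]
    have cN := (continuousOn_meridionalGradSq_rpow hq ha hw).mono hsub
    have cN' : ContinuousOn (fun x : ℝ × ℝ => x.1 * meridionalGradSq a w x ^ (q / 2))
      (Icc (R, -π) (4 * R, π)) := continuousOn_fst.mul cN
    have iN := cN'.integrableOn_compact (μ := volume) isCompact_Icc
    have ic : IntegrableOn (fun _ : ℝ × ℝ => 8 * R) (Icc (R, -π) (4 * R, π)) :=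
      continuousOn_const.integrableOn_compact isCompact_Icc
    have hle : ∫ x in Icc (R, -π) (4 * R, π), U x ≤ ∫ x in Icc (R, -π) (4 * R, π),
        (8 * R + 2 * (x.1 * meridionalGradSq a w x ^ (q / 2))) := by
      refine setIntegral_mono_on ((cU.mono hsub).integrableOn_compact isCompact_Icc)
        (ic.add (iN.const_mul 2)) measurableSet_Icc fun x hx => ?_
      have x1 : R ≤ x.1 := hx.1.1
      have x2 : x.1 ≤ 4 * R := hx.2.1
      have h1 := abs_quotient_le hq a w x
      have h2 := abs_mul_dSnd_le hq a w x
      have h3 := Real.rpow_nonneg (meridionalGradSq_nonneg a w x) (q / 2)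
      rw [hU, abs_mul x.1 (a x), abs_of_pos (by linarith)]
      nlinarith
    refine hle.trans ?_
    rw [integral_add ic (iN.const_mul 2), setIntegral_const, smul_eq_mul, integral_const_mul]
    have hv : volume.real (Icc ((R, -π) : ℝ × ℝ) (4 * R, π)) = 3 * R * (2 * π) := by
      rw [Measure.real, Icc_prod_eq, Measure.volume_eq_prod, Measure.prod_prod, Real.volume_Icc,
        Real.volume_Icc, ENNReal.toReal_mul, ENNReal.toReal_ofReal (by simp; linarith),
        ENNReal.toReal_ofReal (by simp; linarith)]
      simp only []
      ring
    rw [hv]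
    have h1 := hM R (4 * R) hR₀
    have h2 : 1 ≤ R ^ 2 := one_le_pow₀ hR
    nlinarith

/-- On some circle in each dyadic annulus the scaled vorticity has the expected decay. -/
lemma MeridionalFlow.exists_good_radius (hr₀ : 0 < r₀) (hq : 2 < q) (h : MeridionalFlow r₀ a w)
    (hM0 : 0 ≤ M) (hM : ∀ A B : ℝ, r₀ < A →
      ∫ x in Icc (A, -π) (B, π), x.1 * meridionalGradSq a w x ^ (q / 2) ≤ M) :
    ∃ C : ℝ, 0 ≤ C ∧ ∀ R, 1 ≤ R → r₀ < R → ∃ r ∈ Icc (2 * R) (3 * R), ∀ z ∈ Icc (-π) π,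
      |scaledVorticity a w (r, z)| ≤ C * R ^ (-(1 + 2 / q)) := by
  have hπ := pi_pos
  obtain ⟨X, hX⟩ : ∃ X : ℝ, X = 2 ^ (q / 2) * M := ⟨_, rfl⟩
  have hX0 : 0 ≤ X := by rw [hX]; positivity
  obtain ⟨C₁, hC₁⟩ : ∃ C : ℝ, C = 48 * π + 2 * M := ⟨_, rfl⟩
  have hC₁0 : 0 ≤ C₁ := by rw [hC₁]; positivity
  obtain ⟨Y, hY⟩ : ∃ Y : ℝ, Y = 2 * (X + 936 * X * (1 + C₁) ^ 4) := ⟨_, rfl⟩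
  have hY0 : 0 ≤ Y := by rw [hY]; positivity
  refine ⟨Y ^ (1 / q), by positivity, fun R hR hR₀ => ?_⟩
  have hRpos : 0 < R := by linarith
  obtain ⟨g, gc, g0, gu, gi⟩ := exists_radial_majorant hr₀ hq h.smooth_a h.smooth_w hM0 hM hR hR₀
  rw [← hC₁] at gi
  obtain ⟨η, η', dη, cη', ηR, ηR', bη, lη⟩ := exists_cutoff hRpos hC₁0 gc g0 gi
  set Ω := scaledVorticity a w with hΩ
  have sΩ : ContDiffOn ℝ ∞ Ω (halfPlane r₀) := contDiffOn_scaledVorticity hr₀ h.smooth_a h.smooth_w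
  have energy := h.weighted_energy hr₀ (hasDerivAt_rpow_abs hq)
    (hasDerivAt_rpow_abs_mul_self hq)
    (continuous_const.mul (continuous_abs.rpow_const fun _ => Or.inr (by linarith)))
    (fun s => Real.rpow_nonneg (abs_nonneg s) q)
    (fun s => mul_nonneg (by nlinarith) (Real.rpow_nonneg (abs_nonneg s) _)) (sq_rpow_abs_le hq)
    dη cη' hR₀ (by linarith : R ≤ 4 * R) ηR ηR'
  rw [← hΩ] at energy
  obtain ⟨P, hP⟩ : ∃ P : ℝ × ℝ → ℝ, ∀ x, P x = |Ω x| ^ q := ⟨_, fun _ => rfl⟩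
  obtain ⟨Q, hQ⟩ : ∃ P : ℝ × ℝ → ℝ, ∀ x, P x = q * (q - 1) * |Ω x| ^ (q - 2) := ⟨_, fun _ => rfl⟩
  simp only [← hP, ← hQ] at energy
  have P0 : ∀ x, 0 ≤ P x := fun x => by rw [hP]; positivity
  have Q0 : ∀ x, 0 ≤ Q x := fun x => by
    rw [hQ]; exact mul_nonneg (by nlinarith) (Real.rpow_nonneg (abs_nonneg _) _)
  have cη : Continuous η := continuous_iff_continuousAt.2 fun r => (dη r).continuousAt
  have hsub := Icc_subset_halfPlane hR₀ (4 * R) (-π) π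
  have cΩ := sΩ.continuousOn
  have cΩr := sΩ.dFst.continuousOn
  have cΩz := sΩ.dSnd.continuousOn
  have ca := h.smooth_a.continuousOn
  have cP : ContinuousOn P (halfPlane r₀) := by
    rw [funext hP]; exact cΩ.abs.rpow_const fun _ _ => Or.inr (by linarith)
  have cQ : ContinuousOn Q (halfPlane r₀) := by
    rw [funext hQ]
    exact continuousOn_const.mul (cΩ.abs.rpow_const fun _ _ => Or.inr (by linarith))
  have int : ∀ {f : ℝ × ℝ → ℝ}, ContinuousOn f (halfPlane r₀) →
      IntegrableOn f (Icc (R, -π) (4 * R, π)) := fun hf =>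
    (hf.mono hsub).integrableOn_compact isCompact_Icc
  have cN : ContinuousOn (fun x : ℝ × ℝ => x.1 * meridionalGradSq a w x ^ (q / 2))
    (halfPlane r₀) :=
    continuousOn_fst.mul (continuousOn_meridionalGradSq_rpow hq h.smooth_a h.smooth_w)
  have hPint : ∫ x in Icc (R, -π) (4 * R, π), P x ≤ X * R ^ (-(q + 1)) := by
    have h1 : ∫ x in Icc (R, -π) (4 * R, π), P x ≤ ∫ x in Icc (R, -π) (4 * R, π),
        2 ^ (q / 2) * R ^ (-(q + 1)) * (x.1 * meridionalGradSq a w x ^ (q / 2)) := by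
      refine setIntegral_mono_on (int cP) ((int cN).const_mul _) measurableSet_Icc fun x hx => ?_
      rw [hP]
      exact rpow_abs_scaledVorticity_le hq a w hRpos hx.1.1
    rw [integral_const_mul] at h1
    have h2 := mul_le_mul_of_nonneg_left (hM R (4 * R) hR₀)
      (show 0 ≤ 2 ^ (q / 2) * R ^ (-(q + 1)) by positivity)
    rw [hX]
    linarith
  have hW : ∫ x in Icc (R, -π) (4 * R, π), P x *
      (4 * x.1 * η' x.1 ^ 2 + 2 * |η x.1 * η' x.1| * (2 + x.1 * |x.1 * a x|)) ≤
      468 * R ^ 5 * (X * R ^ (-(q + 1))) := by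
    refine le_trans ?_ (mul_le_mul_of_nonneg_left hPint (by positivity))
    rw [← integral_const_mul]
    refine setIntegral_mono_on (int ?_) ((int cP).const_mul _) measurableSet_Icc fun x hx => ?_
    · have c1 : Continuous fun x : ℝ × ℝ => η x.1 := cη.comp continuous_fst
      have c2 : Continuous fun x : ℝ × ℝ => η' x.1 := cη'.comp continuous_fst
      exact cP.mul (((continuous_const.mul continuous_fst).mul (c2.pow 2)).continuousOn.add
        ((continuous_const.mul (c1.mul c2).abs).continuousOn.mul
          (continuousOn_const.add (continuousOn_fst.mul (continuousOn_fst.mul ca).abs))))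
    · have x1 : R ≤ x.1 := hx.1.1
      have x2 : x.1 ≤ 4 * R := hx.2.1
      obtain ⟨b1, b2, b3, b4⟩ := bη x.1 ⟨x1, x2⟩
      have b5 : |x.1 * a x| ≤ g x.1 := gu x.1 x1 x.2 ⟨hx.1.2, hx.2.2⟩
      rw [mul_comm]
      refine mul_le_mul_of_nonneg_right ?_ (P0 x)
      rw [abs_mul, abs_of_nonneg b1, ← sq_abs (η' x.1)]
      have t1 : |η' x.1| * |x.1 * a x| ≤ 3 * R ^ 2 :=
        (mul_le_mul_of_nonneg_left b5 (abs_nonneg _)).trans b4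
      have t2 : |η' x.1| ^ 2 ≤ (3 * R) ^ 2 := pow_le_pow_left₀ (abs_nonneg _) b3 2
      have t3 : x.1 * |η' x.1| ^ 2 ≤ 4 * R * (3 * R) ^ 2 :=
        mul_le_mul x2 t2 (by positivity) (by positivity)
      have t4 : x.1 * (|η' x.1| * |x.1 * a x|) ≤ 4 * R * (3 * R ^ 2) :=
        mul_le_mul x2 t1 (by positivity) (by positivity)
      have t5 : η x.1 * (2 * |η' x.1| + x.1 * (|η' x.1| * |x.1 * a x|)) ≤
          9 * R ^ 2 * (2 * (3 * R) + 4 * R * (3 * R ^ 2)) :=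
        mul_le_mul b2 (by linarith) (by have : 0 ≤ x.1 := by linarith
                                        positivity) (by positivity)
      have t6 : R ^ 3 ≤ R ^ 5 := pow_le_pow_right₀ hR (by norm_num)
      nlinarith
  have hsub' : Icc ((2 * R, -π) : ℝ × ℝ) (3 * R, π) ⊆ Icc (R, -π) (4 * R, π) :=
    Icc_subset_Icc ⟨by simp; linarith, le_rfl⟩ ⟨by simp; linarith, le_rfl⟩
  have cQz : ContinuousOn (fun x : ℝ × ℝ => Q x * dSnd Ω x ^ 2) (halfPlane r₀) :=
    cQ.mul (cΩz.pow 2)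
  have hQint : ∫ x in Icc ((2 * R, -π) : ℝ × ℝ) (3 * R, π), Q x * dSnd Ω x ^ 2 ≤
      936 * X * (1 + C₁) ^ 4 * R ^ (-(q + 1)) := by
    have cI : ContinuousOn (fun x : ℝ × ℝ => x.1 * Q x * (dFst Ω x ^ 2 + dSnd Ω x ^ 2) *
        η x.1 ^ 2) (halfPlane r₀) := by
      have c1 : Continuous fun x : ℝ × ℝ => η x.1 := cη.comp continuous_fst
      exact ((continuousOn_fst.mul cQ).mul ((cΩr.pow 2).add (cΩz.pow 2))).mul (c1.pow 2).continuousOn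
    have h1 : R * (R / (1 + C₁)) ^ 4 *
        ∫ x in Icc ((2 * R, -π) : ℝ × ℝ) (3 * R, π), Q x * dSnd Ω x ^ 2 ≤
        ∫ x in Icc ((2 * R, -π) : ℝ × ℝ) (3 * R, π),
          x.1 * Q x * (dFst Ω x ^ 2 + dSnd Ω x ^ 2) * η x.1 ^ 2 := by
      rw [← integral_const_mul]
      refine setIntegral_mono_on (((int cQz).mono_set hsub').const_mul _)
        ((int cI).mono_set hsub') measurableSet_Icc fun x hx => ?_
      have x1 : R ≤ x.1 := by have : 2 * R ≤ x.1 := hx.1.1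
                              linarith
      have l1 : (R / (1 + C₁)) ^ 2 ≤ η x.1 := lη x.1 ⟨hx.1.1, hx.2.1⟩
      have l2 : ((R / (1 + C₁)) ^ 2) ^ 2 ≤ η x.1 ^ 2 := pow_le_pow_left₀ (by positivity) l1 2
      have l3 : R * ((R / (1 + C₁)) ^ 2) ^ 2 ≤ x.1 * η x.1 ^ 2 :=
        mul_le_mul x1 l2 (by positivity) (by linarith)
      have q0 := Q0 x
      have l4 := mul_le_mul_of_nonneg_right l3 (show 0 ≤ Q x * dSnd Ω x ^ 2 by positivity)
      have l5 : 0 ≤ x.1 * η x.1 ^ 2 * (Q x * dFst Ω x ^ 2) := by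
        have : 0 ≤ x.1 := by linarith
        positivity
      nlinarith
    have h2 : ∫ x in Icc ((2 * R, -π) : ℝ × ℝ) (3 * R, π),
        x.1 * Q x * (dFst Ω x ^ 2 + dSnd Ω x ^ 2) * η x.1 ^ 2 ≤
        ∫ x in Icc (R, -π) (4 * R, π), x.1 * Q x * (dFst Ω x ^ 2 + dSnd Ω x ^ 2) * η x.1 ^ 2 := by
      refine setIntegral_mono_set (int cI)
        ((ae_restrict_iff' measurableSet_Icc).2 (ae_of_all _ fun x hx => ?_)) hsub'.eventuallyLE
      have x1 : R ≤ x.1 := hx.1.1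
      have q0 := Q0 x
      have : 0 ≤ x.1 := by linarith
      simp only [Pi.zero_apply]
      positivity
    have h3 := (h1.trans h2).trans (energy.trans (mul_le_mul_of_nonneg_left hW zero_le_two))
    have h4 : R * (R / (1 + C₁)) ^ 4 = R ^ 5 / (1 + C₁) ^ 4 := by rw [div_pow]; ring
    rw [h4, div_mul_eq_mul_div, div_le_iff₀ (by positivity)] at h3
    have h5 : R ^ 5 * ∫ x in Icc ((2 * R, -π) : ℝ × ℝ) (3 * R, π), Q x * dSnd Ω x ^ 2 ≤
        R ^ 5 * (936 * X * (1 + C₁) ^ 4 * R ^ (-(q + 1))) := by linarith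
    exact le_of_mul_le_mul_left h5 (by positivity)
  have cS : ContinuousOn (fun x : ℝ × ℝ => P x + Q x * dSnd Ω x ^ 2) (halfPlane r₀) :=
    cP.add cQz
  obtain ⟨r, hr, hrle⟩ := exists_slice_integral_le (by linarith : 2 * R < 3 * R)
    ((cS.mono hsub).mono hsub')
  refine ⟨r, hr, fun z hz => ?_⟩
  have hr' : ∀ z, ((r, z) : ℝ × ℝ) ∈ halfPlane r₀ := fun z => by
    have : 2 * R ≤ r := hr.1
    change r₀ < r
    linarith
  rw [integral_add ((int cP).mono_set hsub')
    ((int cQz).mono_set hsub')] at hrle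
  have hPint' : ∫ x in Icc ((2 * R, -π) : ℝ × ℝ) (3 * R, π), P x ≤ X * R ^ (-(q + 1)) :=
    (setIntegral_mono_set (int cP) (ae_of_all _ P0) hsub'.eventuallyLE).trans hPint
  have slice : ∀ {f : ℝ × ℝ → ℝ}, ContinuousOn f (halfPlane r₀) → Continuous fun z => f (r, z) :=
    fun hf => hf.comp_continuous (by fun_prop) hr'
  have sob := abs_le_integral_abs_add_abs_deriv (f := fun z => |Ω (r, z)| ^ q)
    (f' := fun z => q * |Ω (r, z)| ^ (q - 2) * Ω (r, z) * dSnd Ω (r, z))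
    (fun z => HasDerivAt.comp (h₂ := fun s => |s| ^ q) (h := fun z => Ω (r, z)) z
      (hasDerivAt_rpow_abs hq (Ω (r, z)))
      (hasDerivAt_dSnd (sΩ.differentiableAt_halfPlane (hr' z))))
    (((continuous_const.mul ((slice cΩ).abs.rpow_const fun _ => Or.inr (by linarith))).mul
      (slice cΩ)).mul (slice cΩz)) hz
  have hle : ∫ y in (-π)..π, (|(|Ω (r, y)| ^ q)| +
      |q * |Ω (r, y)| ^ (q - 2) * Ω (r, y) * dSnd Ω (r, y)|) ≤
      ∫ y in (-π)..π, 2 * (P (r, y) + Q (r, y) * dSnd Ω (r, y) ^ 2) := by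
    refine intervalIntegral.integral_mono_on (by linarith) (Continuous.intervalIntegrable
      (((slice cΩ).abs.rpow_const fun _ => Or.inr (by linarith)).abs.add
      (((continuous_const.mul ((slice cΩ).abs.rpow_const fun _ => Or.inr (by linarith))).mul
      (slice cΩ)).mul (slice cΩz)).abs) _ _)
      (Continuous.intervalIntegrable (continuous_const.mul (slice cS)) _ _) fun y _ => ?_
    have p0 := P0 (r, y)
    have q0 := Q0 (r, y)
    have s1 := sq_rpow_abs_le hq (Ω (r, y))
    rw [← hP, ← hQ] at s1
    have s2 : |q * |Ω (r, y)| ^ (q - 2) * Ω (r, y) * dSnd Ω (r, y)| ≤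
        P (r, y) + Q (r, y) * dSnd Ω (r, y) ^ 2 := by
      refine abs_le_of_sq_le_sq ?_ (by positivity)
      rw [mul_pow]
      have := mul_le_mul_of_nonneg_right s1 (sq_nonneg (dSnd Ω (r, y)))
      nlinarith [sq_nonneg (P (r, y)), sq_nonneg (Q (r, y) * dSnd Ω (r, y) ^ 2)]
    rw [← hP, abs_of_nonneg p0]
    have : 0 ≤ Q (r, y) * dSnd Ω (r, y) ^ 2 := by positivity
    linarith
  rw [intervalIntegral.integral_const_mul] at hle
  rw [abs_of_nonneg (by positivity)] at sob
  have e1 : R ^ (-(q + 1)) = R * R ^ (-(q + 2)) := by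
    rw [mul_comm, ← Real.rpow_add_one hRpos.ne']; ring_nf
  have h6 : R * ∫ z in (-π)..π, (P (r, z) + Q (r, z) * dSnd Ω (r, z) ^ 2) ≤
      R * ((X + 936 * X * (1 + C₁) ^ 4) * R ^ (-(q + 2))) := by
    rw [e1] at hPint' hQint
    linarith
  have h7 : |Ω (r, z)| ^ q ≤ Y * R ^ (-(q + 2)) := by
    have := le_of_mul_le_mul_left h6 hRpos
    rw [hY]
    linarith
  have h8 := Real.rpow_le_rpow (by positivity) h7 (show 0 ≤ 1 / q by positivity)
  rw [← Real.rpow_mul (abs_nonneg _), mul_one_div_cancel (by linarith), Real.rpow_one,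
    Real.mul_rpow hY0 (by positivity), ← Real.rpow_mul hRpos.le] at h8
  have e2 : -(q + 2) * (1 / q) = -(1 + 2 / q) := by
    have : q ≠ 0 := by linarith
    field_simp
  rwa [e2] at h8

end GoodRadius

section MaximumPrinciple

/-- First and second order necessary conditions at a local maximum. -/
lemma IsLocalMax.second_deriv_nonpos {g g' : ℝ → ℝ} {t c : ℝ} (hmax : IsLocalMax g t)
    (hg : ∀ᶠ s in 𝓝 t, HasDerivAt g (g' s) s) (hg' : HasDerivAt g' c t) : g' t = 0 ∧ c ≤ 0 := by
  have h0 : g' t = 0 := hmax.hasDerivAt_eq_zero hg.self_of_nhds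
  refine ⟨h0, ?_⟩
  by_contra! hc
  have hd : deriv g =ᶠ[𝓝 t] g' := hg.mono fun s hs => hs.deriv
  have hmin : IsLocalMin g t := by
    refine isLocalMin_of_deriv_deriv_pos ?_ ?_ hg.self_of_nhds.continuousAt
    · rw [hd.deriv_eq, hg'.deriv]; exact hc
    · rw [hd.self_of_nhds, h0]
  have hconst : g =ᶠ[𝓝 t] fun _ => g t := by
    filter_upwards [hmax, hmin] with s h1 h2
    exact le_antisymm h1 h2
  have h1 : deriv g =ᶠ[𝓝 t] deriv fun _ => g t := hconst.deriv
  have h2 := (hd.symm.trans h1).deriv_eq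
  rw [hg'.deriv] at h2
  simp at h2
  exact hc.ne' h2

variable {r₀ r₁ r₂ K : ℝ}

lemma le_of_elliptic (hr₀ : 0 < r₀) {f b w : ℝ × ℝ → ℝ} (hf : ContDiffOn ℝ ∞ f (halfPlane r₀))
    (hfp : ∀ x, f (x + (0, 2 * π)) = f x) (hb : ContinuousOn b (halfPlane r₀))
    (heq : ∀ x ∈ halfPlane r₀, b x * dFst f x + w x * dSnd f x =
      dFst (dFst f) x + 3 * dFst f x * x.1⁻¹ + dSnd (dSnd f) x)
    (hr₁ : r₀ < r₁) (h₁ : ∀ z ∈ Icc (-π) π, f (r₁, z) ≤ K)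
    (h₂ : ∀ z ∈ Icc (-π) π, f (r₂, z) ≤ K) {x : ℝ × ℝ} (hx : x ∈ Icc (r₁, -π) (r₂, π)) :
    f x ≤ K := by
  by_contra! hcon
  have hsub := Icc_subset_halfPlane hr₁ r₂ (-π) π
  obtain ⟨L, hL⟩ := isCompact_Icc.exists_bound_of_continuousOn (hb.mono hsub)
  obtain ⟨l, hl⟩ : ∃ l : ℝ, l = |L| + 1 := ⟨_, rfl⟩
  have hl0 : 0 < l := by rw [hl]; positivity
  obtain ⟨ε, hε⟩ : ∃ ε : ℝ, ε = (f x - K) / (2 * exp (l * r₂)) := ⟨_, rfl⟩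
  have hε0 : 0 < ε := by rw [hε]; exact div_pos (by linarith) (by positivity)
  have hεE : ε * exp (l * r₂) = (f x - K) / 2 := by
    rw [hε]; field_simp
  obtain ⟨F, hF⟩ : ∃ F : ℝ × ℝ → ℝ, ∀ y, F y = f y + ε * exp (l * y.1) := ⟨_, fun _ => rfl⟩
  have cF : ContinuousOn F (Icc (r₁, -π) (r₂, π)) := by
    rw [funext hF]
    exact (hf.continuousOn.mono hsub).add (by fun_prop)
  obtain ⟨y, hy, hmax⟩ := isCompact_Icc.exists_isMaxOn ⟨x, hx⟩ cF
  have hFy : K + ε * exp (l * r₂) < F y := by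
    have h1 : F x ≤ F y := hmax hx
    have h2 : F x = f x + ε * exp (l * x.1) := hF x
    have : 0 < ε * exp (l * x.1) := by positivity
    linarith
  have hyz : y.2 ∈ Icc (-π) π := ⟨hy.1.2, hy.2.2⟩
  have hr12 : r₁ ≤ r₂ := le_trans hx.1.1 hx.2.1
  have hy1 : r₁ < y.1 := by
    refine lt_of_le_of_ne hy.1.1 fun hne => ?_
    have e : F y = f (r₁, y.2) + ε * exp (l * r₁) := by rw [hF, hne]
    have := h₁ y.2 hyz
    have h3 : exp (l * r₁) ≤ exp (l * r₂) := exp_le_exp.2 (by gcongr)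
    have := mul_le_mul_of_nonneg_left h3 hε0.le
    linarith
  have hy2 : y.1 < r₂ := by
    refine lt_of_le_of_ne hy.2.1 fun hne => ?_
    have e : F y = f (r₂, y.2) + ε * exp (l * r₂) := by rw [hF, ← hne]
    have := h₂ y.2 hyz
    linarith
  have hyH : y ∈ halfPlane r₀ := hsub hy
  have near : ∀ᶠ s in 𝓝 y.1, s ∈ Ioo r₁ r₂ := Ioo_mem_nhds hy1 hy2
  have mr : IsLocalMax (fun s => f (s, y.2) + ε * exp (l * s)) y.1 := by
    filter_upwards [near] with s hs
    have : F (s, y.2) ≤ F y := hmax ⟨⟨hs.1.le, hyz.1⟩, ⟨hs.2.le, hyz.2⟩⟩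
    simpa only [hF] using this
  have mz : IsLocalMax (fun t => f (y.1, t)) y.2 := by
    refine Eventually.of_forall fun t => ?_
    have hper : Function.Periodic (fun t => f (y.1, t)) (2 * π) := fun t => by
      simpa using hfp (y.1, t)
    obtain ⟨s, hs, hst⟩ := hper.exists_mem_Ioc (by positivity) t (-π)
    have : F (y.1, s) ≤ F y := hmax ⟨⟨hy1.le, hs.1.le⟩, ⟨hy2.le, by
      have := hs.2; simp only []; linarith⟩⟩
    simp only [hF] at this
    have hst' : f (y.1, t) = f (y.1, s) := hst
    change f (y.1, t) ≤ f y
    rw [hst']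
    linarith
  have e1 : ∀ s, HasDerivAt (fun s => ε * exp (l * s)) (ε * l * exp (l * s)) s := fun s => by
    refine ((((hasDerivAt_id s).const_mul l).exp).const_mul ε).congr_deriv ?_
    simp only [id]
    ring
  have e2 : HasDerivAt (fun s => ε * l * exp (l * s)) (ε * l ^ 2 * exp (l * y.1)) y.1 := by
    refine ((((hasDerivAt_id y.1).const_mul l).exp).const_mul (ε * l)).congr_deriv ?_
    simp only [id]
    ring
  obtain ⟨d1, d2⟩ := mr.second_deriv_nonpos (g' := fun s => dFst f (s, y.2) + ε * l * exp (l * s))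
    (near.mono fun s hs => (hasDerivAt_dFst (x := (s, y.2))
      (hf.differentiableAt_halfPlane (hr₁.trans hs.1))).add (e1 s))
    ((hasDerivAt_dFst (hf.dFst.differentiableAt_halfPlane hyH)).add e2)
  obtain ⟨d3, d4⟩ := mz.second_deriv_nonpos (g' := fun t => dSnd f (y.1, t))
    (Eventually.of_forall fun t => hasDerivAt_dSnd (x := (y.1, t))
      (hf.differentiableAt_halfPlane hyH))
    (hasDerivAt_dSnd (hf.dSnd.differentiableAt_halfPlane hyH))
  have heqy := heq y hyH
  have hby : b y < l := by
    have h1 := hL y hy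
    rw [Real.norm_eq_abs] at h1
    have h2 := le_abs_self (b y)
    have h3 := le_abs_self L
    rw [hl]
    linarith
  have hy0 : 0 < y.1⁻¹ := inv_pos.2 (hr₀.trans hyH)
  have hE : 0 < ε * l * exp (l * y.1) := by positivity
  have d1' : dFst f y = -(ε * l * exp (l * y.1)) := by linarith
  have d3' : dSnd f y = 0 := d3
  rw [d1', d3'] at heqy
  have t1 := mul_pos hE (sub_pos.2 hby)
  have t2 := mul_pos hE hy0
  nlinarith

lemma MeridionalFlow.abs_scaledVorticity_le (hr₀ : 0 < r₀) {a w : ℝ × ℝ → ℝ}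
    (h : MeridionalFlow r₀ a w) (hr₁ : r₀ < r₁)
    (h₁ : ∀ z ∈ Icc (-π) π, |scaledVorticity a w (r₁, z)| ≤ K)
    (h₂ : ∀ z ∈ Icc (-π) π, |scaledVorticity a w (r₂, z)| ≤ K) {x : ℝ × ℝ}
    (hx : x ∈ Icc (r₁, -π) (r₂, π)) : |scaledVorticity a w x| ≤ K := by
  have sΩ := contDiffOn_scaledVorticity hr₀ h.smooth_a h.smooth_w
  have pΩ : ∀ x, scaledVorticity a w (x + (0, 2 * π)) = scaledVorticity a w x := by
    intro x
    simp [scaledVorticity, dSnd_periodic h.periodic_a, dFst_periodic h.periodic_w]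
  have cb : ContinuousOn (fun x : ℝ × ℝ => x.1 * a x) (halfPlane r₀) :=
    continuousOn_fst.mul h.smooth_a.continuousOn
  have nr : ∀ f : ℝ × ℝ → ℝ, dFst (fun y => -f y) = fun y => -dFst f y := fun f => by
    ext y; simp [dFst, fderiv_fun_neg]
  have nz : ∀ f : ℝ × ℝ → ℝ, dSnd (fun y => -f y) = fun y => -dSnd f y := fun f => by
    ext y; simp [dSnd, fderiv_fun_neg]
  refine abs_le.2 ⟨?_, ?_⟩
  · have := le_of_elliptic (K := K) hr₀ (f := fun y => -scaledVorticity a w y) (w := w) sΩ.neg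
      (fun x => by simp only [pΩ]) cb
      (fun y hy => by
        simp only [nr, nz]
        linear_combination -h.vorticity y hy)
      hr₁ (fun z hz => (neg_le_abs _).trans (h₁ z hz)) (fun z hz => (neg_le_abs _).trans (h₂ z hz)) hx
    linarith
  · exact le_of_elliptic hr₀ sΩ pΩ cb h.vorticity hr₁ (fun z hz => (le_abs_self _).trans (h₁ z hz))
      (fun z hz => (le_abs_self _).trans (h₂ z hz)) hx

end MaximumPrinciple

/-- decay of `Ω` in Theorem 1.1 for `q > 2`:
`r^{1 + 2/q − 1/q²} sup_z |Ω(r,z)| → 0` as `r → ∞`. -/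
theorem Omega_decay_q_gt_two (r₀ q : ℝ) (hr₀ : 0 < r₀) (hq : 2 < q)
    (v : E3 → E3) (p : E3 → ℝ) (vr vz : ℝ → ℝ → ℝ)
    (hsol : AxisymNoSwirlNSSlab r₀ v p vr vz)
    (hdiri : ∫⁻ x : E3 in {x : E3 | r₀ < rr x ∧ x 2 ∈ Icc (-π) π},
      ENNReal.ofReal ((gradSq3 v x) ^ (q / 2)) < ⊤) :
    Tendsto
      (fun r : ℝ => r ^ (1 + 2 / q - 1 / q ^ 2) *
        ⨆ z : (Icc (-π) π : Set ℝ), |Om vr vz r (z : ℝ)|)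
      atTop (𝓝 0) := by
  have hflow := hsol.meridionalFlow hr₀
  obtain ⟨M, hM⟩ := (hsol.isCylindrical hr₀).exists_integral_le hr₀ hq hdiri
  obtain ⟨C, hC0, hC⟩ := hflow.exists_good_radius hr₀ hq (le_max_right M 0)
    fun A B hA => (hM A B hA).trans (le_max_left M 0)
  have hq0 : 0 < q := by linarith
  have hneg : -(1 + 2 / q) ≤ 0 := by
    have : 0 < 2 / q := by positivity
    linarith
  have hbound : ∀ r, 3 ≤ r → 3 * r₀ < r →
      ⨆ z : (Icc (-π) π : Set ℝ), |Om vr vz r (z : ℝ)| ≤ C * (r / 3) ^ (-(1 + 2 / q)) := by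
    intro r h3 h3r
    obtain ⟨r₁, hr₁, hz₁⟩ := hC (r / 3) (by linarith) (by linarith)
    obtain ⟨r₂, hr₂, hz₂⟩ := hC (r / 2) (by linarith) (by linarith)
    have hle : C * (r / 2) ^ (-(1 + 2 / q)) ≤ C * (r / 3) ^ (-(1 + 2 / q)) :=
      mul_le_mul_of_nonneg_left
        (rpow_le_rpow_of_nonpos (by linarith) (by linarith) hneg) hC0
    have : Nonempty (Icc (-π) π : Set ℝ) := ⟨⟨0, by constructor <;> linarith [pi_pos]⟩⟩
    refine ciSup_le fun z => ?_
    rw [hsol.Om_eq hr₀ (y := (r, (z : ℝ))) (show r₀ < r by linarith)]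
    refine hflow.abs_scaledVorticity_le hr₀ (r₁ := r₁) (r₂ := r₂) ?_ hz₁
      (fun t ht => (hz₂ t ht).trans hle) ⟨⟨?_, z.2.1⟩, ⟨?_, z.2.2⟩⟩
    · linarith [hr₁.1]
    · change r₁ ≤ r
      linarith [hr₁.2]
    · change r ≤ r₂
      linarith [hr₂.1]
  have hlim : Tendsto (fun r : ℝ => C * (3 : ℝ) ^ (1 + 2 / q) * r ^ (-(1 / q ^ 2))) atTop (𝓝 0) := by
    have ht := (tendsto_rpow_neg_atTop (y := 1 / q ^ 2) (by positivity)).const_mul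
      (C * (3 : ℝ) ^ (1 + 2 / q))
    rwa [mul_zero] at ht
  refine squeeze_zero' ?_ ?_ hlim
  · filter_upwards [eventually_ge_atTop 0] with r hr
    exact mul_nonneg (rpow_nonneg hr _) (Real.iSup_nonneg fun _ => abs_nonneg _)
  · filter_upwards [eventually_ge_atTop 3, eventually_gt_atTop (3 * r₀)] with r h3 h3r
    have hr : 0 < r := by linarith
    refine (mul_le_mul_of_nonneg_left (hbound r h3 h3r) (rpow_nonneg hr.le _)).trans_eq ?_
    have e : r ^ (1 + 2 / q - 1 / q ^ 2) = r ^ (1 + 2 / q) * r ^ (-(1 / q ^ 2)) := by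
      rw [← rpow_add hr, sub_eq_add_neg]
    rw [e, div_rpow hr.le (by norm_num), rpow_neg hr.le (1 + 2 / q),
      rpow_neg (by norm_num : (0 : ℝ) ≤ 3)]
    have : r ^ (1 + 2 / q) ≠ 0 := (rpow_pos_of_pos hr _).ne'
    field_simp
end
end
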